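/- Let d ≥ 2, and let α_1, …, α_{d−1}, 1 be real algebraic numbers that are linearly independent over ℚ. Let L_1, …, L_{d−1} be linearly independent linear forms of d−1 variables with real algebraic coefficients. Then for any ε > 0 the inequality ‖α_1 n_1 + ⋯ + α_{d−1} n_{d−1}‖ · ∏_{k=1}^{d−1} (|L_k(n)| + 1) < |n|^{−ε} has only finitely many integer solutions n ∈ ℤ^{d−1}. -/

import Mathlib

open Real

/-- Distance from a real number to the nearest integer. -/
noncomputable def nint (x : ℝ) : ℝ := |x - round x|

/-- Euclidean norm of an integer vector. -/
noncomputable def znorm {m : ℕ} (n : Fin m → ℤ) : ℝ := Real.sqrt (∑ i, ((n i : ℝ)) ^ 2)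

namespace SchmidtSubspace

open MvPolynomial

section WeightedNorm

variable {σ R : Type*} [CommRing R]

/-- The weighted `ℓ¹` norm of a polynomial: the sum over its monomials of the seminorm `ν` of the
coefficient times the value of the monomial at the weight vector `w`. -/
noncomputable def wnorm (ν : RingSeminorm R) (w : σ → ℝ) (f : MvPolynomial σ R) : ℝ :=
  ∑ k ∈ f.support, ν (f.coeff k) * k.prod fun i n => w i ^ n

variable {ν : RingSeminorm R} {w : σ → ℝ}

lemma monomial_weight_nonneg (hw : ∀ i, 0 ≤ w i) (k : σ →₀ ℕ) :
    0 ≤ k.prod fun i n => w i ^ n :=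
  Finset.prod_nonneg fun i _ => pow_nonneg (hw i) _

lemma wnorm_nonneg (hw : ∀ i, 0 ≤ w i) (f : MvPolynomial σ R) : 0 ≤ wnorm ν w f :=
  Finset.sum_nonneg fun k _ => mul_nonneg (apply_nonneg ν _) (monomial_weight_nonneg hw k)

lemma wnorm_eq_sum_of_support_subset (f : MvPolynomial σ R) {s : Finset (σ →₀ ℕ)}
    (hs : f.support ⊆ s) :
    wnorm ν w f = ∑ k ∈ s, ν (f.coeff k) * k.prod fun i n => w i ^ n := by
  refine Finset.sum_subset hs fun k _ hk => ?_
  rw [notMem_support_iff.1 hk, map_zero, zero_mul]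

lemma coeff_mul_weight_le_wnorm (hw : ∀ i, 0 ≤ w i) (f : MvPolynomial σ R) (k : σ →₀ ℕ) :
    ν (f.coeff k) * (k.prod fun i n => w i ^ n) ≤ wnorm ν w f := by
  by_cases hk : k ∈ f.support
  · exact Finset.single_le_sum (f := fun k => ν (f.coeff k) * k.prod fun i n => w i ^ n)
      (fun k _ => mul_nonneg (apply_nonneg ν _) (monomial_weight_nonneg hw k)) hk
  · rw [notMem_support_iff.1 hk, map_zero, zero_mul]
    exact wnorm_nonneg hw f

@[simp] lemma wnorm_zero : wnorm ν w (0 : MvPolynomial σ R) = 0 := by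
  simp [wnorm]

lemma wnorm_add_le (hw : ∀ i, 0 ≤ w i) (f g : MvPolynomial σ R) :
    wnorm ν w (f + g) ≤ wnorm ν w f + wnorm ν w g := by
  classical
  rw [wnorm_eq_sum_of_support_subset (f + g) support_add,
    wnorm_eq_sum_of_support_subset f (Finset.subset_union_left (s₂ := g.support)),
    wnorm_eq_sum_of_support_subset g (Finset.subset_union_right (s₁ := f.support)),
    ← Finset.sum_add_distrib]
  refine Finset.sum_le_sum fun k _ => ?_
  rw [← add_mul, coeff_add]
  exact mul_le_mul_of_nonneg_right (map_add_le_add ν _ _) (monomial_weight_nonneg hw k)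

lemma wnorm_sum_le (hw : ∀ i, 0 ≤ w i) {α : Type*} (s : Finset α) (f : α → MvPolynomial σ R) :
    wnorm ν w (∑ a ∈ s, f a) ≤ ∑ a ∈ s, wnorm ν w (f a) := by
  classical
  induction s using Finset.induction_on with
  | empty => simp
  | insert a s ha ih =>
    rw [Finset.sum_insert ha, Finset.sum_insert ha]
    exact (wnorm_add_le hw _ _).trans (by gcongr)

lemma wnorm_monomial (k : σ →₀ ℕ) (c : R) :
    wnorm ν w (monomial k c) = ν c * k.prod fun i n => w i ^ n := by
  classical
  rw [wnorm_eq_sum_of_support_subset _ support_monomial_subset]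
  simp

lemma wnorm_neg (f : MvPolynomial σ R) : wnorm ν w (-f) = wnorm ν w f := by
  simp [wnorm, support_neg]

lemma wnorm_mul_le (hw : ∀ i, 0 ≤ w i) (f g : MvPolynomial σ R) :
    wnorm ν w (f * g) ≤ wnorm ν w f * wnorm ν w g := by
  classical
  conv_lhs => rw [f.as_sum, g.as_sum, Finset.sum_mul_sum]
  refine (wnorm_sum_le hw _ _).trans ?_
  rw [wnorm, wnorm, Finset.sum_mul_sum]
  refine Finset.sum_le_sum fun k _ => (wnorm_sum_le hw _ _).trans (Finset.sum_le_sum fun l _ => ?_)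
  rw [monomial_mul, wnorm_monomial, Finsupp.prod_add_index' (by simp) (by simp [pow_add])]
  calc ν (coeff k f * coeff l g) * ((k.prod fun i n => w i ^ n) * l.prod fun i n => w i ^ n)
      ≤ (ν (coeff k f) * ν (coeff l g)) *
          ((k.prod fun i n => w i ^ n) * l.prod fun i n => w i ^ n) := by
        refine mul_le_mul_of_nonneg_right (map_mul_le_mul ν _ _) ?_
        exact mul_nonneg (monomial_weight_nonneg hw k) (monomial_weight_nonneg hw l)
    _ = _ := by ring

lemma wnorm_one_le (h1 : ν 1 ≤ 1) : wnorm ν w (1 : MvPolynomial σ R) ≤ 1 := by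
  have := wnorm_monomial (ν := ν) (w := w) (0 : σ →₀ ℕ) 1
  rw [show (1 : MvPolynomial σ R) = monomial 0 1 from rfl, this]
  simpa using h1

lemma wnorm_prod_le (h1 : ν 1 ≤ 1) (hw : ∀ i, 0 ≤ w i) {α : Type*} (s : Finset α)
    (f : α → MvPolynomial σ R) :
    wnorm ν w (∏ a ∈ s, f a) ≤ ∏ a ∈ s, wnorm ν w (f a) := by
  classical
  induction s using Finset.induction_on with
  | empty => simpa using wnorm_one_le h1
  | insert a s ha ih =>
    rw [Finset.prod_insert ha, Finset.prod_insert ha]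
    exact (wnorm_mul_le hw _ _).trans (mul_le_mul_of_nonneg_left ih (wnorm_nonneg hw _))

lemma wnorm_pow_le (h1 : ν 1 ≤ 1) (hw : ∀ i, 0 ≤ w i) (f : MvPolynomial σ R) (n : ℕ) :
    wnorm ν w (f ^ n) ≤ wnorm ν w f ^ n := by
  simpa using wnorm_prod_le h1 hw (Finset.range n) (fun _ => f)

lemma wnorm_C_mul_X (c : R) (i : σ) : wnorm ν w (C c * X i) = ν c * w i := by
  rw [C_mul_X_eq_monomial, wnorm_monomial]
  simp

/-- The weighted norm of a substitution. -/
lemma wnorm_aeval_le {τ : Type*} {S : Type*} [CommRing S] [Algebra S R]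
    (h1 : ν 1 ≤ 1) (hw : ∀ i, 0 ≤ w i) (μ : RingSeminorm S)
    (hμ : ∀ s : S, ν (algebraMap S R s) ≤ μ s)
    (g : τ → MvPolynomial σ R) (f : MvPolynomial τ S) :
    wnorm ν w (aeval g f) ≤ wnorm μ (fun i => wnorm ν w (g i)) f := by
  classical
  rw [aeval_def, eval₂_eq]
  refine (wnorm_sum_le hw _ _).trans (Finset.sum_le_sum fun k _ => ?_)
  refine (wnorm_mul_le hw _ _).trans ?_
  have hC : wnorm ν w (algebraMap S (MvPolynomial σ R) (coeff k f)) ≤ μ (coeff k f) := by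
    rw [IsScalarTower.algebraMap_apply S R (MvPolynomial σ R), algebraMap_eq,
      ← monomial_zero', wnorm_monomial]
    simpa using hμ _
  refine mul_le_mul hC ?_ (wnorm_nonneg hw _) (apply_nonneg μ _)
  exact (wnorm_prod_le h1 hw _ _).trans
    (Finset.prod_le_prod (fun _ _ => wnorm_nonneg hw _) fun i _ => wnorm_pow_le h1 hw _ _)

lemma wnorm_mono_weight {w' : σ → ℝ} (hw : ∀ i, 0 ≤ w i) (hww : ∀ i, w i ≤ w' i)
    (f : MvPolynomial σ R) : wnorm ν w f ≤ wnorm ν w' f := by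
  refine Finset.sum_le_sum fun k _ => mul_le_mul_of_nonneg_left ?_ (apply_nonneg ν _)
  exact Finset.prod_le_prod (fun i _ => pow_nonneg (hw i) _)
    fun i _ => pow_le_pow_left₀ (hw i) (hww i) _

end WeightedNorm

/-- The `ℓ¹` norm of an integer polynomial. -/
noncomputable def inorm {σ : Type*} (f : MvPolynomial σ ℤ) : ℝ :=
  wnorm (normRingSeminorm ℤ) (fun _ => 1) f

/-- The `ℓ¹` norm of a real polynomial. -/
noncomputable def rnorm {σ : Type*} (f : MvPolynomial σ ℝ) : ℝ :=
  wnorm (normRingSeminorm ℝ) (fun _ => 1) f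

lemma normRingSeminorm_int (a : ℤ) : normRingSeminorm ℤ a = |((a : ℤ) : ℝ)| :=
  Int.norm_eq_abs a

lemma normRingSeminorm_real (a : ℝ) : normRingSeminorm ℝ a = |a| := rfl

lemma inorm_eq {σ : Type*} (f : MvPolynomial σ ℤ) :
    inorm f = ∑ k ∈ f.support, |((f.coeff k : ℤ) : ℝ)| := by
  simp [inorm, wnorm, normRingSeminorm_int, Finsupp.prod]

lemma rnorm_eq {σ : Type*} (f : MvPolynomial σ ℝ) :
    rnorm f = ∑ k ∈ f.support, |f.coeff k| := by
  simp [rnorm, wnorm, normRingSeminorm_real, Finsupp.prod]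

lemma abs_coeff_le_inorm {σ : Type*} (f : MvPolynomial σ ℤ) (k : σ →₀ ℕ) :
    |((f.coeff k : ℤ) : ℝ)| ≤ inorm f := by
  have := coeff_mul_weight_le_wnorm (ν := normRingSeminorm ℤ) (w := fun _ : σ => (1 : ℝ))
    (by simp) f k
  simpa [normRingSeminorm_int, Finsupp.prod, inorm] using this

lemma one_le_inorm {σ : Type*} {f : MvPolynomial σ ℤ} (hf : f ≠ 0) : 1 ≤ inorm f := by
  obtain ⟨k, hk⟩ := MvPolynomial.ne_zero_iff.1 hf
  refine le_trans ?_ (abs_coeff_le_inorm f k)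
  exact_mod_cast Int.one_le_abs hk

lemma inorm_nonneg {σ : Type*} (f : MvPolynomial σ ℤ) : 0 ≤ inorm f :=
  wnorm_nonneg (by simp) f

end SchmidtSubspace

namespace SchmidtSubspace

section Chernoff

lemma sum_exp_le_of_mean_zero {α : Type*} (S : Finset α) (X : α → ℝ) (h1 : ∀ a ∈ S, |X a| ≤ 1)
    (h0 : ∑ a ∈ S, X a = 0) {s : ℝ} (hs : |s| ≤ 1) :
    ∑ a ∈ S, Real.exp (s * X a) ≤ S.card * Real.exp (s ^ 2) := by
  have key : ∀ a ∈ S, Real.exp (s * X a) ≤ 1 + s * X a + s ^ 2 := by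
    intro a ha
    have hsx : |s * X a| ≤ 1 := by
      rw [abs_mul]; exact mul_le_one₀ hs (abs_nonneg _) (h1 a ha)
    have := (abs_le.1 (Real.abs_exp_sub_one_sub_id_le hsx)).2
    have hX : (X a) ^ 2 ≤ 1 := (sq_le_one_iff_abs_le_one _).2 (h1 a ha)
    nlinarith [sq_nonneg s]
  refine (Finset.sum_le_sum key).trans ?_
  rw [Finset.sum_add_distrib, Finset.sum_add_distrib, ← Finset.mul_sum, h0]
  simp only [Finset.sum_const, nsmul_eq_mul]
  have := Real.add_one_le_exp (s ^ 2)
  nlinarith [(Nat.cast_nonneg S.card : (0 : ℝ) ≤ S.card)]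

/-- A Chernoff bound for sums of independent bounded centred variables on finite sets. -/
lemma card_filter_lt_sum_le {α : Type*} {m : ℕ} (S : Fin m → Finset α)
    (X : Fin m → α → ℝ) (h1 : ∀ h, ∀ a ∈ S h, |X h a| ≤ 1)
    (h0 : ∀ h, ∑ a ∈ S h, X h a = 0) {η : ℝ} (hη : 0 < η) (hη2 : η ≤ 2) :
    (((Fintype.piFinset S).filter fun I => η * m < ∑ h, X h (I h)).card : ℝ) ≤
      Real.exp (-(m * η ^ 2 / 4)) * ∏ h, ((S h).card : ℝ) := by
  classical
  set s := η / 2 with hs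
  have hs1 : |s| ≤ 1 := by rw [abs_of_pos (by positivity)]; linarith
  have hsum : ∑ I ∈ Fintype.piFinset S, Real.exp (s * ∑ h, X h (I h)) ≤
      (∏ h, ((S h).card : ℝ)) * Real.exp (m * s ^ 2) := by
    have : ∀ I : Fin m → α, Real.exp (s * ∑ h, X h (I h)) = ∏ h, Real.exp (s * X h (I h)) := by
      intro I
      rw [Finset.mul_sum, Real.exp_sum]
    simp_rw [this]
    rw [← Finset.prod_univ_sum S fun h a => Real.exp (s * X h a)]
    refine (Finset.prod_le_prod (fun h _ => Finset.sum_nonneg fun a _ => (Real.exp_pos _).le)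
      fun h _ => sum_exp_le_of_mean_zero (S h) (X h) (h1 h) (h0 h) hs1).trans ?_
    rw [Finset.prod_mul_distrib]
    simp [← Real.exp_nat_mul]
  have hmarkov : (((Fintype.piFinset S).filter fun I => η * m < ∑ h, X h (I h)).card : ℝ) *
      Real.exp (s * (η * m)) ≤ ∑ I ∈ Fintype.piFinset S, Real.exp (s * ∑ h, X h (I h)) := by
    rw [← nsmul_eq_mul, ← Finset.sum_const]
    refine (Finset.sum_le_sum fun I hI => ?_).trans
      (Finset.sum_le_sum_of_subset_of_nonneg (Finset.filter_subset _ _)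
        fun _ _ _ => (Real.exp_pos _).le)
    have := (Finset.mem_filter.1 hI).2
    exact Real.exp_le_exp.2 (mul_le_mul_of_nonneg_left this.le (by positivity))
  have := hmarkov.trans hsum
  rw [← le_div_iff₀ (Real.exp_pos _), mul_div_assoc, ← Real.exp_sub] at this
  refine this.trans_eq ?_
  rw [mul_comm]
  congr 2
  rw [hs]; ring

/-- The exponent vectors of degree `r`. -/
lemma sum_piAntidiag_coord {ι : Type*} [Fintype ι] [DecidableEq ι] (r : ℕ) (i : ι) :
    (Fintype.card ι : ℝ) * ∑ f ∈ Finset.piAntidiag (Finset.univ : Finset ι) r, (f i : ℝ) =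
      r * (Finset.piAntidiag (Finset.univ : Finset ι) r).card := by
  have hsymm : ∀ j, ∑ f ∈ Finset.piAntidiag (Finset.univ : Finset ι) r, (f j : ℝ) =
      ∑ f ∈ Finset.piAntidiag (Finset.univ : Finset ι) r, (f i : ℝ) := by
    intro j
    refine Finset.sum_bij' (fun f _ => f ∘ Equiv.swap i j) (fun f _ => f ∘ Equiv.swap i j)
      ?_ ?_ ?_ ?_ ?_
    · intro f hf
      rw [Finset.mem_piAntidiag] at hf ⊢
      refine ⟨?_, by simp⟩
      rw [← hf.1]
      exact Equiv.sum_comp (Equiv.swap i j) f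
    · intro f hf
      rw [Finset.mem_piAntidiag] at hf ⊢
      refine ⟨?_, by simp⟩
      rw [← hf.1]
      exact Equiv.sum_comp (Equiv.swap i j) f
    · intro f _; funext x; simp
    · intro f _; funext x; simp
    · intro f _; simp
  calc (Fintype.card ι : ℝ) * ∑ f ∈ Finset.piAntidiag (Finset.univ : Finset ι) r, (f i : ℝ)
      = ∑ j : ι, ∑ f ∈ Finset.piAntidiag (Finset.univ : Finset ι) r, (f j : ℝ) := by
        simp_rw [hsymm]; simp
    _ = ∑ f ∈ Finset.piAntidiag (Finset.univ : Finset ι) r, (r : ℝ) := by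
        rw [Finset.sum_comm]
        refine Finset.sum_congr rfl fun f hf => ?_
        rw [Finset.mem_piAntidiag] at hf
        exact_mod_cast hf.1
    _ = _ := by simp [mul_comm]

/-- Block exponents `I` are `η`-balanced when in each direction `i` the normalised total exponent
is within `η m` of its mean. -/
def Balanced {ι : Type*} [Fintype ι] {m : ℕ} (η : ℝ) (r : Fin m → ℕ) (I : Fin m → ι → ℕ) : Prop :=
  ∀ i, |∑ h, (I h i : ℝ) / r h - m / Fintype.card ι| ≤ η * m

open Classical in
lemma card_not_balanced_le {ι : Type*} [Fintype ι] {m : ℕ} {η : ℝ} (hη : 0 < η) (hη2 : η ≤ 2)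
    {r : Fin m → ℕ} (hr : ∀ h, 0 < r h) :
    (((Fintype.piFinset fun h => Finset.piAntidiag (Finset.univ : Finset ι) (r h)).filter
      fun I => ¬ Balanced η r I).card : ℝ) ≤
      2 * Fintype.card ι * Real.exp (-(m * η ^ 2 / 4)) *
        ∏ h, ((Finset.piAntidiag (Finset.univ : Finset ι) (r h)).card : ℝ) := by
  set S : Fin m → Finset (ι → ℕ) := fun h => Finset.piAntidiag (Finset.univ : Finset ι) (r h)
    with hS
  let X : ι → Fin m → (ι → ℕ) → ℝ := fun i h f => (f i : ℝ) / r h - 1 / Fintype.card ι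
  have hXsum : ∀ i (I : Fin m → ι → ℕ),
      ∑ h, X i h (I h) = ∑ h, (I h i : ℝ) / r h - m / Fintype.card ι := by
    intro i I
    simp only [X, Finset.sum_sub_distrib]
    simp [div_eq_mul_inv]
  have hX0 : ∀ i h, ∑ f ∈ S h, X i h f = 0 := by
    intro i h
    have hN : (0 : ℝ) < Fintype.card ι := by
      exact_mod_cast Fintype.card_pos_iff.2 ⟨i⟩
    have hrh : (0 : ℝ) < r h := by exact_mod_cast hr h
    simp only [X, Finset.sum_sub_distrib, ← Finset.sum_div]
    have := sum_piAntidiag_coord (r h) i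
    rw [sub_eq_zero]
    simp only [Finset.sum_const, nsmul_eq_mul]
    field_simp
    rw [mul_comm, this]
  have hX1 : ∀ i h, ∀ f ∈ S h, |X i h f| ≤ 1 := by
    intro i h f hf
    have hN : (1 : ℝ) ≤ Fintype.card ι := by
      exact_mod_cast Fintype.card_pos_iff.2 ⟨i⟩
    have hrh : (0 : ℝ) < r h := by exact_mod_cast hr h
    have hfi : f i ≤ r h := by
      rw [hS, Finset.mem_piAntidiag] at hf
      rw [← hf.1]
      exact Finset.single_le_sum (fun _ _ => Nat.zero_le _) (Finset.mem_univ i)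
    have h1 : (f i : ℝ) / r h ≤ 1 := by
      rw [div_le_one hrh]; exact_mod_cast hfi
    have h2 : (0 : ℝ) ≤ (f i : ℝ) / r h := by positivity
    have h3 : (1 : ℝ) / Fintype.card ι ≤ 1 := by
      rw [div_le_one (by linarith)]; exact hN
    have h4 : (0 : ℝ) ≤ (1 : ℝ) / Fintype.card ι := by positivity
    rw [abs_le]; constructor <;> simp only [X] <;> linarith
  let E := Real.exp (-(m * η ^ 2 / 4)) * ∏ h, ((S h).card : ℝ)
  have hcov : ((Fintype.piFinset S).filter fun I => ¬ Balanced η r I) ⊆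
      Finset.univ.biUnion fun i : ι =>
        ((Fintype.piFinset S).filter fun I => η * m < ∑ h, X i h (I h)) ∪
        ((Fintype.piFinset S).filter fun I => η * m < ∑ h, (fun h f => - X i h f) h (I h)) := by
    intro I hI
    rw [Finset.mem_filter] at hI
    obtain ⟨hIS, hI⟩ := hI
    simp only [Balanced, not_forall, not_le] at hI
    obtain ⟨i, hi⟩ := hI
    rw [← hXsum] at hi
    simp only [Finset.mem_biUnion, Finset.mem_univ, true_and, Finset.mem_union, Finset.mem_filter,
      hIS, Finset.sum_neg_distrib]
    exact ⟨i, lt_abs.1 hi⟩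
  have hcard := (Finset.card_le_card hcov).trans Finset.card_biUnion_le
  have hcardR : (((Fintype.piFinset S).filter fun I => ¬ Balanced η r I).card : ℝ) ≤
      ∑ i : ι, 2 * E := by
    refine (Nat.cast_le.2 hcard).trans ?_
    push_cast
    refine Finset.sum_le_sum fun i _ => (Nat.cast_le.2 (Finset.card_union_le _ _)).trans ?_
    have h1 := card_filter_lt_sum_le S (X i) (hX1 i) (hX0 i) hη hη2
    have h2 := card_filter_lt_sum_le S (fun h f => - X i h f)
      (fun h a ha => by rw [abs_neg]; exact hX1 i h a ha)
      (fun h => by rw [Finset.sum_neg_distrib, hX0, neg_zero]) hη hη2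
    push_cast
    rw [two_mul]
    exact add_le_add h1 h2
  refine hcardR.trans_eq ?_
  simp only [Finset.sum_const, Finset.card_univ, nsmul_eq_mul, E]
  ring

end Chernoff

end SchmidtSubspace

namespace SchmidtSubspace

lemma abs_int_det_le {ι : Type*} [Fintype ι] [DecidableEq ι] {A : Matrix ι ι ℤ} {x : ℝ}
    (hx : ∀ i j, |((A i j : ℤ) : ℝ)| ≤ x) :
    |((A.det : ℤ) : ℝ)| ≤ (Fintype.card ι).factorial * x ^ Fintype.card ι := by
  have := Matrix.det_le (A := A.map (Int.castRingHom ℝ)) (abv := AbsoluteValue.abs) (x := x)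
    (by simpa using hx)
  rw [← RingHom.mapMatrix_apply, ← RingHom.map_det, nsmul_eq_mul] at this
  simpa using this

section Order

attribute [local instance] Matrix.linftyOpNormedRing Matrix.linftyOpNormedAddCommGroup

lemma linfty_opNorm_one_le {s : ℕ} : ‖(1 : Matrix (Fin s) (Fin s) ℤ)‖ ≤ 1 := by
  rw [Matrix.linfty_opNorm_def]
  have : (Finset.univ.sup fun i : Fin s => ∑ j, ‖(1 : Matrix (Fin s) (Fin s) ℤ) i j‖₊) ≤ 1 := by
    refine Finset.sup_le fun i _ => ?_
    rw [Finset.sum_eq_single i]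
    · simp
    · intro j _ hj; simp [Matrix.one_apply_ne hj.symm]
    · simp
  exact_mod_cast this

lemma norm_entry_le_linfty_opNorm {s : ℕ} (A : Matrix (Fin s) (Fin s) ℤ) (i j : Fin s) :
    ‖A i j‖ ≤ ‖A‖ := by
  rw [Matrix.linfty_opNorm_def]
  have : ‖A i j‖₊ ≤ (Finset.univ.sup fun i : Fin s => ∑ j, ‖A i j‖₊) :=
    (Finset.single_le_sum (f := fun j => ‖A i j‖₊) (fun _ _ => zero_le) (Finset.mem_univ j)).trans
      (Finset.le_sup (f := fun i => ∑ j, ‖A i j‖₊) (Finset.mem_univ i))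
  exact_mod_cast this

/-- The ring seminorm on an order given by the operator norm of the multiplication matrices. -/
noncomputable def orderSeminorm {O : Type*} [CommRing O] {s : ℕ} (b : Module.Basis (Fin s) ℤ O) :
    RingSeminorm O where
  toFun x := ‖Algebra.leftMulMatrix b x‖
  map_zero' := by simp
  add_le' x y := by rw [map_add]; exact norm_add_le _ _
  neg' x := by rw [map_neg, norm_neg]
  mul_le' x y := by rw [map_mul]; exact norm_mul_le _ _

variable {O : Type*} [CommRing O] {s : ℕ} (b : Module.Basis (Fin s) ℤ O)

lemma orderSeminorm_apply (x : O) : orderSeminorm b x = ‖Algebra.leftMulMatrix b x‖ := rfl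

lemma orderSeminorm_one_le : orderSeminorm b 1 ≤ 1 := by
  rw [orderSeminorm_apply, map_one]; exact linfty_opNorm_one_le

lemma orderSeminorm_intCast_le (n : ℤ) : orderSeminorm b (n : O) ≤ |(n : ℝ)| := by
  rw [orderSeminorm_apply, map_intCast]
  have : ((n : ℤ) : Matrix (Fin s) (Fin s) ℤ) = n • 1 := by simp
  rw [this]
  refine (norm_zsmul_le _ _).trans ?_
  rw [Int.norm_eq_abs]
  exact mul_le_of_le_one_right (abs_nonneg _) linfty_opNorm_one_le

lemma exists_repr_le : ∃ K : ℝ, 1 ≤ K ∧ ∀ x i, |((b.repr x i : ℤ) : ℝ)| ≤ K * orderSeminorm b x := by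
  refine ⟨max 1 ‖(fun i => b.repr 1 i : Fin s → ℤ)‖, le_max_left _ _, fun x i => ?_⟩
  have h1 : Matrix.mulVec (Algebra.leftMulMatrix b x) (b.repr 1) = b.repr x := by
    rw [Algebra.leftMulMatrix_mulVec_repr, mul_one]
  have h2 := Matrix.linfty_opNorm_mulVec (Algebra.leftMulMatrix b x) (fun i => b.repr 1 i)
  have h3 : ‖b.repr x i‖ ≤ ‖Matrix.mulVec (Algebra.leftMulMatrix b x) (b.repr 1)‖ := by
    rw [← congrFun h1 i]
    exact norm_le_pi_norm (Matrix.mulVec (Algebra.leftMulMatrix b x) (b.repr 1)) i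
  rw [← Int.norm_eq_abs, mul_comm]
  refine h3.trans (h2.trans ?_)
  exact mul_le_mul_of_nonneg_left (le_max_right _ _) (norm_nonneg _)

/-- A Liouville type lower bound for the nonzero elements of an order. -/
lemma exists_liouville [IsDomain O] (φ : O →+* ℝ) :
    ∃ K : ℝ, 1 ≤ K ∧ ∀ x, x ≠ 0 → 1 ≤ K * (1 + orderSeminorm b x) ^ s * |φ x| := by
  obtain ⟨K, hK, hb⟩ := exists_repr_le b
  let c : ℝ := ∑ i, |((b.repr 1 i : ℤ) : ℝ)|
  let F : ℝ := ∑ i, |φ (b i)|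
  refine ⟨max 1 (s.factorial * c * F), le_max_left _ _, fun x hx => ?_⟩
  set A := Algebra.leftMulMatrix b x with hA
  have hν : orderSeminorm b x = ‖A‖ := rfl
  have hdet : A.det ≠ 0 := by
    rw [hA, ← Algebra.norm_eq_matrix_det b x]
    have : Module.Finite ℤ O := Module.Finite.of_basis b
    have : Module.Free ℤ O := Module.Free.of_basis b
    exact Algebra.norm_ne_zero_iff.2 hx
  let z : Fin s → ℤ := Matrix.mulVec A.adjugate (fun i => b.repr 1 i)
  let y : O := b.equivFun.symm z
  have hxy : x * y = (A.det : O) := by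
    apply b.equivFun.injective
    funext i
    have h1 : ∀ w : O, (b.equivFun w) = fun i => b.repr w i := fun w => by
      funext i; simp [Module.Basis.equivFun_apply]
    have h2 : (fun i => b.repr y i) = z := by
      rw [← h1]; exact b.equivFun.apply_symm_apply z
    rw [h1, h1]
    have h3 := Algebra.leftMulMatrix_mulVec_repr b x y
    have h4 : (fun i => b.repr (x * y) i) = Matrix.mulVec A z := by
      rw [← h2]; exact h3.symm
    rw [h4]
    simp only [z, Matrix.mulVec_mulVec, Matrix.mul_adjugate]
    have : ((A.det : ℤ) : O) = A.det • (1 : O) := by simp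
    rw [this, Matrix.smul_mulVec, Matrix.one_mulVec, map_zsmul]
    rfl
  have hA1 : (1 : ℝ) ≤ 1 + ‖A‖ := by linarith [norm_nonneg A]
  have hadj : ∀ i j, |((A.adjugate i j : ℤ) : ℝ)| ≤ s.factorial * (1 + ‖A‖) ^ s := by
    intro i j
    rw [Matrix.adjugate_apply]
    refine (abs_int_det_le (x := 1 + ‖A‖) fun k l => ?_).trans (by simp)
    rw [Matrix.updateRow_apply]
    split_ifs
    · rw [Pi.single_apply]
      split_ifs
      · simp
      · simp; linarith
    · have := norm_entry_le_linfty_opNorm A k l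
      rw [Int.norm_eq_abs] at this
      linarith
  have hz : ∀ i, |((z i : ℤ) : ℝ)| ≤ s.factorial * (1 + ‖A‖) ^ s * c := by
    intro i
    simp only [z, Matrix.mulVec, dotProduct]
    push_cast
    refine (Finset.abs_sum_le_sum_abs _ _).trans ?_
    rw [Finset.mul_sum]
    refine Finset.sum_le_sum fun j _ => ?_
    rw [abs_mul]
    exact mul_le_mul_of_nonneg_right (hadj i j) (abs_nonneg _)
  have hy : |φ y| ≤ s.factorial * (1 + ‖A‖) ^ s * c * F := by
    have : φ y = ∑ i, ((z i : ℤ) : ℝ) * φ (b i) := by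
      simp [y, Module.Basis.equivFun_symm_apply]
    rw [this]
    refine (Finset.abs_sum_le_sum_abs _ _).trans ?_
    rw [Finset.mul_sum]
    refine Finset.sum_le_sum fun j _ => ?_
    rw [abs_mul]
    exact mul_le_mul_of_nonneg_right (hz j) (abs_nonneg _)
  have h1 : (1 : ℝ) ≤ |φ x| * |φ y| := by
    rw [← abs_mul, ← map_mul, hxy, map_intCast]
    exact_mod_cast Int.one_le_abs hdet
  rw [hν]
  calc (1 : ℝ) ≤ |φ x| * |φ y| := h1
    _ ≤ |φ x| * (s.factorial * (1 + ‖A‖) ^ s * c * F) :=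
        mul_le_mul_of_nonneg_left hy (abs_nonneg _)
    _ = (s.factorial * c * F) * (1 + ‖A‖) ^ s * |φ x| := by ring
    _ ≤ _ := by
        gcongr
        exact le_max_right _ _

end Order

/-- Finitely many real algebraic integers lie in an order with a finite `ℤ`-basis. -/
lemma exists_order {κ : Type*} [Finite κ] (β : κ → ℝ) (hβ : ∀ k, IsIntegral ℤ (β k)) :
    ∃ (O : Subalgebra ℤ ℝ) (s : ℕ) (_ : Module.Basis (Fin s) ℤ O), ∀ k, β k ∈ O := by
  let O := Algebra.adjoin ℤ (Set.range β)
  have hfin : Module.Finite ℤ O := by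
    have := fg_adjoin_of_finite (R := ℤ) (Set.finite_range β) (by
      rintro x ⟨k, rfl⟩; exact hβ k)
    exact Module.Finite.iff_fg.2 this
  have hfree : Module.Free ℤ O := inferInstance
  exact ⟨O, _, Module.finBasis ℤ O, fun k => Algebra.subset_adjoin ⟨k, rfl⟩⟩

/-- A common denominator for finitely many algebraic numbers. -/
lemma exists_common_denominator {κ : Type*} [Fintype κ] (β : κ → ℝ)
    (hβ : ∀ k, IsAlgebraic ℚ (β k)) :
    ∃ D : ℤ, D ≠ 0 ∧ ∀ k, IsIntegral ℤ ((D : ℝ) * β k) := by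
  have h1 : ∀ k, ∃ D : ℤ, D ≠ 0 ∧ IsIntegral ℤ ((D : ℝ) * β k) := by
    intro k
    have : IsAlgebraic ℤ (β k) := (IsFractionRing.isAlgebraic_iff ℤ ℚ ℝ).2 (hβ k)
    obtain ⟨D, hD, h⟩ := this.exists_integral_multiple
    exact ⟨D, hD, by simpa using h⟩
  choose D hD h using h1
  refine ⟨∏ k, D k, Finset.prod_ne_zero_iff.2 fun k _ => hD k, fun k => ?_⟩
  classical
  rw [← Finset.mul_prod_erase _ _ (Finset.mem_univ k)]
  push_cast
  rw [mul_right_comm]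
  refine (h k).mul ?_
  have := isIntegral_algebraMap (R := ℤ) (A := ℝ) (x := ∏ x ∈ Finset.univ.erase k, D x)
  simpa using this

end SchmidtSubspace

namespace SchmidtSubspace

open MvPolynomial

section MultiHomogeneous

/-- The weight counting the degree in each block of variables. -/
def blockWeight (m : ℕ) (ι : Type*) : Fin m × ι → (Fin m → ℕ) := fun p => Pi.single p.1 1

lemma weight_blockWeight {m : ℕ} {ι : Type*} [Fintype ι] (T : Fin m × ι →₀ ℕ) (h : Fin m) :
    Finsupp.weight (blockWeight m ι) T h = ∑ i, T (h, i) := by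
  classical
  rw [Finsupp.weight_eq_sum, Finset.sum_apply, Fintype.sum_prod_type, Finset.sum_eq_single h]
  · simp [blockWeight]
  · intro h' _ hh
    refine Finset.sum_eq_zero fun i _ => ?_
    simp [blockWeight, Pi.single_eq_of_ne hh.symm]
  · simp

lemma sum_support_of_homogeneous {m : ℕ} {ι S : Type*} [Fintype ι] [CommRing S]
    {P : MvPolynomial (Fin m × ι) S} {r : Fin m → ℕ}
    (hP : IsWeightedHomogeneous (blockWeight m ι) P r) {T : Fin m × ι →₀ ℕ} (hT : T ∈ P.support) :
    ∑ p ∈ T.support, T p = ∑ h, r h := by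
  classical
  rw [Finset.sum_subset (Finset.subset_univ _) fun p _ hp => Finsupp.notMem_support_iff.1 hp,
    Fintype.sum_prod_type]
  refine Finset.sum_congr rfl fun h _ => ?_
  rw [← weight_blockWeight, hP (mem_support_iff.1 hT)]

lemma isWeightedHomogeneous_aeval {σ τ W R S : Type*} [CommRing R] [CommRing S] [Algebra S R]
    [AddCommMonoid W] {w : σ → W} {u : τ → W} (g : τ → MvPolynomial σ R)
    (hg : ∀ p, IsWeightedHomogeneous w (g p) (u p)) {P : MvPolynomial τ S} {n : W}
    (hP : IsWeightedHomogeneous u P n) : IsWeightedHomogeneous w (aeval g P) n := by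
  classical
  rw [aeval_def, eval₂_eq]
  refine IsWeightedHomogeneous.sum _ _ _ fun T hT => ?_
  rw [IsScalarTower.algebraMap_apply S R (MvPolynomial σ R), algebraMap_eq]
  refine IsWeightedHomogeneous.C_mul ?_ _
  have h1 := IsWeightedHomogeneous.prod T.support (fun p => g p ^ T p) (fun p => T p • u p) (w := w)
    fun p _ => (hg p).pow (T p)
  rw [← hP (mem_support_iff.1 hT), Finsupp.weight_apply]
  exact h1

/-- Scaling all variables of a block homogeneous polynomial. -/
lemma aeval_smul_of_homogeneous {m : ℕ} {ι σ R S : Type*} [Fintype ι] [CommRing R] [CommRing S]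
    [Algebra S R] {P : MvPolynomial (Fin m × ι) S} {r : Fin m → ℕ}
    (hP : IsWeightedHomogeneous (blockWeight m ι) P r) (g : Fin m × ι → MvPolynomial σ R) (c : R) :
    aeval (fun p => C c * g p) P = C (c ^ ∑ h, r h) * aeval g P := by
  classical
  rw [aeval_def, aeval_def, eval₂_eq, eval₂_eq, Finset.mul_sum]
  refine Finset.sum_congr rfl fun T hT => ?_
  have h1 := sum_support_of_homogeneous hP hT
  simp_rw [mul_pow]
  rw [Finset.prod_mul_distrib, Finset.prod_pow_eq_pow_sum, h1, map_pow]
  ring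

lemma wnorm_le_pow_mul {m : ℕ} {ι S : Type*} [Fintype ι] [CommRing S]
    {μ : RingSeminorm S} {w : Fin m × ι → ℝ} (hw : ∀ p, 0 ≤ w p) {E : ℝ}
    (hE : ∀ p, w p ≤ E) {P : MvPolynomial (Fin m × ι) S} {r : Fin m → ℕ}
    (hP : IsWeightedHomogeneous (blockWeight m ι) P r) :
    wnorm μ w P ≤ E ^ (∑ h, r h) * wnorm μ (fun _ => 1) P := by
  classical
  rw [wnorm, wnorm, Finset.mul_sum]
  refine Finset.sum_le_sum fun T hT => ?_
  have h1 := sum_support_of_homogeneous hP hT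
  rw [mul_comm, mul_comm (μ _), ← mul_assoc]
  refine mul_le_mul_of_nonneg_right ?_ (apply_nonneg μ _)
  simp only [Finsupp.prod, one_pow, Finset.prod_const_one, mul_one]
  rw [← h1, ← Finset.prod_pow_eq_pow_sum]
  exact Finset.prod_le_prod (fun _ _ => pow_nonneg (hw _) _)
    fun p _ => pow_le_pow_left₀ (hw _) (hE _) _

/-- Linear substitution acting in each block by the same matrix. -/
noncomputable def blockSubst {ι R : Type*} [Fintype ι] [CommRing R] (m : ℕ) (M : Matrix ι ι R) :
    Fin m × ι → MvPolynomial (Fin m × ι) R :=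
  fun p => ∑ k, C (M p.2 k) * X (p.1, k)

lemma blockSubst_homogeneous {ι R : Type*} [Fintype ι] [CommRing R] (m : ℕ) (M : Matrix ι ι R)
    (p : Fin m × ι) :
    IsWeightedHomogeneous (blockWeight m ι) (blockSubst m M p) (blockWeight m ι p) :=
  IsWeightedHomogeneous.sum _ _ _ fun k _ =>
    IsWeightedHomogeneous.C_mul (isWeightedHomogeneous_X R (blockWeight m ι) (p.1, k)) _

lemma blockSubst_mul {ι R : Type*} [Fintype ι] [DecidableEq ι] [CommRing R] (m : ℕ)
    (A B : Matrix ι ι R) (p : Fin m × ι) :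
    aeval (blockSubst m B) (blockSubst m A p) = blockSubst m (A * B) p := by
  simp only [blockSubst, map_sum, map_mul, algHom_C, aeval_X, Matrix.mul_apply, Finset.sum_mul,
    Finset.mul_sum, algebraMap_eq]
  rw [Finset.sum_comm]
  refine Finset.sum_congr rfl fun k _ => Finset.sum_congr rfl fun j _ => ?_
  ring

lemma blockSubst_one {ι R : Type*} [Fintype ι] [DecidableEq ι] [CommRing R] (m : ℕ) :
    blockSubst m (1 : Matrix ι ι R) = X := by
  funext p
  simp only [blockSubst]
  rw [Finset.sum_eq_single p.2]
  · simp
  · intro k _ hk; simp [Matrix.one_apply_ne hk.symm]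
  · simp

end MultiHomogeneous

section Siegel

attribute [local instance] Matrix.seminormedAddCommGroup

/-- Siegel's lemma with at most half as many equations as unknowns. -/
lemma exists_small_solution {κ τ : Type*} [Fintype κ] [Fintype τ] [DecidableEq τ] [Nonempty τ]
    (A : Matrix κ τ ℤ) (hcard : 2 * Fintype.card κ ≤ Fintype.card τ) {B : ℝ} (hB : 1 ≤ B)
    (hA : ∀ i j, |((A i j : ℤ) : ℝ)| ≤ B) :
    ∃ t : τ → ℤ, t ≠ 0 ∧ A.mulVec t = 0 ∧ ∀ j, |((t j : ℤ) : ℝ)| ≤ Fintype.card τ * B := by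
  classical
  have hτ : 0 < Fintype.card τ := Fintype.card_pos
  have hτ1 : (1 : ℝ) ≤ Fintype.card τ := by exact_mod_cast hτ
  have hbase : (1 : ℝ) ≤ Fintype.card τ * B := one_le_mul_of_one_le_of_one_le hτ1 hB
  rcases Nat.eq_zero_or_pos (Fintype.card κ) with h0 | hpos
  · have : IsEmpty κ := Fintype.card_eq_zero_iff.1 h0
    refine ⟨fun _ => 1, ?_, funext fun i => isEmptyElim i, fun j => by simpa using hbase⟩
    exact fun h => one_ne_zero (congrFun h (Classical.arbitrary τ))
  · obtain ⟨t, ht0, ht, hbound⟩ :=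
      Int.Matrix.exists_ne_zero_int_vec_norm_le A (by omega) hpos
    refine ⟨t, ht0, ht, fun j => ?_⟩
    have hAn : max 1 ‖A‖ ≤ B := by
      refine max_le hB ((Matrix.norm_le_iff (by linarith)).2 fun i j => ?_)
      rw [Int.norm_eq_abs]; exact hA i j
    rw [← Int.norm_eq_abs]
    refine (norm_le_pi_norm t j).trans (hbound.trans ?_)
    have hexp : (Fintype.card κ : ℝ) / (Fintype.card τ - Fintype.card κ) ≤ 1 := by
      have : (2 : ℝ) * Fintype.card κ ≤ Fintype.card τ := by exact_mod_cast hcard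
      have h2 : (0 : ℝ) < Fintype.card κ := by exact_mod_cast hpos
      rw [div_le_one (by linarith)]
      linarith
    have h1 : (1 : ℝ) ≤ Fintype.card τ * max 1 ‖A‖ :=
      one_le_mul_of_one_le_of_one_le hτ1 (le_max_left _ _)
    calc ((Fintype.card τ : ℝ) * max 1 ‖A‖) ^
          ((Fintype.card κ : ℝ) / (Fintype.card τ - Fintype.card κ))
        ≤ ((Fintype.card τ : ℝ) * max 1 ‖A‖) ^ (1 : ℝ) :=
          Real.rpow_le_rpow_of_exponent_le h1 hexp
      _ = (Fintype.card τ : ℝ) * max 1 ‖A‖ := Real.rpow_one _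
      _ ≤ _ := by gcongr

end Siegel

lemma map_intCast_eq_aeval {σ : Type*} (P : MvPolynomial σ ℤ) :
    map (Int.castRingHom ℝ) P = aeval (fun p => (X p : MvPolynomial σ ℝ)) P := by
  induction P using MvPolynomial.induction_on with
  | C a => simp
  | add p q hp hq => simp [hp, hq]
  | mul_X p i hp => simp [hp]

section AlgebraicMatrix

variable {ι : Type*} [Fintype ι] [DecidableEq ι] {M : Matrix ι ι ℝ}

lemma exists_algebraicClosure_lift (halg : ∀ i j, IsAlgebraic ℚ (M i j)) :
    ∃ M' : Matrix ι ι (algebraicClosure ℚ ℝ), (algebraMap (algebraicClosure ℚ ℝ) ℝ).mapMatrix M' = M :=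
  ⟨fun i j => ⟨M i j, (mem_algebraicClosure_iff).2 (halg i j)⟩, rfl⟩

lemma isAlgebraic_det (halg : ∀ i j, IsAlgebraic ℚ (M i j)) : IsAlgebraic ℚ M.det := by
  obtain ⟨M', rfl⟩ := exists_algebraicClosure_lift halg
  rw [← RingHom.map_det]
  exact mem_algebraicClosure_iff.1 (M'.det).2

lemma isAlgebraic_inv_apply (halg : ∀ i j, IsAlgebraic ℚ (M i j)) (i j : ι) :
    IsAlgebraic ℚ (M⁻¹ i j) := by
  have hadj : IsAlgebraic ℚ (M.adjugate i j) := by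
    obtain ⟨M', rfl⟩ := exists_algebraicClosure_lift halg
    rw [← RingHom.map_adjugate]
    exact mem_algebraicClosure_iff.1 (M'.adjugate i j).2
  rw [Matrix.inv_def, Ring.inverse_eq_inv', Matrix.smul_apply, smul_eq_mul]
  exact (isAlgebraic_det halg).inv.mul hadj

end AlgebraicMatrix

section Auxiliary

/-- Block exponents as a monomial exponent. -/
noncomputable def toExp {m : ℕ} {ι : Type*} [Finite ι] (I : Fin m → ι → ℕ) : Fin m × ι →₀ ℕ :=
  Finsupp.equivFunOnFinite.symm fun p => I p.1 p.2

lemma toExp_apply {m : ℕ} {ι : Type*} [Finite ι] (I : Fin m → ι → ℕ) (p : Fin m × ι) :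
    toExp I p = I p.1 p.2 := by
  simp [toExp]

lemma toExp_injective {m : ℕ} {ι : Type*} [Finite ι] :
    Function.Injective (toExp : (Fin m → ι → ℕ) → (Fin m × ι →₀ ℕ)) := by
  intro I J hIJ
  funext h i
  rw [← toExp_apply I (h, i), hIJ, toExp_apply]

lemma card_piAntidiag_le {ι : Type*} [Fintype ι] [DecidableEq ι] (r : ℕ) :
    (Finset.piAntidiag (Finset.univ : Finset ι) r).card ≤ (2 ^ Fintype.card ι) ^ r := by
  have hsub : Finset.piAntidiag (Finset.univ : Finset ι) r ⊆
      Fintype.piFinset fun _ => Finset.range (r + 1) := by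
    intro f hf
    rw [Finset.mem_piAntidiag] at hf
    rw [Fintype.mem_piFinset]
    intro i
    rw [Finset.mem_range, Nat.lt_succ_iff, ← hf.1]
    exact Finset.single_le_sum (fun _ _ => Nat.zero_le _) (Finset.mem_univ i)
  refine (Finset.card_le_card hsub).trans ?_
  rw [Fintype.card_piFinset]
  simp only [Finset.card_range, Finset.prod_const, Finset.card_univ]
  rw [← pow_mul, mul_comm, pow_mul]
  exact Nat.pow_le_pow_left Nat.lt_two_pow_self _

open Classical in
/-- The auxiliary polynomial: a small integral block homogeneous polynomial which, written in the
coordinates given by an algebraic invertible matrix, only has balanced exponents. -/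
theorem exists_auxiliary_polynomial {ι : Type*} [Fintype ι] [Nonempty ι]
    (M : Matrix ι ι ℝ) (halg : ∀ i j, IsAlgebraic ℚ (M i j)) (hdet : M.det ≠ 0)
    {η : ℝ} (hη : 0 < η) (hη2 : η ≤ 2) :
    ∃ m0 : ℕ, ∀ m ≥ m0, ∃ K : ℝ, 1 ≤ K ∧ ∀ r : Fin m → ℕ, (∀ h, 0 < r h) →
      ∃ P : MvPolynomial (Fin m × ι) ℤ, P ≠ 0 ∧ IsWeightedHomogeneous (blockWeight m ι) P r ∧
        inorm P ≤ K ^ (∑ h, r h) ∧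
        ∃ G : MvPolynomial (Fin m × ι) ℝ,
          map (Int.castRingHom ℝ) P = aeval (blockSubst m M) G ∧ rnorm G ≤ K ^ (∑ h, r h) ∧
          IsWeightedHomogeneous (blockWeight m ι) G r ∧
          ∀ I ∈ G.support, Balanced η r fun h i => I (h, i) := by
  have halgB : ∀ p : ι × ι, IsAlgebraic ℚ (M⁻¹ p.1 p.2) :=
    fun p => isAlgebraic_inv_apply halg p.1 p.2
  obtain ⟨D, hD, hint⟩ := exists_common_denominator (fun p : ι × ι => M⁻¹ p.1 p.2) halgB
  obtain ⟨O, s, b, hO⟩ := exists_order (fun p : ι × ι => (D : ℝ) * M⁻¹ p.1 p.2) hint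
  obtain ⟨K₁, hK₁, hrepr⟩ := exists_repr_le b
  set ν := orderSeminorm b with hν
  set N := Fintype.card ι with hN
  let β : Matrix ι ι O := fun i j => ⟨(D : ℝ) * M⁻¹ i j, hO (i, j)⟩
  obtain ⟨E, hE1, hEβ, hEM⟩ : ∃ E : ℝ, 1 ≤ E ∧ (∀ i, ∑ k, ν (β i k) ≤ E) ∧
      (∀ i, ∑ k, |M⁻¹ i k| ≤ E) := by
    refine ⟨1 + ∑ i, ∑ k, ν (β i k) + ∑ i, ∑ k, |M⁻¹ i k|, ?_, fun i => ?_, fun i => ?_⟩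
    · have h1 : 0 ≤ ∑ i, ∑ k, ν (β i k) :=
        Finset.sum_nonneg fun i _ => Finset.sum_nonneg fun k _ => apply_nonneg ν _
      have h2 : 0 ≤ ∑ i, ∑ k, |M⁻¹ i k| := by positivity
      linarith
    · have h1 := Finset.single_le_sum (f := fun i => ∑ k, ν (β i k))
        (fun i _ => Finset.sum_nonneg fun k _ => apply_nonneg ν _) (Finset.mem_univ i)
      have h2 : 0 ≤ ∑ i, ∑ k, |M⁻¹ i k| := by positivity
      exact h1.trans (by linarith)
    · have h1 : 0 ≤ ∑ i, ∑ k, ν (β i k) :=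
        Finset.sum_nonneg fun i _ => Finset.sum_nonneg fun k _ => apply_nonneg ν _
      have h2 := Finset.single_le_sum (f := fun i => ∑ k, |M⁻¹ i k|)
        (fun i _ => Finset.sum_nonneg fun k _ => abs_nonneg _) (Finset.mem_univ i)
      exact h2.trans (by linarith)
  obtain ⟨m0, hm0⟩ := exists_nat_ge (16 * N * s / η ^ 2)
  refine ⟨m0 + 1, fun m hm => ?_⟩
  have hexp : 4 * N * s * Real.exp (-(m * η ^ 2 / 4)) ≤ 1 := by
    have h1 : 16 * N * s / η ^ 2 ≤ m := hm0.trans (by exact_mod_cast (by omega : m0 ≤ m))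
    rw [div_le_iff₀ (by positivity)] at h1
    have h2 : (4 * N * s : ℝ) ≤ Real.exp (m * η ^ 2 / 4) := by
      have := Real.add_one_le_exp (m * η ^ 2 / 4)
      linarith
    rw [Real.exp_neg, ← div_eq_mul_inv, div_le_one (Real.exp_pos _)]
    exact h2
  let H : ℝ := (2 : ℝ) ^ N
  have hH1 : 1 ≤ H := one_le_pow₀ (by norm_num)
  refine ⟨H * H * K₁ * E * E, ?_, fun r hr => ?_⟩
  · exact one_le_mul_of_one_le_of_one_le (one_le_mul_of_one_le_of_one_le
      (one_le_mul_of_one_le_of_one_le (one_le_mul_of_one_le_of_one_le hH1 hH1) hK₁) hE1) hE1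
  set R := ∑ h, r h with hR
  have hR1 : 1 ≤ R := by
    have h0 : (0 : ℕ) < m := by omega
    exact (hr ⟨0, h0⟩).trans_le (Finset.single_le_sum (f := r) (fun _ _ => Nat.zero_le _)
      (Finset.mem_univ (⟨0, h0⟩ : Fin m)))
  set 𝒯 := Fintype.piFinset fun h => Finset.piAntidiag (Finset.univ : Finset ι) (r h) with h𝒯
  have hcard𝒯 : (𝒯.card : ℝ) = ∏ h, ((Finset.piAntidiag (Finset.univ : Finset ι) (r h)).card : ℝ) := by
    rw [h𝒯, Fintype.card_piFinset]; push_cast; rfl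
  have hne : 𝒯.Nonempty := by
    rw [h𝒯, Fintype.piFinset_nonempty]
    intro h
    obtain ⟨i⟩ := ‹Nonempty ι›
    refine ⟨Pi.single i (r h), ?_⟩
    rw [Finset.mem_piAntidiag]
    exact ⟨by simp, by simp⟩
  have : Nonempty 𝒯 := hne.to_subtype
  have hcardH : (𝒯.card : ℝ) ≤ H ^ R := by
    rw [hcard𝒯, hR, ← Finset.prod_pow_eq_pow_sum]
    refine Finset.prod_le_prod (fun _ _ => Nat.cast_nonneg _) fun h _ => ?_
    have := card_piAntidiag_le (ι := ι) (r h)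
    simp only [H]
    exact_mod_cast this
  set 𝒰 := 𝒯.filter fun I => ¬ Balanced η r I with h𝒰
  have hcard𝒰 : 2 * Fintype.card (𝒰 × Fin s) ≤ Fintype.card 𝒯 := by
    have h1 := card_not_balanced_le (ι := ι) hη hη2 hr
    rw [← hcard𝒯] at h1
    simp only [Fintype.card_prod, Fintype.card_coe, Fintype.card_fin]
    have h2 : (2 : ℝ) * (𝒰.card * s) ≤ 𝒯.card := by
      have h3 : (0 : ℝ) ≤ 𝒯.card := Nat.cast_nonneg _
      have h4 : (0 : ℝ) ≤ s := Nat.cast_nonneg _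
      calc (2 : ℝ) * (𝒰.card * s) ≤
            2 * ((2 * N * Real.exp (-(m * η ^ 2 / 4)) * 𝒯.card) * s) := by
              gcongr
        _ = (4 * N * s * Real.exp (-(m * η ^ 2 / 4))) * 𝒯.card := by ring
        _ ≤ 1 * 𝒯.card := by gcongr
        _ = _ := one_mul _
    exact_mod_cast h2
  have hwt : ∀ T ∈ 𝒯, Finsupp.weight (blockWeight m ι) (toExp T) = r := by
    intro T hT
    funext h
    rw [weight_blockWeight]
    rw [h𝒯, Fintype.mem_piFinset] at hT
    simp only [toExp_apply]
    exact (Finset.mem_piAntidiag.1 (hT h)).1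
  have hone : ∀ g : Fin m × ι, wnorm ν (fun _ => 1) (blockSubst m β g) ≤ E := by
    intro g
    refine (wnorm_sum_le (by simp) _ _).trans ?_
    simp only [wnorm_C_mul_X, mul_one]
    exact hEβ g.2
  let A : Matrix (𝒰 × Fin s) 𝒯 ℤ := fun p T =>
    b.repr (coeff (toExp p.1.1) (aeval (blockSubst m β) (monomial (toExp T.1) (1 : ℤ)))) p.2
  have hAbound : ∀ p T, |((A p T : ℤ) : ℝ)| ≤ K₁ * E ^ R := by
    intro p T
    refine (hrepr _ _).trans (mul_le_mul_of_nonneg_left ?_ (by linarith))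
    have h1 := coeff_mul_weight_le_wnorm (ν := ν) (w := fun _ : Fin m × ι => (1 : ℝ)) (by simp)
      (aeval (blockSubst m β) (monomial (toExp T.1) (1 : ℤ))) (toExp p.1.1)
    simp only [Finsupp.prod, one_pow, Finset.prod_const_one, mul_one] at h1
    refine h1.trans ((wnorm_aeval_le (orderSeminorm_one_le b) (by simp) (normRingSeminorm ℤ)
      (fun n => ?_) _ _).trans ?_)
    · rw [normRingSeminorm_int]; simpa using orderSeminorm_intCast_le b n
    · refine (wnorm_le_pow_mul (fun p => wnorm_nonneg (by simp) _) hone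
        (isWeightedHomogeneous_monomial _ _ _ (hwt T.1 T.2))).trans ?_
      rw [wnorm_monomial, normRingSeminorm_int]
      simp [Finsupp.prod, hR]
  obtain ⟨t, ht0, hAt, htb⟩ := exists_small_solution A hcard𝒰
    (one_le_mul_of_one_le_of_one_le hK₁ (one_le_pow₀ hE1)) hAbound
  let P : MvPolynomial (Fin m × ι) ℤ := ∑ T : 𝒯, monomial (toExp T.1) (t T)
  have hcoeffP : ∀ T : 𝒯, coeff (toExp T.1) P = t T := by
    intro T
    simp only [P, coeff_sum, coeff_monomial]
    rw [Finset.sum_eq_single T]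
    · simp
    · intro S _ hS
      rw [if_neg]
      intro h
      exact hS (Subtype.ext (toExp_injective h))
    · simp
  have hPhom : IsWeightedHomogeneous (blockWeight m ι) P r :=
    IsWeightedHomogeneous.sum _ _ _ fun T _ =>
      isWeightedHomogeneous_monomial _ _ _ (hwt T.1 T.2)
  have hPnorm : inorm P ≤ (H ^ R) * (H ^ R * (K₁ * E ^ R)) := by
    refine (wnorm_sum_le (by simp) _ _).trans ?_
    refine (Finset.sum_le_card_nsmul _ _ (𝒯.card * (K₁ * E ^ R)) fun T _ => ?_).trans ?_
    · rw [wnorm_monomial, normRingSeminorm_int]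
      simpa [Finsupp.prod] using htb T
    · rw [Finset.card_univ, Fintype.card_coe, nsmul_eq_mul]
      have : (0 : ℝ) ≤ K₁ * E ^ R := by positivity
      gcongr
  have hK₁R : K₁ ≤ K₁ ^ R := le_self_pow₀ hK₁ (by omega)
  have hPnorm2 : inorm P ≤ (H * H * K₁ * E) ^ R := by
    refine hPnorm.trans ?_
    rw [mul_pow, mul_pow, mul_pow]
    calc (H ^ R) * (H ^ R * (K₁ * E ^ R)) = H ^ R * H ^ R * K₁ * E ^ R := by ring
      _ ≤ _ := by gcongr
  have hβmap : ∀ p, map (algebraMap O ℝ) (blockSubst m β p) =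
      C (D : ℝ) * blockSubst m M⁻¹ p := by
    intro p
    simp only [blockSubst, map_sum, map_mul, map_C, map_X, Finset.mul_sum]
    refine Finset.sum_congr rfl fun k _ => ?_
    rw [← mul_assoc, ← map_mul]
    rfl
  have hscale : map (algebraMap O ℝ) (aeval (blockSubst m β) P) =
      C ((D : ℝ) ^ R) * aeval (blockSubst m M⁻¹) P := by
    rw [← aeval_smul_of_homogeneous hPhom (blockSubst m M⁻¹) (D : ℝ)]
    simp_rw [← hβmap]
    rw [aeval_def, eval₂_eq, aeval_def, eval₂_eq, map_sum]
    simp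
  refine ⟨P, ?_, hPhom, ?_, aeval (blockSubst m M⁻¹) P, ?_, ?_, ?_, ?_⟩
  · intro h0
    apply ht0
    funext T
    rw [← hcoeffP T, h0]; simp
  · refine hPnorm2.trans (pow_le_pow_left₀ (by positivity) ?_ _)
    exact le_mul_of_one_le_right (by positivity) hE1
  · have hBM : M⁻¹ * M = 1 := Matrix.nonsing_inv_mul M (isUnit_iff_ne_zero.2 hdet)
    have h1 : aeval (blockSubst m M) (aeval (blockSubst m M⁻¹) P) =
        aeval (fun p => aeval (blockSubst m M) (blockSubst m M⁻¹ p)) P := by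
      have := comp_aeval_apply (R := ℤ) (blockSubst m M⁻¹)
        ((aeval (blockSubst m M) : MvPolynomial (Fin m × ι) ℝ →ₐ[ℝ] _).restrictScalars ℤ) P
      simpa using this
    rw [h1]
    simp_rw [blockSubst_mul, hBM]
    rw [blockSubst_one]
    exact map_intCast_eq_aeval P
  · have hone' : ∀ g : Fin m × ι,
        wnorm (normRingSeminorm ℝ) (fun _ => 1) (blockSubst m M⁻¹ g) ≤ E := by
      intro g
      refine (wnorm_sum_le (by simp) _ _).trans ?_
      simp only [wnorm_C_mul_X, mul_one, normRingSeminorm_real]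
      exact hEM g.2
    refine (wnorm_aeval_le (by simp [normRingSeminorm_real]) (by simp) (normRingSeminorm ℤ)
      (fun n => by simp [normRingSeminorm_real, normRingSeminorm_int]) _ _).trans ?_
    refine (wnorm_le_pow_mul (fun p => wnorm_nonneg (by simp) _) hone' hPhom).trans ?_
    rw [mul_pow _ E, mul_comm]
    exact mul_le_mul_of_nonneg_right hPnorm2 (by positivity)
  · exact isWeightedHomogeneous_aeval _ (blockSubst_homogeneous m M⁻¹) hPhom
  · intro I hI
    by_contra hbal
    have hGhom := isWeightedHomogeneous_aeval _ (blockSubst_homogeneous m M⁻¹) hPhom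
    let J : Fin m → ι → ℕ := fun h i => I (h, i)
    have hJI : toExp J = I := by ext p; simp [toExp_apply, J]
    have hJ : J ∈ 𝒯 := by
      rw [h𝒯, Fintype.mem_piFinset]
      intro h
      rw [Finset.mem_piAntidiag]
      refine ⟨?_, by simp⟩
      rw [← hGhom (mem_support_iff.1 hI), weight_blockWeight]
    have hJ𝒰 : J ∈ 𝒰 := Finset.mem_filter.2 ⟨hJ, hbal⟩
    have hzero : coeff I (aeval (blockSubst m β) P) = 0 := by
      have hsum : aeval (blockSubst m β) P =
          ∑ T : 𝒯, t T • aeval (blockSubst m β) (monomial (toExp T.1) (1 : ℤ)) := by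
        simp only [P, map_sum]
        refine Finset.sum_congr rfl fun T _ => ?_
        rw [← map_zsmul, smul_monomial, smul_eq_mul, mul_one]
      apply b.repr.injective
      ext j
      rw [hsum, coeff_sum, map_sum, Finsupp.finsetSum_apply]
      have := congrFun hAt (⟨J, hJ𝒰⟩, j)
      rw [Matrix.mulVec, dotProduct] at this
      simp only [A, hJI] at this
      rw [map_zero, Finsupp.zero_apply]
      rw [Pi.zero_apply] at this
      rw [← this]
      refine Finset.sum_congr rfl fun T _ => ?_
      rw [coeff_smul, map_zsmul, Finsupp.smul_apply, smul_eq_mul, mul_comm]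
    have h2 := congrArg (coeff I) hscale
    rw [coeff_map, hzero, map_zero, coeff_C_mul] at h2
    rcases mul_eq_zero.1 h2.symm with h3 | h3
    · exact hD (by exact_mod_cast pow_eq_zero_iff (by omega) |>.1 h3)
    · exact mem_support_iff.1 hI h3

end Auxiliary

end SchmidtSubspace

namespace SchmidtSubspace

open MvPolynomial

section BinomialOperator

variable {σ R : Type*} [Fintype σ] [CommRing R]

/-- The product of the binomial coefficients of the entries of two exponents. -/
def binomProd (a μ : σ →₀ ℕ) : ℕ := ∏ h, (a h).choose (μ h)

/-- The operator multiplying the coefficient at `a` by `binomProd a μ`, that is the Hasse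
derivative of exponent `μ` multiplied by the monomial of exponent `μ`. -/
noncomputable def binomOp (μ : σ →₀ ℕ) (f : MvPolynomial σ R) : MvPolynomial σ R :=
  ∑ a ∈ f.support, monomial a ((binomProd a μ : R) * coeff a f)

lemma coeff_binomOp (μ a : σ →₀ ℕ) (f : MvPolynomial σ R) :
    coeff a (binomOp μ f) = (binomProd a μ : R) * coeff a f := by
  classical
  simp only [binomOp, coeff_sum, coeff_monomial, Finset.sum_ite_eq']
  split_ifs with h
  · rfl
  · rw [notMem_support_iff.1 h, mul_zero]

lemma binomOp_sum {α : Type*} (s : Finset α) (μ : σ →₀ ℕ) (f : α → MvPolynomial σ R) :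
    binomOp μ (∑ i ∈ s, f i) = ∑ i ∈ s, binomOp μ (f i) := by
  ext a
  simp [coeff_binomOp, coeff_sum, Finset.mul_sum]

lemma binomOp_C_mul (μ : σ →₀ ℕ) (c : R) (f : MvPolynomial σ R) :
    binomOp μ (C c * f) = C c * binomOp μ f := by
  ext a
  simp only [coeff_binomOp, coeff_C_mul]
  ring

lemma map_binomOp {S : Type*} [CommRing S] (φ : R →+* S) (μ : σ →₀ ℕ) (f : MvPolynomial σ R) :
    map φ (binomOp μ f) = binomOp μ (map φ f) := by
  ext a
  simp [coeff_binomOp, coeff_map]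

lemma support_binomOp_subset (μ : σ →₀ ℕ) (f : MvPolynomial σ R) :
    (binomOp μ f).support ⊆ f.support := by
  intro a ha
  rw [mem_support_iff, coeff_binomOp] at ha
  exact mem_support_iff.2 (right_ne_zero_of_mul ha)

lemma binomProd_zero (a : σ →₀ ℕ) : binomProd a 0 = 1 := by simp [binomProd]

lemma binomProd_add_single [DecidableEq σ] (a μ : σ →₀ ℕ) (h : σ) :
    (μ h + 1 : ℚ) * binomProd a (μ + Finsupp.single h 1) = ((a h : ℚ) - μ h) * binomProd a μ := by
  have h1 : ∀ ν : σ →₀ ℕ, (binomProd a ν : ℚ) = (a h).choose (ν h) *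
      ∏ x ∈ Finset.univ.erase h, ((a x).choose (ν x) : ℚ) := by
    intro ν
    rw [binomProd]
    push_cast
    exact (Finset.mul_prod_erase _ _ (Finset.mem_univ h)).symm
  rw [h1, h1]
  have h2 : ∏ x ∈ Finset.univ.erase h, ((a x).choose ((μ + Finsupp.single h 1 : σ →₀ ℕ) x) : ℚ) =
      ∏ x ∈ Finset.univ.erase h, ((a x).choose (μ x) : ℚ) := by
    refine Finset.prod_congr rfl fun x hx => ?_
    have : (Finsupp.single h 1 : σ →₀ ℕ) x = 0 :=
      Finsupp.single_eq_of_ne (Finset.ne_of_mem_erase hx)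
    simp [this]
  rw [h2]
  have h3 : (((a h).choose (μ h + 1) : ℕ) : ℚ) * (μ h + 1) = (a h).choose (μ h) * ((a h : ℚ) - μ h) := by
    rcases le_or_gt (μ h) (a h) with hle | hlt
    · have := Nat.choose_succ_right_eq (a h) (μ h)
      have h4 : (((a h - μ h : ℕ)) : ℚ) = (a h : ℚ) - μ h := by push_cast [hle]; ring
      rw [← h4]
      exact_mod_cast this
    · rw [Nat.choose_eq_zero_of_lt hlt, Nat.choose_eq_zero_of_lt (by omega)]; simp
  simp only [Finsupp.add_apply, Finsupp.single_eq_same]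
  linear_combination (∏ x ∈ Finset.univ.erase h, ((a x).choose (μ x) : ℚ)) * h3

lemma inorm_binomOp_le {r : σ → ℕ} (μ : σ →₀ ℕ) {f : MvPolynomial σ ℤ}
    (hf : ∀ h, degreeOf h f ≤ r h) : inorm (binomOp μ f) ≤ 2 ^ (∑ h, r h) * inorm f := by
  rw [inorm, wnorm_eq_sum_of_support_subset _ (support_binomOp_subset μ f), inorm, wnorm,
    Finset.mul_sum]
  refine Finset.sum_le_sum fun a ha => ?_
  rw [coeff_binomOp, normRingSeminorm_int, normRingSeminorm_int]
  push_cast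
  rw [abs_mul, ← mul_assoc]
  simp only [Finsupp.prod, one_pow, Finset.prod_const_one, mul_one]
  refine mul_le_mul_of_nonneg_right ?_ (abs_nonneg _)
  rw [abs_of_nonneg (Nat.cast_nonneg _)]
  have : binomProd a μ ≤ 2 ^ ∑ h, r h := by
    rw [← Finset.prod_pow_eq_pow_sum]
    refine Finset.prod_le_prod' fun h _ => ?_
    refine (Nat.choose_le_two_pow _ _).trans (Nat.pow_le_pow_right (by norm_num) ?_)
    exact (degreeOf_le_iff.1 (hf h)) a ha
  exact_mod_cast this

end BinomialOperator

section Index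

variable {σ : Type*} [Fintype σ]

/-- Translation of the variables by `ξ`. -/
noncomputable def translate (ξ : σ → ℚ) : MvPolynomial σ ℚ →ₐ[ℚ] MvPolynomial σ ℚ :=
  aeval fun h => X h + C (ξ h)

/-- The weighted order of an exponent with respect to the degrees `r`. -/
noncomputable def idx (r : σ → ℕ) (J : σ →₀ ℕ) : ℝ := ∑ h, (J h : ℝ) / r h

lemma idx_nonneg (r : σ → ℕ) (J : σ →₀ ℕ) : 0 ≤ idx r J :=
  Finset.sum_nonneg fun _ _ => by positivity

lemma idx_add (r : σ → ℕ) (I J : σ →₀ ℕ) : idx r (I + J) = idx r I + idx r J := by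
  simp [idx, add_div, Finset.sum_add_distrib]

lemma idx_single (r : σ → ℕ) (h : σ) (n : ℕ) : idx r (Finsupp.single h n) = n / r h := by
  classical
  rw [idx, Finset.sum_eq_single h]
  · simp
  · intro j _ hj; simp [Finsupp.single_eq_of_ne hj]
  · simp

/-- The exponents of order less than `t` do not occur. -/
def OrderGE (r : σ → ℕ) (t : ℝ) (f : MvPolynomial σ ℚ) : Prop :=
  ∀ J, idx r J < t → coeff J f = 0

variable {r : σ → ℕ} {t u : ℝ} {f g : MvPolynomial σ ℚ}

lemma OrderGE.mono (hf : OrderGE r t f) (hu : u ≤ t) : OrderGE r u f :=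
  fun J hJ => hf J (hJ.trans_le hu)

lemma orderGE_of_nonpos (ht : t ≤ 0) : OrderGE r t f :=
  fun J hJ => absurd (hJ.trans_le ht) (not_lt.2 (idx_nonneg r J))

lemma OrderGE.sum {α : Type*} {s : Finset α} {f : α → MvPolynomial σ ℚ}
    (hf : ∀ a ∈ s, OrderGE r t (f a)) : OrderGE r t (∑ a ∈ s, f a) := by
  intro J hJ
  rw [coeff_sum]
  exact Finset.sum_eq_zero fun a ha => hf a ha J hJ

lemma OrderGE.mul (hf : OrderGE r t f) (hg : OrderGE r u g) : OrderGE r (t + u) (f * g) := by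
  classical
  intro J hJ
  rw [coeff_mul]
  refine Finset.sum_eq_zero fun p hp => ?_
  rw [Finset.HasAntidiagonal.mem_antidiagonal] at hp
  rw [← hp, idx_add] at hJ
  rcases lt_or_ge (idx r p.1) t with h | h
  · rw [hf _ h, zero_mul]
  · rw [hg _ (by linarith), mul_zero]

lemma OrderGE.mul_left (hg : OrderGE r u g) : OrderGE r u (f * g) := by
  simpa using (orderGE_of_nonpos (f := f) (r := r) le_rfl).mul hg

lemma OrderGE.prod {α : Type*} {s : Finset α} {f : α → MvPolynomial σ ℚ} {t : α → ℝ}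
    (hf : ∀ a ∈ s, OrderGE r (t a) (f a)) : OrderGE r (∑ a ∈ s, t a) (∏ a ∈ s, f a) := by
  classical
  induction s using Finset.induction_on with
  | empty => exact orderGE_of_nonpos (by simp)
  | insert a s ha ih =>
    rw [Finset.sum_insert ha, Finset.prod_insert ha]
    exact (hf a (Finset.mem_insert_self _ _)).mul
      (ih fun b hb => hf b (Finset.mem_insert_of_mem hb))

lemma OrderGE.sub (hf : OrderGE r t f) (hg : OrderGE r t g) : OrderGE r t (f - g) := by
  intro J hJ
  rw [coeff_sub, hf J hJ, hg J hJ, sub_zero]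

lemma OrderGE.pderiv (hf : OrderGE r t f) (h : σ) :
    OrderGE r (t - 1 / r h) (pderiv h f) := by
  intro J hJ
  rw [coeff_pderiv, hf, zero_mul]
  rw [idx_add, idx_single]
  push_cast
  linarith

lemma pderiv_translate (ξ : σ → ℚ) (h : σ) (f : MvPolynomial σ ℚ) :
    pderiv h (translate ξ f) = translate ξ (pderiv h f) := by
  classical
  induction f using MvPolynomial.induction_on with
  | C a => simp [translate, algebraMap_eq]
  | add p q hp hq => simp [hp, hq]
  | mul_X p i hp =>
    have : translate ξ (X i) = X i + C (ξ i) := by simp [translate]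
    rw [map_mul, this, Derivation.leibniz, hp, Derivation.leibniz, smul_eq_mul,
      smul_eq_mul, smul_eq_mul, smul_eq_mul, map_add (pderiv h), map_add (translate ξ), map_mul, map_mul, this]
    simp only [pderiv_X, pderiv_C, add_zero]
    rcases eq_or_ne i h with rfl | hne
    · simp
    · simp [Pi.single_eq_of_ne hne]

lemma binomOp_add_single [DecidableEq σ] (μ : σ →₀ ℕ) (h : σ) (f : MvPolynomial σ ℚ) :
    binomOp (μ + Finsupp.single h 1) f =
      C ((μ h + 1 : ℚ)⁻¹) * (X h * pderiv h (binomOp μ f) - C (μ h : ℚ) * binomOp μ f) := by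
  ext a
  have hX : coeff a (X h * pderiv h (binomOp μ f)) = a h * coeff a (binomOp μ f) := by
    rw [mul_comm, coeff_mul_X']
    split_ifs with ha
    · rw [coeff_pderiv]
      have h1 : 1 ≤ a h := Nat.one_le_iff_ne_zero.2 (Finsupp.mem_support_iff.1 ha)
      have h2 : a - Finsupp.single h 1 + Finsupp.single h 1 = a :=
        tsub_add_cancel_of_le (by simpa using h1)
      rw [h2]
      have h3 : (((a - Finsupp.single h 1 : σ →₀ ℕ) h : ℕ) : ℚ) + 1 = a h := by
        rw [Finsupp.tsub_apply, Finsupp.single_eq_same]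
        push_cast [h1]; ring
      rw [h3, mul_comm]
    · rw [Finsupp.notMem_support_iff.1 ha]; simp
  rw [coeff_C_mul, coeff_sub, hX, coeff_C_mul, coeff_binomOp, coeff_binomOp]
  have := binomProd_add_single a μ h
  have h0 : (μ h + 1 : ℚ) ≠ 0 := by positivity
  field_simp
  linear_combination coeff a f * this

/-- Applying `binomOp μ` lowers the order at a point by at most the order of `μ`. -/
lemma orderGE_translate_binomOp {ξ : σ → ℚ} (hf : OrderGE r t (translate ξ f)) (μ : σ →₀ ℕ) :
    OrderGE r (t - idx r μ) (translate ξ (binomOp μ f)) := by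
  classical
  induction μ using WellFoundedLT.induction with
  | ind μ ih =>
    by_cases hμ : μ = 0
    · subst hμ
      have h1 : binomOp 0 f = f := by ext a; simp [coeff_binomOp, binomProd_zero]
      have h2 : idx r (0 : σ →₀ ℕ) = 0 := by simp [idx]
      rwa [h1, h2, sub_zero]
    · obtain ⟨h, hh⟩ := Finsupp.ne_iff.1 hμ
      have h1 : 1 ≤ μ h := Nat.one_le_iff_ne_zero.2 hh
      obtain ⟨μ', rfl⟩ : ∃ μ' : σ →₀ ℕ, μ = μ' + Finsupp.single h 1 :=
        ⟨μ - Finsupp.single h 1, (tsub_add_cancel_of_le (by simpa using h1)).symm⟩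
      have ih' := ih μ' (lt_add_of_pos_right _ (by rw [pos_iff_ne_zero]; simp))
      rw [binomOp_add_single, map_mul]
      refine OrderGE.mul_left ?_
      rw [map_sub, map_mul, map_mul, ← pderiv_translate]
      have hidx : idx r (μ' + Finsupp.single h 1) = idx r μ' + 1 / r h := by
        rw [idx_add, idx_single]; simp
      refine OrderGE.sub (OrderGE.mul_left ?_) (OrderGE.mul_left (ih'.mono ?_))
      · exact (ih'.pderiv h).mono (by rw [hidx]; linarith)
      · rw [hidx]
        have : (0 : ℝ) ≤ 1 / r h := by positivity
        linarith

end Index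

end SchmidtSubspace

namespace SchmidtSubspace

open MvPolynomial
open scoped MonomialOrder

section Wronskian

variable {σ : Type*} [Fintype σ] {k : ℕ}

/-- The span of the vectors of binomial coefficients of order at most `d`. -/
noncomputable def binomSpan (a : Fin k → σ →₀ ℕ) (d : ℕ) : Submodule ℚ (Fin k → ℚ) :=
  Submodule.span ℚ ((fun μ : σ →₀ ℕ => fun j => (binomProd (a j) μ : ℚ)) '' {μ | μ.degree ≤ d})

lemma sub_mul_mem_binomSpan (a : Fin k → σ →₀ ℕ) {d : ℕ} {w : Fin k → ℚ}
    (hw : w ∈ binomSpan a d) (c : σ) (s : ℚ) :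
    (fun j => (a j c - s) * w j) ∈ binomSpan a (d + 1) := by
  classical
  induction hw using Submodule.span_induction with
  | zero =>
    convert (binomSpan a (d + 1)).zero_mem using 1
    ext j; simp
  | add x y _ _ hx hy =>
    convert (binomSpan a (d + 1)).add_mem hx hy using 1
    ext j; simp; ring
  | smul q x _ hx =>
    convert (binomSpan a (d + 1)).smul_mem q hx using 1
    ext j; simp; ring
  | mem x hx =>
    obtain ⟨μ, hμ, rfl⟩ := hx
    have h1 : (fun j => (binomProd (a j) μ : ℚ)) ∈ binomSpan a (d + 1) :=
      Submodule.subset_span ⟨μ, le_trans hμ (Nat.le_succ d), rfl⟩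
    have h2 : (fun j => (binomProd (a j) (μ + Finsupp.single c 1) : ℚ)) ∈ binomSpan a (d + 1) := by
      refine Submodule.subset_span ⟨_, ?_, rfl⟩
      simp only [Set.mem_ofPred_eq, map_add, Finsupp.degree_single] at hμ ⊢
      omega
    convert (binomSpan a (d + 1)).add_mem ((binomSpan a (d + 1)).smul_mem (μ c + 1 : ℚ) h2)
      ((binomSpan a (d + 1)).smul_mem (μ c - s) h1) using 1
    ext j
    have := binomProd_add_single (a j) μ c
    simp only [Pi.add_apply, Pi.smul_apply, smul_eq_mul]
    linear_combination -this

lemma binomSpan_eq_top {a : Fin k → σ →₀ ℕ} (ha : Function.Injective a) :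
    binomSpan a (k - 1) = ⊤ := by
  classical
  have key : ∀ (i : Fin k) (t : Finset (Fin k)), i ∉ t → ∃ w ∈ binomSpan a t.card,
      w i ≠ 0 ∧ ∀ j ∈ t, w j = 0 := by
    intro i t
    induction t using Finset.induction_on with
    | empty =>
      intro _
      refine ⟨fun j => (binomProd (a j) 0 : ℚ), Submodule.subset_span ⟨0, by simp, rfl⟩, ?_, by simp⟩
      simp [binomProd_zero]
    | insert b t hb ih =>
      intro hi
      rw [Finset.mem_insert, not_or] at hi
      obtain ⟨w, hw, hwi, hwt⟩ := ih hi.2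
      obtain ⟨c, hc⟩ := Finsupp.ne_iff.1 (ha.ne hi.1)
      refine ⟨_, by rw [Finset.card_insert_of_notMem hb]; exact sub_mul_mem_binomSpan a hw c (a b c),
        mul_ne_zero (sub_ne_zero.2 (Nat.cast_injective.ne hc)) hwi, ?_⟩
      intro j hj
      rcases Finset.mem_insert.1 hj with rfl | hj
      · simp
      · simp [hwt j hj]
  rw [eq_top_iff]
  rintro x -
  rw [pi_eq_sum_univ' x]
  refine Submodule.sum_mem _ fun i _ => Submodule.smul_mem _ _ ?_
  obtain ⟨w, hw, hwi, hwt⟩ := key i (Finset.univ.erase i) (by simp)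
  rw [Finset.card_erase_of_mem (Finset.mem_univ i), Finset.card_univ, Fintype.card_fin] at hw
  convert (binomSpan a (k - 1)).smul_mem (w i)⁻¹ hw using 1
  ext j
  by_cases hj : j = i
  · subst hj; simp [hwi]
  · simp [hwt j (by simp [hj]), Ne.symm hj]

/-- Distinct exponents are separated by binomial coefficients of small order. -/
lemma exists_det_binomProd_ne_zero {a : Fin k → σ →₀ ℕ} (ha : Function.Injective a) :
    ∃ μ : Fin k → σ →₀ ℕ, (∀ i, (μ i).degree ≤ k - 1) ∧
      (Matrix.of fun i j => (binomProd (a j) (μ i) : ℚ)).det ≠ 0 := by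
  obtain ⟨f, hf, -, hli⟩ := Submodule.exists_fun_fin_finrank_span_eq ℚ
    ((fun μ : σ →₀ ℕ => fun j : Fin k => (binomProd (a j) μ : ℚ)) '' {μ | μ.degree ≤ k - 1})
  have hrank : Module.finrank ℚ (Submodule.span ℚ
      ((fun μ : σ →₀ ℕ => fun j : Fin k => (binomProd (a j) μ : ℚ)) '' {μ | μ.degree ≤ k - 1}))
      = k := by
    have := binomSpan_eq_top ha
    rw [binomSpan] at this
    rw [this]; simp
  choose μ hμ hμf using hf
  let e := finCongr hrank.symm
  refine ⟨fun i => μ (e i), fun i => hμ _, ?_⟩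
  have h : LinearIndependent ℚ (fun i => f (e i)) := hli.comp _ e.injective
  have h2 := (Matrix.linearIndependent_rows_iff_isUnit (A := Matrix.of fun i => f (e i))).1 h
  rw [Matrix.isUnit_iff_isUnit_det] at h2
  convert h2.ne_zero using 3
  ext i j
  rw [← hμf]

lemma exists_distinct_degrees (m : MonomialOrder σ) {φ : Fin k → MvPolynomial σ ℚ}
    (hφ : LinearIndependent ℚ φ) : ∃ f : Fin k → MvPolynomial σ ℚ,
      (∀ j, f j ∈ Submodule.span ℚ (Set.range φ)) ∧ (∀ j, f j ≠ 0) ∧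
      Function.Injective fun j => m.degree (f j) := by
  classical
  set D : Set (σ →₀ ℕ) := m.degree '' {f | f ∈ Submodule.span ℚ (Set.range φ) ∧ f ≠ 0} with hD
  obtain ⟨t, htD, htk⟩ : ∃ t : Finset (σ →₀ ℕ), (t : Set _) ⊆ D ∧ t.card = k := by
    rcases D.finite_or_infinite with hfin | hinf
    · have hle : k ≤ hfin.toFinset.card := by
        let T : Submodule.span ℚ (Set.range φ) →ₗ[ℚ] (hfin.toFinset → ℚ) :=
          LinearMap.pi fun d => (lcoeff ℚ (d : σ →₀ ℕ)).comp (Submodule.subtype _)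
        have hT : Function.Injective T := by
          rw [injective_iff_map_eq_zero]
          intro w hw
          by_contra hne
          have hne' : (w : MvPolynomial σ ℚ) ≠ 0 := by simpa using hne
          have hmem : m.degree (w : MvPolynomial σ ℚ) ∈ hfin.toFinset := by
            rw [Set.Finite.mem_toFinset]
            exact ⟨_, ⟨w.2, hne'⟩, rfl⟩
          have := congrFun hw ⟨_, hmem⟩
          exact (m.coeff_degree_ne_zero_iff.2 hne') this
        have := LinearMap.finrank_le_finrank_of_injective hT
        rw [finrank_span_eq_card hφ] at this
        simpa using this
      obtain ⟨t, ht, htk⟩ := Finset.exists_subset_card_eq hle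
      exact ⟨t, fun x hx => by simpa using ht hx, htk⟩
    · exact hinf.exists_subset_card_eq k
  let e := (Finset.equivFinOfCardEq htk).symm
  have h : ∀ j, ∃ f : MvPolynomial σ ℚ, (f ∈ Submodule.span ℚ (Set.range φ) ∧ f ≠ 0) ∧
      m.degree f = e j := fun j => htD (e j).2
  choose f hf hfe using h
  refine ⟨f, fun j => (hf j).1, fun j => (hf j).2, ?_⟩
  intro i j hij
  simp only [hfe] at hij
  exact e.injective (Subtype.ext hij)

lemma coeff_prod_of_degree_le (m : MonomialOrder σ) {α : Type*} (s : Finset α)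
    {g : α → MvPolynomial σ ℚ} {a : α → σ →₀ ℕ} (h : ∀ i ∈ s, m.degree (g i) ≼[m] a i) :
    m.degree (∏ i ∈ s, g i) ≼[m] (∑ i ∈ s, a i) ∧
      coeff (∑ i ∈ s, a i) (∏ i ∈ s, g i) = ∏ i ∈ s, coeff (a i) (g i) := by
  classical
  induction s using Finset.induction_on with
  | empty => simp
  | insert b s hb ih =>
    obtain ⟨h1, h2⟩ := ih fun i hi => h i (Finset.mem_insert_of_mem hi)
    have hb' := h b (Finset.mem_insert_self _ _)
    simp only [Finset.prod_insert hb, Finset.sum_insert hb]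
    refine ⟨m.degree_mul_le.trans ?_, ?_⟩
    · simp only [map_add]
      exact add_le_add hb' h1
    · rw [m.coeff_mul_of_add_of_degree_le hb' h1, h2]

/-- A generalised Wronskian of linearly independent polynomials does not vanish. -/
lemma exists_wronskian_ne_zero [LinearOrder σ] {φ : Fin k → MvPolynomial σ ℚ}
    (hφ : LinearIndependent ℚ φ) :
    ∃ μ : Fin k → σ →₀ ℕ, (∀ i, (μ i).degree ≤ k - 1) ∧
      (Matrix.of fun i j => binomOp (μ i) (φ j)).det ≠ 0 := by
  classical
  let m : MonomialOrder σ := MonomialOrder.lex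
  obtain ⟨f, hf, hf0, hinj⟩ := exists_distinct_degrees m hφ
  obtain ⟨μ, hμ, hdet⟩ := exists_det_binomProd_ne_zero hinj
  refine ⟨μ, hμ, fun hzero => ?_⟩
  choose T hT using fun j => (Submodule.mem_span_range_iff_exists_fun ℚ).1 (hf j)
  have hmul : (Matrix.of fun i j => binomOp (μ i) (f j)) =
      (Matrix.of fun i j => binomOp (μ i) (φ j)) * (Matrix.of fun l j => C (T j l)) := by
    ext1 i j
    rw [Matrix.mul_apply, Matrix.of_apply, ← hT j, binomOp_sum]
    refine Finset.sum_congr rfl fun l _ => ?_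
    rw [MvPolynomial.smul_eq_C_mul, binomOp_C_mul, Matrix.of_apply, Matrix.of_apply, mul_comm]
  have h0 : (Matrix.of fun i j => binomOp (μ i) (f j)).det = 0 := by
    rw [hmul, Matrix.det_mul, hzero, zero_mul]
  have hc := congrArg (coeff (∑ j, m.degree (f j))) h0
  rw [Matrix.det_apply', coeff_sum, coeff_zero] at hc
  have hterm : ∀ τ : Equiv.Perm (Fin k), coeff (∑ j, m.degree (f j))
      (((Equiv.Perm.sign τ : ℤ) : MvPolynomial σ ℚ) *
        ∏ j, (Matrix.of fun i j => binomOp (μ i) (f j)) (τ j) j) =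
      ((Equiv.Perm.sign τ : ℤ) : ℚ) * ∏ j,
        (Matrix.of fun i j => (binomProd (m.degree (f j)) (μ i) : ℚ)) (τ j) j *
          m.leadingCoeff (f j) := by
    intro τ
    rw [← map_intCast (C (σ := σ) (R := ℚ)), coeff_C_mul,
      (coeff_prod_of_degree_le m Finset.univ fun j _ => ?_).2]
    · congr 1
      refine Finset.prod_congr rfl fun j _ => ?_
      rw [Matrix.of_apply, coeff_binomOp]; rfl
    · exact m.degree_le_degree_of_support_subset (support_binomOp_subset _ _)
  simp only [hterm, Finset.prod_mul_distrib, ← mul_assoc] at hc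
  rw [← Finset.sum_mul, ← Matrix.det_apply'] at hc
  refine (mul_ne_zero hdet ?_) hc
  exact Finset.prod_ne_zero_iff.2 fun j _ => m.leadingCoeff_ne_zero_iff.2 (hf0 j)

end Wronskian

end SchmidtSubspace

namespace SchmidtSubspace

open MvPolynomial

section Slice

variable {σ τ R : Type*} [CommRing R]

/-- The polynomial whose coefficients are those of `P` along an injective family of exponents. -/
noncomputable def slice (e : (τ →₀ ℕ) → (σ →₀ ℕ)) (he : Function.Injective e)
    (P : MvPolynomial σ R) : MvPolynomial τ R :=
  ∑ a ∈ P.support.preimage e he.injOn, monomial a (coeff (e a) P)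

lemma coeff_slice (e : (τ →₀ ℕ) → (σ →₀ ℕ)) (he : Function.Injective e) (P : MvPolynomial σ R)
    (a : τ →₀ ℕ) : coeff a (slice e he P) = coeff (e a) P := by
  classical
  simp only [slice, coeff_sum, coeff_monomial, Finset.sum_ite_eq', Finset.mem_preimage]
  split_ifs with h
  · rfl
  · rw [notMem_support_iff.1 h]

lemma map_slice {S : Type*} [CommRing S] (φ : R →+* S) (e : (τ →₀ ℕ) → (σ →₀ ℕ))
    (he : Function.Injective e) (P : MvPolynomial σ R) :
    map φ (slice e he P) = slice e he (map φ P) := by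
  ext a
  simp [coeff_map, coeff_slice]

lemma inorm_slice_le (e : (τ →₀ ℕ) → (σ →₀ ℕ)) (he : Function.Injective e)
    (P : MvPolynomial σ ℤ) : inorm (slice e he P) ≤ inorm P := by
  classical
  rw [inorm_eq, inorm_eq]
  simp only [coeff_slice]
  rw [← Finset.sum_image (f := fun k => |((coeff k P : ℤ) : ℝ)|) (g := e) he.injOn]
  refine Finset.sum_le_sum_of_subset_of_nonneg ?_ fun _ _ _ => abs_nonneg _
  intro k hk
  obtain ⟨a, ha, rfl⟩ := Finset.mem_image.1 hk
  rw [mem_support_iff, coeff_slice] at ha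
  exact mem_support_iff.2 ha

end Slice

section Tensor

variable {n : ℕ}

/-- The product of polynomials in complementary sets of variables. -/
noncomputable def tens (u : MvPolynomial (Fin n) ℚ) (v : MvPolynomial (Fin 1) ℚ) :
    MvPolynomial (Fin (n + 1)) ℚ :=
  rename Fin.succ u * rename (fun _ => 0) v

lemma eq_single_zero (b : Fin 1 →₀ ℕ) : b = Finsupp.single 0 (b 0) := by
  refine Finsupp.ext fun i => ?_
  rw [Subsingleton.elim i 0]; simp

lemma mapDomain_add_mapDomain (a : Fin n →₀ ℕ) (b : Fin 1 →₀ ℕ) :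
    Finsupp.mapDomain Fin.succ a + Finsupp.mapDomain (fun _ => (0 : Fin (n + 1))) b =
      Finsupp.cons (b 0) a := by
  have hb := eq_single_zero b
  ext i
  refine Fin.cases ?_ (fun j => ?_) i
  · rw [hb, Finsupp.add_apply, Finsupp.mapDomain_single,
      Finsupp.mapDomain_of_notMem_range _ _ (by simp)]
    simp
  · rw [hb, Finsupp.add_apply, Finsupp.mapDomain_single,
      Finsupp.mapDomain_apply (Fin.succ_injective n)]
    simp

lemma coeff_tens (u : MvPolynomial (Fin n) ℚ) (v : MvPolynomial (Fin 1) ℚ)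
    (c : ℕ) (a : Fin n →₀ ℕ) :
    coeff (Finsupp.cons c a) (tens u v) = coeff a u * coeff (Finsupp.single 0 c) v := by
  classical
  have key : ∀ (a' : Fin n →₀ ℕ) (x : ℚ) (b' : Fin 1 →₀ ℕ) (y : ℚ),
      coeff (Finsupp.cons c a) (tens (monomial a' x) (monomial b' y)) =
        coeff a (monomial a' x) * coeff (Finsupp.single 0 c) (monomial b' y) := by
    intro a' x b' y
    have hb := eq_single_zero b'
    have hb2 : b' = Finsupp.single 0 c ↔ b' 0 = c :=
      ⟨fun h => by rw [h]; simp, fun h => by rw [hb, h]⟩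
    rw [tens, rename_monomial, rename_monomial, monomial_mul, mapDomain_add_mapDomain,
      coeff_monomial, coeff_monomial, coeff_monomial]
    simp only [hb2, Finsupp.cons_injective2.eq_iff]
    by_cases h1 : a' = a <;> by_cases h2 : b' 0 = c <;> simp [h1, h2]
  conv_lhs => rw [u.as_sum, v.as_sum]
  conv_rhs => rw [u.as_sum, v.as_sum]
  rw [tens, map_sum, map_sum, Finset.sum_mul_sum, coeff_sum, coeff_sum, coeff_sum,
    Finset.sum_mul_sum]
  refine Finset.sum_congr rfl fun i _ => ?_
  rw [coeff_sum]
  exact Finset.sum_congr rfl fun j _ => key _ _ _ _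

lemma ext_cons {f g : MvPolynomial (Fin (n + 1)) ℚ}
    (h : ∀ c a, coeff (Finsupp.cons c a) f = coeff (Finsupp.cons c a) g) : f = g := by
  ext m
  rw [← Finsupp.cons_tail m]
  exact h _ _

lemma binomProd_cons (c l : ℕ) (a μ : Fin n →₀ ℕ) :
    binomProd (Finsupp.cons c a) (Finsupp.cons l μ) = c.choose l * binomProd a μ := by
  simp [binomProd, Fin.prod_univ_succ]

lemma binomOp_tens (l : Fin 1 →₀ ℕ) (μ : Fin n →₀ ℕ) (u : MvPolynomial (Fin n) ℚ)
    (v : MvPolynomial (Fin 1) ℚ) :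
    binomOp (Finsupp.cons (l 0) μ) (tens u v) = tens (binomOp μ u) (binomOp l v) := by
  refine ext_cons fun c a => ?_
  rw [coeff_binomOp, coeff_tens, coeff_tens, coeff_binomOp, coeff_binomOp, binomProd_cons]
  simp [binomProd]
  ring

lemma translate_rename {σ τ : Type*} (e : σ → τ) (ξ : τ → ℚ) (u : MvPolynomial σ ℚ) :
    translate ξ (rename e u) = rename e (translate (ξ ∘ e) u) := by
  have : (translate ξ).comp (rename e) = (rename e).comp (translate (ξ ∘ e)) := by
    ext i
    simp [translate]
  exact DFunLike.congr_fun this u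

lemma translate_tens (ξ : Fin (n + 1) → ℚ) (u : MvPolynomial (Fin n) ℚ)
    (v : MvPolynomial (Fin 1) ℚ) :
    translate ξ (tens u v) = tens (translate (fun i => ξ i.succ) u) (translate (fun _ => ξ 0) v) := by
  rw [tens, map_mul, translate_rename, translate_rename, tens]
  rfl

end Tensor

section Univariate

/-- The order of vanishing of an integral polynomial at a rational point is bounded in terms of its
size and of the denominator. -/
lemma exists_coeff_translate_ne_zero {f : MvPolynomial (Fin 1) ℤ} (hf : f ≠ 0) {p q : ℤ}
    (hq : 0 < q) (hpq : IsCoprime p q) :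
    ∃ e : ℕ, coeff (Finsupp.single 0 e) (translate (fun _ => (p : ℚ) / q)
      (map (Int.castRingHom ℚ) f)) ≠ 0 ∧ (q : ℝ) ^ e ≤ inorm f := by
  classical
  have hcoeff : ∀ {R : Type} [CommRing R] (g : MvPolynomial (Fin 1) R) (e : ℕ),
      (aeval (fun _ : Fin 1 => (Polynomial.X : Polynomial R)) g).coeff e =
        coeff (Finsupp.single 0 e) g := by
    intro R _ g e
    induction g using MvPolynomial.induction_on' with
    | monomial u a =>
      have hu := eq_single_zero u
      have hu2 : u = Finsupp.single 0 e ↔ e = u 0 :=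
        ⟨fun h => by rw [h]; simp, fun h => by rw [hu, h]⟩
      rw [aeval_monomial, coeff_monomial, hu, Finsupp.prod_single_index (by simp), ← hu,
        Polynomial.algebraMap_apply, Algebra.algebraMap_self, RingHom.id_apply,
        Polynomial.coeff_C_mul_X_pow]
      simp only [hu2]
    | add g h hg hh => rw [map_add, Polynomial.coeff_add, hg, hh, coeff_add]
  set g : Polynomial ℤ := aeval (fun _ : Fin 1 => (Polynomial.X : Polynomial ℤ)) f with hg
  have hmap : aeval (fun _ : Fin 1 => (Polynomial.X : Polynomial ℚ)) (map (Int.castRingHom ℚ) f) =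
      g.map (Int.castRingHom ℚ) := by
    ext e
    rw [hcoeff, Polynomial.coeff_map, hg, hcoeff, coeff_map]
  have hg0 : g ≠ 0 := by
    obtain ⟨d, hd⟩ := MvPolynomial.ne_zero_iff.1 hf
    intro h0
    have h1 := hcoeff f (d 0)
    rw [← hg, h0, Polynomial.coeff_zero] at h1
    have hu := eq_single_zero d
    rw [← hu] at h1
    exact hd h1.symm
  set t : ℚ := (p : ℚ) / q with ht
  have hqQ : (q : ℚ) ≠ 0 := by exact_mod_cast hq.ne'
  have htr : ∀ h : MvPolynomial (Fin 1) ℚ,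
      aeval (fun _ : Fin 1 => (Polynomial.X : Polynomial ℚ)) (translate (fun _ => t) h) =
      (aeval (fun _ : Fin 1 => (Polynomial.X : Polynomial ℚ)) h).comp
        (Polynomial.X + Polynomial.C t) := by
    intro h
    have : (aeval (fun _ : Fin 1 => (Polynomial.X : Polynomial ℚ))).comp (translate (fun _ => t)) =
        (Polynomial.aeval (Polynomial.X + Polynomial.C t)).comp
          (aeval (fun _ : Fin 1 => (Polynomial.X : Polynomial ℚ))) := by
      ext i
      simp [translate]
    exact DFunLike.congr_fun this h
  have hG0 : g.map (Int.castRingHom ℚ) ≠ 0 :=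
    (Polynomial.map_ne_zero_iff Int.cast_injective).2 hg0
  refine ⟨(g.map (Int.castRingHom ℚ)).rootMultiplicity t, ?_, ?_⟩
  · rw [← hcoeff, htr, hmap, Polynomial.rootMultiplicity_eq_natTrailingDegree]
    rw [← Polynomial.trailingCoeff, Ne, Polynomial.trailingCoeff_eq_zero]
    rw [← Polynomial.taylor_apply]
    intro h
    exact hG0 ((Polynomial.taylor_eq_zero _ _).1 h)
  · set e := (g.map (Int.castRingHom ℚ)).rootMultiplicity t
    have hdvd := Polynomial.pow_rootMultiplicity_dvd (g.map (Int.castRingHom ℚ)) t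
    have hprim : (Polynomial.C q * Polynomial.X - Polynomial.C p).IsPrimitive := by
      intro r hr
      rw [Polynomial.C_dvd_iff_dvd_coeff] at hr
      have h0 := hr 0
      have h1 := hr 1
      simp only [Polynomial.coeff_sub, Polynomial.coeff_C_mul, Polynomial.coeff_X_one,
        Polynomial.coeff_C_succ, mul_one, sub_zero, Polynomial.coeff_X_zero, mul_zero,
        Polynomial.coeff_C_zero, zero_sub, dvd_neg] at h0 h1
      exact hpq.isUnit_of_dvd' h0 h1
    have hfac : (Polynomial.C q * Polynomial.X - Polynomial.C p).map (Int.castRingHom ℚ) =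
        Polynomial.C (q : ℚ) * (Polynomial.X - Polynomial.C t) := by
      have : (q : ℚ) * t = p := by rw [ht]; field_simp
      rw [mul_sub, ← Polynomial.C_mul, this]
      simp
    have hdvd2 : (Polynomial.C q * Polynomial.X - Polynomial.C p) ^ e ∣ g := by
      have hprim' : ((Polynomial.C q * Polynomial.X - Polynomial.C p) ^ e).IsPrimitive := by
        clear_value e
        induction e with
        | zero => simp
        | succ e ih => rw [pow_succ]; exact ih.mul hprim
      rw [Polynomial.IsPrimitive.Int.dvd_iff_map_cast_dvd_map_cast _ _ hprim', Polynomial.map_pow,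
        hfac, mul_pow]
      have hu : IsUnit (Polynomial.C (q : ℚ) ^ e) :=
        (Polynomial.isUnit_C.2 (isUnit_iff_ne_zero.2 hqQ)).pow e
      exact hu.mul_left_dvd.2 hdvd
    obtain ⟨w, hw⟩ := hdvd2
    have hlc : q ^ e ∣ g.leadingCoeff := by
      rw [hw, Polynomial.leadingCoeff_mul, Polynomial.leadingCoeff_pow]
      have : (Polynomial.C q * Polynomial.X - Polynomial.C p).leadingCoeff = q := by
        rw [sub_eq_add_neg, ← Polynomial.C_neg]
        exact Polynomial.leadingCoeff_linear hq.ne'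
      rw [this]
      exact dvd_mul_right _ _
    have hle : (q : ℤ) ^ e ≤ |g.leadingCoeff| :=
      Int.le_of_dvd (abs_pos.2 (Polynomial.leadingCoeff_ne_zero.2 hg0)) ((dvd_abs _ _).2 hlc)
    have h2 := abs_coeff_le_inorm f (Finsupp.single 0 g.natDegree)
    rw [← hcoeff, ← hg, Polynomial.coeff_natDegree] at h2
    refine le_trans ?_ h2
    exact_mod_cast hle

end Univariate

section Determinant

variable {σ : Type*} {k : ℕ}

lemma inorm_det_le {A : Matrix (Fin k) (Fin k) (MvPolynomial σ ℤ)} {B : ℝ}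
    (hA : ∀ i j, inorm (A i j) ≤ B) : inorm A.det ≤ k.factorial * B ^ k := by
  have hw : ∀ i : σ, (0 : ℝ) ≤ (fun _ => 1 : σ → ℝ) i := fun _ => zero_le_one
  have h1 : normRingSeminorm ℤ (1 : ℤ) ≤ 1 := by simp [normRingSeminorm_int]
  have hterm : ∀ τ : Equiv.Perm (Fin k), inorm (Equiv.Perm.sign τ • ∏ i, A (τ i) i) ≤ B ^ k := by
    intro τ
    have : inorm (∏ i, A (τ i) i) ≤ B ^ k := by
      refine (wnorm_prod_le h1 hw _ _).trans ?_
      refine (Finset.prod_le_prod (fun i _ => inorm_nonneg _) fun i _ => hA (τ i) i).trans ?_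
      simp
    rcases Int.units_eq_one_or (Equiv.Perm.sign τ) with h | h
    · rw [h, one_smul]; exact this
    · rw [h, Units.neg_smul, one_smul, inorm, wnorm_neg]; exact this
  rw [Matrix.det_apply]
  refine (wnorm_sum_le hw _ _).trans ((Finset.sum_le_sum fun τ _ => hterm τ).trans ?_)
  simp [Fintype.card_perm]

lemma degreeOf_det_le {A : Matrix (Fin k) (Fin k) (MvPolynomial σ ℤ)} {h : σ} {B : ℕ}
    (hA : ∀ i j, degreeOf h (A i j) ≤ B) : degreeOf h A.det ≤ k * B := by
  rw [Matrix.det_apply']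
  refine (degreeOf_sum_le _ _ _).trans (Finset.sup_le fun τ _ => ?_)
  refine (degreeOf_mul_le _ _ _).trans ?_
  rw [← map_intCast (C (σ := σ) (R := ℤ)), degreeOf_C, zero_add]
  refine (degreeOf_prod_le _ _ _).trans ((Finset.sum_le_sum fun i _ => hA (τ i) i).trans ?_)
  simp

end Determinant

end SchmidtSubspace

namespace SchmidtSubspace

open MvPolynomial

section Decomposition

variable {n : ℕ}

lemma exists_tens_decomposition {P : MvPolynomial (Fin (n + 1)) ℚ} (hP : P ≠ 0) {s : ℕ}
    (hdeg : degreeOf 0 P ≤ s) : ∃ k, 1 ≤ k ∧ k ≤ s + 1 ∧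
      ∃ (φ : Fin k → MvPolynomial (Fin n) ℚ) (ψ : Fin k → MvPolynomial (Fin 1) ℚ),
        LinearIndependent ℚ φ ∧ LinearIndependent ℚ ψ ∧ P = ∑ j, tens (φ j) (ψ j) := by
  classical
  set S : Fin (s + 1) → MvPolynomial (Fin n) ℚ := fun b =>
    slice (Finsupp.cons (b : ℕ)) (Finsupp.cons_right_injective _) P with hS
  have hcS : ∀ (b : Fin (s + 1)) a, coeff a (S b) = coeff (Finsupp.cons (b : ℕ) a) P :=
    fun b a => coeff_slice _ _ _ _
  have : Module.Finite ℚ (Submodule.span ℚ (Set.range S)) :=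
    Module.Finite.span_of_finite ℚ (Set.finite_range S)
  have hex := Submodule.exists_fun_fin_finrank_span_eq ℚ (Set.range S)
  generalize hk : Module.finrank ℚ (Submodule.span ℚ (Set.range S)) = k at hex
  obtain ⟨φ, hφS, hspan, hli⟩ := hex
  have hlarge : ∀ c a, s < c → coeff (Finsupp.cons c a) P = 0 := by
    intro c a hc
    by_contra hne
    have := (degreeOf_le_iff.1 hdeg) _ (mem_support_iff.2 hne)
    rw [Finsupp.cons_zero] at this
    omega
  have hk1 : 1 ≤ k := by
    rw [Nat.one_le_iff_ne_zero]
    intro h0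
    have hbot := Submodule.finrank_eq_zero.1 (hk.trans h0)
    rw [Submodule.span_eq_bot] at hbot
    refine hP (ext_cons fun c a => ?_)
    rw [coeff_zero]
    rcases le_or_gt c s with hc | hc
    · have := hcS ⟨c, by omega⟩ a
      rw [hbot _ (Set.mem_range_self _), coeff_zero] at this
      exact this.symm
    · exact hlarge c a hc
  have hk2 : k ≤ s + 1 := by
    have := finrank_range_le_card (R := ℚ) S
    simpa [Set.finrank, hk] using this
  choose b hb using hφS
  have hmem : ∀ c, ∃ t : Fin k → ℚ, ∑ j, t j • φ j = S c := by
    intro c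
    rw [← Submodule.mem_span_range_iff_exists_fun, hspan]
    exact Submodule.subset_span (Set.mem_range_self c)
  choose t ht using hmem
  set ψ : Fin k → MvPolynomial (Fin 1) ℚ := fun j =>
    ∑ c : Fin (s + 1), monomial (Finsupp.single 0 (c : ℕ)) (t c j) with hψ
  have hcψ : ∀ (c : Fin (s + 1)) j, coeff (Finsupp.single 0 (c : ℕ)) (ψ j) = t c j := by
    intro c j
    simp only [hψ, coeff_sum, coeff_monomial]
    rw [Finset.sum_eq_single c]
    · simp
    · intro d _ hd
      rw [if_neg]
      intro h
      have := Finsupp.single_injective 0 h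
      exact hd (Fin.ext this)
    · simp
  have hcψ' : ∀ (c : ℕ) j, s < c → coeff (Finsupp.single 0 c) (ψ j) = 0 := by
    intro c j hc
    simp only [hψ, coeff_sum, coeff_monomial]
    refine Finset.sum_eq_zero fun d _ => ?_
    rw [if_neg]
    intro h
    have := Finsupp.single_injective 0 h
    omega
  have htb : ∀ i j, t (b i) j = if j = i then 1 else 0 := by
    intro i
    have h1 : ∑ j, (t (b i) j - if j = i then 1 else 0) • φ j = 0 := by
      simp only [sub_smul, Finset.sum_sub_distrib, ht, hb]
      simp
    intro j
    exact sub_eq_zero.1 (Fintype.linearIndependent_iff.1 hli _ h1 j)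
  refine ⟨k, hk1, hk2, φ, ψ, hli, ?_, ?_⟩
  · rw [Fintype.linearIndependent_iff]
    intro g hg i
    have h1 := congrArg (coeff (Finsupp.single 0 (b i : ℕ))) hg
    simpa [coeff_sum, hcψ, htb] using h1
  · refine ext_cons fun c a => ?_
    simp only [coeff_sum, coeff_tens]
    rcases le_or_gt c s with hc | hc
    · have h1 := congrArg (coeff a) (ht ⟨c, by omega⟩)
      rw [hcS, coeff_sum] at h1
      rw [← h1]
      refine Finset.sum_congr rfl fun j _ => ?_
      rw [← hcψ]
      simp [mul_comm]
    · rw [hlarge c a hc]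
      exact (Finset.sum_eq_zero fun j _ => by rw [hcψ' c j hc, mul_zero]).symm

/-- A suitable determinant of derivatives of `P` splits as a product of polynomials in separate
variables. -/
lemma exists_splitting_det {P : MvPolynomial (Fin (n + 1)) ℤ} (hP : P ≠ 0) {s : ℕ}
    (hdeg : degreeOf 0 P ≤ s) : ∃ k, 1 ≤ k ∧ k ≤ s + 1 ∧
      ∃ (μ : Fin k → Fin n →₀ ℕ) (l : Fin k → Fin k), (∀ i, (μ i).degree ≤ k - 1) ∧
        Function.Injective l ∧ ∃ (U : MvPolynomial (Fin n) ℚ) (V : MvPolynomial (Fin 1) ℚ),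
          U ≠ 0 ∧ V ≠ 0 ∧ map (Int.castRingHom ℚ)
            (Matrix.of fun i j => binomOp (Finsupp.cons (l j : ℕ) (μ i)) P).det = tens U V := by
  have hinj : Function.Injective (Int.castRingHom ℚ) := Int.cast_injective
  have hP' : map (Int.castRingHom ℚ) P ≠ 0 := by
    rw [Ne, map_eq_zero_iff _ (map_injective _ hinj)]; exact hP
  have hdeg' : degreeOf 0 (map (Int.castRingHom ℚ) P) ≤ s := by
    rw [degreeOf_le_iff]
    intro m hm
    exact degreeOf_le_iff.1 hdeg m (support_map_subset _ _ hm)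
  obtain ⟨k, hk1, hk2, φ, ψ, hφ, hψ, hsum⟩ := exists_tens_decomposition hP' hdeg'
  obtain ⟨μ, hμ, hU⟩ := exists_wronskian_ne_zero hφ
  obtain ⟨ν, hν, hV⟩ := exists_wronskian_ne_zero hψ
  have hν' : ∀ j, ν j 0 < k := by
    intro j
    have := hν j
    rw [eq_single_zero (ν j), Finsupp.degree_single] at this
    omega
  refine ⟨k, hk1, hk2, μ, fun j => ⟨ν j 0, hν' j⟩, hμ, ?_, _, _, hU, hV, ?_⟩
  · intro i j hij
    by_contra hne
    refine hV (Matrix.det_zero_of_row_eq hne ?_)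
    have : ν i = ν j := by
      rw [eq_single_zero (ν i), eq_single_zero (ν j)]
      simpa using hij
    ext1 a
    simp [this]
  · rw [RingHom.map_det, tens, AlgHom.map_det, AlgHom.map_det,
      ← Matrix.det_transpose ((rename fun _ => 0).mapMatrix _), ← Matrix.det_mul]
    congr 1
    ext1 i j
    simp only [RingHom.mapMatrix_apply, AlgHom.mapMatrix_apply, Matrix.map_apply, Matrix.of_apply,
      Matrix.mul_apply, Matrix.transpose_apply]
    rw [map_binomOp, hsum, binomOp_sum]
    exact Finset.sum_congr rfl fun a _ => binomOp_tens _ _ _ _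

end Decomposition

lemma sum_max_sub_div_ge {k s : ℕ} (hs : 0 < s) (hk : k ≤ s + 1) {σ : ℝ} (h0 : 0 ≤ σ)
    (h1 : σ ≤ 1) : k * σ ^ 2 / 8 ≤ ∑ l ∈ Finset.range k, max 0 (σ - (l : ℝ) / s) := by
  have hs' : (0 : ℝ) < s := by exact_mod_cast hs
  have hs1 : (1 : ℝ) ≤ s := by exact_mod_cast hs
  have hk' : (k : ℝ) ≤ s + 1 := by exact_mod_cast hk
  set c := min k (⌊σ * s / 2⌋₊ + 1) with hc
  have hc1 : σ * k / 4 ≤ (c : ℝ) := by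
    rw [hc]
    push_cast
    refine le_min ?_ ?_
    · nlinarith [(Nat.cast_nonneg k : (0 : ℝ) ≤ k)]
    · have := Nat.lt_floor_add_one (σ * s / 2)
      nlinarith
  have hsub : Finset.range c ⊆ Finset.range k := Finset.range_subset_range.2 (min_le_left _ _)
  calc k * σ ^ 2 / 8 = (σ * k / 4) * (σ / 2) := by ring
    _ ≤ c * (σ / 2) := mul_le_mul_of_nonneg_right hc1 (by linarith)
    _ = ∑ l ∈ Finset.range c, σ / 2 := by simp
    _ ≤ ∑ l ∈ Finset.range c, max 0 (σ - (l : ℝ) / s) := by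
        refine Finset.sum_le_sum fun l hl => le_max_of_le_right ?_
        have hl' : l ≤ ⌊σ * s / 2⌋₊ := by
          have := Finset.mem_range.1 hl
          have := min_le_right k (⌊σ * s / 2⌋₊ + 1)
          omega
        have h2 : (l : ℝ) ≤ σ * s / 2 :=
          (Nat.cast_le.2 hl').trans (Nat.floor_le (by positivity))
        have h3 : (l : ℝ) / s ≤ σ / 2 := by
          rw [div_le_iff₀ hs']; linarith
        linarith
    _ ≤ _ := Finset.sum_le_sum_of_subset_of_nonneg hsub fun _ _ _ => le_max_left _ _

lemma idx_cons {n : ℕ} (r : Fin (n + 1) → ℕ) (c : ℕ) (J : Fin n →₀ ℕ) :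
    idx r (Finsupp.cons c J) = (c : ℝ) / r 0 + idx (fun i => r i.succ) J := by
  simp [idx, Fin.sum_univ_succ]

lemma idx_le_mul_degree {n : ℕ} {r : Fin n → ℕ} {B : ℝ} (hr : ∀ h, (1 : ℝ) / r h ≤ B)
    (J : Fin n →₀ ℕ) : idx r J ≤ J.degree * B := by
  rw [Finsupp.degree_eq_sum, Nat.cast_sum, Finset.sum_mul, idx]
  refine Finset.sum_le_sum fun h _ => ?_
  rw [div_eq_mul_one_div]
  exact mul_le_mul_of_nonneg_left (hr h) (Nat.cast_nonneg _)

lemma orderGE_det {σ : Type*} [Fintype σ] {r : σ → ℕ} {k : ℕ} {t : Fin k → ℝ}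
    {A : Matrix (Fin k) (Fin k) (MvPolynomial σ ℚ)} (hA : ∀ i j, OrderGE r (t j) (A i j)) :
    OrderGE r (∑ j, t j) A.det := by
  rw [Matrix.det_apply']
  exact OrderGE.sum fun τ _ => OrderGE.mul_left (OrderGE.prod fun j _ => hA _ _)

lemma translate_C_mul {σ : Type*} (ξ : σ → ℚ) (c : ℚ) (f : MvPolynomial σ ℚ) :
    translate ξ (C c * f) = C c * translate ξ f := by
  rw [map_mul]
  congr 1
  simp [translate, algebraMap_eq]

lemma factorial_mul_pow_le {k R N : ℕ} (hk : k ≤ R + 1) {B : ℝ} (hB : 0 ≤ B) :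
    k.factorial * ((2 : ℝ) ^ (N * R) * B) ^ k ≤ ((2 ^ (N + 1)) ^ R * B) ^ k := by
  have h1 : (k : ℝ) ≤ 2 ^ R := by
    have : k ≤ 2 ^ R := hk.trans (Nat.lt_two_pow_self)
    exact_mod_cast this
  have h2 : (k.factorial : ℝ) ≤ (2 ^ R) ^ k := by
    refine le_trans ?_ (pow_le_pow_left₀ (Nat.cast_nonneg _) h1 k)
    exact_mod_cast Nat.factorial_le_pow k
  calc k.factorial * ((2 : ℝ) ^ (N * R) * B) ^ k
      ≤ (2 ^ R) ^ k * ((2 : ℝ) ^ (N * R) * B) ^ k := by gcongr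
    _ = ((2 ^ (N + 1)) ^ R * B) ^ k := by
        rw [← mul_pow, ← mul_assoc, ← pow_add, ← pow_mul]
        ring_nf

/-- Roth's lemma: an integral polynomial of small height has small index at a rational point with
large denominators. -/
theorem roth_lemma (n : ℕ) : ∀ ε : ℝ, 0 < ε → ε ≤ 1 → ∃ ω : ℝ, 0 < ω ∧
    ∀ (r : Fin n → ℕ) (R : ℕ) (p q : Fin n → ℤ) (P : MvPolynomial (Fin n) ℤ),
      (∀ h, 0 < r h) → (∀ h, r h ≤ R) → 1 ≤ R → (∀ h, 0 < q h) → (∀ h, IsCoprime (p h) (q h)) →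
      P ≠ 0 → (∀ h, degreeOf h P ≤ r h) → (∀ i j, i < j → (r i : ℝ) ≤ ω * r j) →
      (∀ h, ((2 : ℝ) ^ ((n + 1) ^ 2)) ^ R * inorm P ≤ (q h : ℝ) ^ (ω * r h)) →
      ∃ J, idx r J ≤ ε ∧
        coeff J (translate (fun h => (p h : ℚ) / q h) (map (Int.castRingHom ℚ) P)) ≠ 0 := by
  induction n with
  | zero =>
    intro ε hε hε1
    refine ⟨1, one_pos, ?_⟩
    intro r R p q P _ _ _ _ _ hP _ _ _
    refine ⟨0, by simpa [idx] using hε.le, ?_⟩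
    obtain ⟨c, rfl⟩ : ∃ c, P = C c := ⟨_, eq_C_of_isEmpty P⟩
    have hc : c ≠ 0 := by simpa using hP
    rw [map_C, translate, aeval_C, algebraMap_eq, coeff_C]
    simpa using hc
  | succ n ih =>
    intro ε hε hε1
    obtain ⟨ω', hω', IH⟩ := ih (ε ^ 2 / 128) (by positivity) (by nlinarith)
    refine ⟨min ω' (min (ε ^ 2 / 128) (ε / 2)), by positivity, ?_⟩
    set ω := min ω' (min (ε ^ 2 / 128) (ε / 2)) with hωdef
    have hω1 : ω ≤ ω' := min_le_left _ _
    have hω2 : ω ≤ ε ^ 2 / 128 := (min_le_right _ _).trans (min_le_left _ _)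
    have hω3 : ω ≤ ε / 2 := (min_le_right _ _).trans (min_le_right _ _)
    have hω0 : 0 < ω := by positivity
    clear_value ω
    intro r R p q P hr hrR hR hq hpq hP hdeg hrr hht
    by_contra hcon
    push Not at hcon
    set ξ : Fin (n + 1) → ℚ := fun h => (p h : ℚ) / q h with hξ
    have hord : OrderGE r ε (translate ξ (map (Int.castRingHom ℚ) P)) :=
      fun J hJ => hcon J hJ.le
    obtain ⟨k, hk1, hk2, μ, l, hμ, hl, U, V, hU, hV, hUV⟩ := exists_splitting_det hP (hdeg 0)
    set W := (Matrix.of fun i j => binomOp (Finsupp.cons (l j : ℕ) (μ i)) P).det with hW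
    have hr0 : (0 : ℝ) < r 0 := by exact_mod_cast hr 0
    have hkpos : (0 : ℝ) < k := by exact_mod_cast hk1
    have hkR : k ≤ R + 1 := hk2.trans (by have := hrR 0; omega)
    -- the order of `W` is large
    have hlow : OrderGE r (k * (ε - ω) ^ 2 / 8) (translate ξ (map (Int.castRingHom ℚ) W)) := by
      have hsum : ∑ j, max 0 ((ε - ω) - ((l j : ℕ) : ℝ) / r 0) =
          ∑ j ∈ Finset.range k, max 0 ((ε - ω) - (j : ℝ) / r 0) := by
        rw [← Fin.sum_univ_eq_sum_range (fun j => max 0 ((ε - ω) - (j : ℝ) / r 0))]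
        exact (Finite.injective_iff_bijective.1 hl).sum_comp
          (fun j : Fin k => max 0 ((ε - ω) - ((j : ℕ) : ℝ) / r 0))
      have h2 := sum_max_sub_div_ge (hr 0) hk2 (σ := ε - ω) (by linarith) (by linarith)
      rw [← hsum] at h2
      refine OrderGE.mono ?_ h2
      rw [hW, RingHom.map_det, AlgHom.map_det]
      refine orderGE_det fun i j => ?_
      simp only [RingHom.mapMatrix_apply, AlgHom.mapMatrix_apply, Matrix.map_apply,
        Matrix.of_apply, map_binomOp]
      rcases le_total ((ε - ω) - ((l j : ℕ) : ℝ) / r 0) 0 with hle | hle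
      · exact orderGE_of_nonpos (by simpa using hle)
      · rw [max_eq_right hle]
        refine (orderGE_translate_binomOp hord _).mono ?_
        rw [idx_cons]
        have h3 : idx (fun i => r (Fin.succ i)) (μ i) ≤ (μ i).degree * (ω / r 0) := by
          refine idx_le_mul_degree (fun h => ?_) _
          have h4 := hrr 0 h.succ (Fin.succ_pos h)
          have h5 : (0 : ℝ) < r h.succ := by exact_mod_cast hr h.succ
          rw [div_le_div_iff₀ h5 hr0]
          linarith
        have h6 : ((μ i).degree : ℝ) ≤ r 0 := by
          have : (μ i).degree ≤ r 0 := by have := hμ i; omega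
          exact_mod_cast this
        have h7 : ((μ i).degree : ℝ) * (ω / r 0) ≤ ω := by
          rw [mul_div_assoc', div_le_iff₀ hr0]
          nlinarith
        linarith
    -- the size of `W`
    have hinorm : inorm W ≤ ((2 ^ (n + 2)) ^ R * inorm P) ^ k := by
      refine (inorm_det_le (B := 2 ^ ((n + 1) * R) * inorm P) fun i j => ?_).trans
        (factorial_mul_pow_le hkR (inorm_nonneg P))
      refine (inorm_binomOp_le _ hdeg).trans ?_
      refine mul_le_mul_of_nonneg_right ?_ (inorm_nonneg P)
      refine pow_le_pow_right₀ (by norm_num) ?_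
      refine (Finset.sum_le_sum fun h _ => hrR h).trans ?_
      simp
    have hWdeg : ∀ h, degreeOf h W ≤ k * r h := fun h =>
      degreeOf_det_le fun i j => by
        rw [Matrix.of_apply, degreeOf_le_iff]
        exact fun m hm => degreeOf_le_iff.1 (hdeg h) m (support_binomOp_subset _ _ hm)
    have hsize : ∀ (N : ℕ) h, (N + (n + 2) ≤ (n + 2) ^ 2) →
        ((2 : ℝ) ^ N) ^ (k * R) * inorm W ≤ (q h : ℝ) ^ (ω * (k * r h : ℕ)) := by
      intro N h hN
      have h0 : (1 : ℝ) ≤ inorm P := one_le_inorm hP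
      calc ((2 : ℝ) ^ N) ^ (k * R) * inorm W
          ≤ ((2 : ℝ) ^ N) ^ (k * R) * ((2 ^ (n + 2)) ^ R * inorm P) ^ k := by gcongr
        _ = ((2 ^ (N + (n + 2))) ^ R * inorm P) ^ k := by
            rw [mul_comm k R, pow_mul, ← mul_pow, ← mul_assoc, ← mul_pow, ← pow_add]
        _ ≤ ((2 ^ ((n + 2) ^ 2)) ^ R * inorm P) ^ k := by
            gcongr
            norm_num
        _ ≤ ((q h : ℝ) ^ (ω * r h)) ^ k := by
            gcongr
            exact hht h
        _ = (q h : ℝ) ^ (ω * (k * r h : ℕ)) := by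
            have : (0 : ℝ) ≤ q h := by exact_mod_cast (hq h).le
            rw [← Real.rpow_natCast, ← Real.rpow_mul this]
            push_cast
            ring_nf
    -- the factor in the remaining variables
    obtain ⟨b, hb⟩ := MvPolynomial.ne_zero_iff.1 hV
    rw [eq_single_zero b] at hb
    obtain ⟨J, hJ, hJU⟩ : ∃ J, idx (fun i => r (Fin.succ i)) J ≤ k * (ε ^ 2 / 128) ∧
        coeff J (translate (fun i => ξ i.succ) U) ≠ 0 := by
      set U' := slice (Finsupp.cons (b 0)) (Finsupp.cons_right_injective _) W with hU'
      have hmap : map (Int.castRingHom ℚ) U' = C (coeff (Finsupp.single 0 (b 0)) V) * U := by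
        ext a
        rw [hU', map_slice, coeff_slice, hUV, coeff_tens, coeff_C_mul, mul_comm]
      have hU'0 : U' ≠ 0 := by
        intro h0
        rw [h0, map_zero] at hmap
        exact (mul_ne_zero (by simpa using hb) hU) hmap.symm
      have hN : (n + 1) ^ 2 + (n + 2) ≤ (n + 2) ^ 2 := by nlinarith
      have hdegU : ∀ h, degreeOf h U' ≤ k * r h.succ := by
        intro h
        rw [degreeOf_le_iff]
        intro m hm
        rw [mem_support_iff, hU', coeff_slice] at hm
        have := degreeOf_le_iff.1 (hWdeg h.succ) _ (mem_support_iff.2 hm)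
        rwa [Finsupp.cons_succ] at this
      have hrU : ∀ i j : Fin n, i < j → ((k * r i.succ : ℕ) : ℝ) ≤ ω' * (k * r j.succ : ℕ) := by
        intro i j hij
        have h1 := hrr i.succ j.succ (Fin.succ_lt_succ_iff.2 hij)
        have h2 : (0 : ℝ) ≤ r j.succ := Nat.cast_nonneg _
        push_cast
        have h3 : ω * r j.succ ≤ ω' * r j.succ := mul_le_mul_of_nonneg_right hω1 h2
        calc (k : ℝ) * r i.succ ≤ k * (ω' * r j.succ) := by gcongr; linarith
          _ = _ := by ring
      have hhtU : ∀ h : Fin n, ((2 : ℝ) ^ ((n + 1) ^ 2)) ^ (k * R) * inorm U' ≤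
          (q h.succ : ℝ) ^ (ω' * (k * r h.succ : ℕ)) := by
        intro h
        have hq1 : (1 : ℝ) ≤ q h.succ := by exact_mod_cast hq h.succ
        calc _ ≤ ((2 : ℝ) ^ ((n + 1) ^ 2)) ^ (k * R) * inorm W := by
              gcongr; exact inorm_slice_le _ _ _
          _ ≤ _ := hsize _ h.succ hN
          _ ≤ _ := Real.rpow_le_rpow_of_exponent_le hq1 (by gcongr)
      obtain ⟨J, hJ1, hJ2⟩ := IH (fun i => k * r i.succ) (k * R) (fun i => p i.succ)
        (fun i => q i.succ) U' (fun h => Nat.mul_pos hk1 (hr _))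
        (fun h => Nat.mul_le_mul_left k (hrR _)) (Nat.mul_pos hk1 hR) (fun h => hq _)
        (fun h => hpq _) hU'0 hdegU hrU hhtU
      refine ⟨J, ?_, ?_⟩
      · have : idx (fun i => k * r (Fin.succ i)) J = idx (fun i => r (Fin.succ i)) J / k := by
          rw [idx, idx, Finset.sum_div]
          refine Finset.sum_congr rfl fun i _ => ?_
          push_cast
          rw [div_div, mul_comm (k : ℝ)]
        rw [this, div_le_iff₀ hkpos] at hJ1
        linarith
      · rw [hmap, translate_C_mul, coeff_C_mul] at hJ2
        exact right_ne_zero_of_mul hJ2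
    -- the factor in the first variable
    obtain ⟨a, ha⟩ := MvPolynomial.ne_zero_iff.1 hU
    obtain ⟨e, he, heV⟩ : ∃ e : ℕ, (e : ℝ) ≤ ω * (k * r 0) ∧
        coeff (Finsupp.single 0 e) (translate (fun _ => ξ 0) V) ≠ 0 := by
      have hinj : Function.Injective fun s : Fin 1 →₀ ℕ => Finsupp.cons (s 0) a := by
        intro s s' hs
        have h1 := (Finsupp.cons_injective2 hs).1
        rw [eq_single_zero s, eq_single_zero s', h1]
      set V' := slice (fun s : Fin 1 →₀ ℕ => Finsupp.cons (s 0) a) hinj W with hV'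
      have hmap : map (Int.castRingHom ℚ) V' = C (coeff a U) * V := by
        ext s
        rw [hV', map_slice, coeff_slice, hUV, coeff_tens, coeff_C_mul, ← eq_single_zero]
      have hV'0 : V' ≠ 0 := by
        intro h0
        rw [h0, map_zero] at hmap
        exact (mul_ne_zero (by simpa using ha) hV) hmap.symm
      obtain ⟨e, he1, he2⟩ := exists_coeff_translate_ne_zero hV'0 (hq 0) (hpq 0)
      refine ⟨e, ?_, ?_⟩
      · have h1 := hsize 0 0 (by nlinarith)
        rw [pow_zero, one_pow, one_mul] at h1
        have h2 : (q 0 : ℝ) ^ (e : ℝ) ≤ (q 0 : ℝ) ^ (ω * (k * r 0 : ℕ)) := by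
          rw [Real.rpow_natCast]
          exact he2.trans ((inorm_slice_le _ _ _).trans h1)
        have hq1 : (1 : ℝ) < q 0 := by
          have hge : (1 : ℤ) ≤ q 0 := hq 0
          rcases hge.lt_or_eq with h | h
          · exact_mod_cast h
          · exfalso
            have h3 := hht 0
            rw [← h, Int.cast_one, Real.one_rpow] at h3
            have h4 : (1 : ℝ) ≤ inorm P := one_le_inorm hP
            have h5 : (1 : ℝ) < ((2 : ℝ) ^ ((n + 1 + 1) ^ 2)) ^ R :=
              one_lt_pow₀ (one_lt_pow₀ (by norm_num) (by positivity)) (by omega)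
            nlinarith
        have h3 := (Real.rpow_le_rpow_left_iff hq1).1 h2
        simpa using h3
      · rw [hmap, translate_C_mul, coeff_C_mul] at he1
        exact right_ne_zero_of_mul he1
    have hzero := hlow (Finsupp.cons e J) ?_
    · rw [hUV, translate_tens, coeff_tens] at hzero
      exact mul_ne_zero hJU heV hzero
    · rw [idx_cons]
      have h1 : (e : ℝ) / r 0 ≤ ω * k := by
        rw [div_le_iff₀ hr0]; linarith
      have h2 : ε ^ 2 / 4 ≤ (ε - ω) ^ 2 := by nlinarith
      have h3 : 0 < k * ε ^ 2 := by positivity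
      have h4 : ω * k ≤ ε ^ 2 / 128 * k := mul_le_mul_of_nonneg_right hω2 hkpos.le
      have h5 : k * (ε ^ 2 / 4) / 8 ≤ k * (ε - ω) ^ 2 / 8 := by gcongr
      linarith

end SchmidtSubspace

namespace SchmidtSubspace

open MvPolynomial

section Restriction

variable {m : ℕ} {ι : Type*} [Fintype ι] [DecidableEq ι]

/-- The exponent `κ` completed by the exponents of the variables `k h` and `l h` to a multihomogeneous
one. -/
noncomputable def extendExp (r : Fin m → ℕ) (k l : Fin m → ι) (κ : Fin m × ι →₀ ℕ)
    (a : Fin m →₀ ℕ) : Fin m × ι →₀ ℕ :=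
  Finsupp.equivFunOnFinite.symm fun x =>
    if x.2 = k x.1 then a x.1
    else if x.2 = l x.1 then r x.1 - a x.1 - ∑ i, κ (x.1, i) else κ x

lemma extendExp_injective (r : Fin m → ℕ) (k l : Fin m → ι) (κ : Fin m × ι →₀ ℕ) :
    Function.Injective (extendExp r k l κ) := by
  intro a b hab
  ext h
  have := DFunLike.congr_fun hab (h, k h)
  simpa [extendExp] using this

/-- The part of an exponent not concerning the variables `k h` and `l h`. -/
noncomputable def restExp (k l : Fin m → ι) (T : Fin m × ι →₀ ℕ) : Fin m × ι →₀ ℕ :=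
  T.filter fun x => x.2 ≠ k x.1 ∧ x.2 ≠ l x.1

lemma sum_restExp {k l : Fin m → ι} (hkl : ∀ h, l h ≠ k h) (T : Fin m × ι →₀ ℕ) (h : Fin m) :
    ∑ i, T (h, i) = T (h, k h) + T (h, l h) + ∑ i, restExp k l T (h, i) := by
  rw [← Finset.add_sum_erase _ _ (Finset.mem_univ (k h)), ← Finset.add_sum_erase _ _
    (Finset.mem_erase.2 ⟨hkl h, Finset.mem_univ (l h)⟩), add_assoc]
  congr 2
  have h1 : ∑ i, restExp k l T (h, i) =
      ∑ i ∈ (Finset.univ.erase (k h)).erase (l h), restExp k l T (h, i) := by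
    symm
    refine Finset.sum_subset (Finset.subset_univ _) fun i _ hi => ?_
    rw [restExp, Finsupp.filter_apply, if_neg]
    simp only [Finset.mem_erase, Finset.mem_univ, and_true] at hi
    tauto
  rw [h1]
  refine Finset.sum_congr rfl fun i hi => ?_
  rw [restExp, Finsupp.filter_apply, if_pos]
  simp only [Finset.mem_erase, Finset.mem_univ, and_true] at hi
  tauto

lemma extendExp_restExp {r : Fin m → ℕ} {k l : Fin m → ι} (hkl : ∀ h, l h ≠ k h)
    {T : Fin m × ι →₀ ℕ} (hT : ∀ h, ∑ i, T (h, i) = r h) {a : Fin m →₀ ℕ}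
    (ha : ∀ h, a h = T (h, k h)) : extendExp r k l (restExp k l T) a = T := by
  ext ⟨h, i⟩
  have h1 := sum_restExp hkl T h
  have h2 := hT h
  simp only [extendExp, Finsupp.coe_equivFunOnFinite_symm]
  split_ifs with hi hi'
  · rw [ha, hi]
  · rw [ha, hi']; omega
  · rw [restExp, Finsupp.filter_apply, if_pos ⟨hi, hi'⟩]

lemma restExp_extendExp {r : Fin m → ℕ} {k l : Fin m → ι} {T : Fin m × ι →₀ ℕ}
    (a : Fin m →₀ ℕ) : restExp k l (extendExp r k l (restExp k l T) a) = restExp k l T := by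
  ext ⟨h, i⟩
  simp only [restExp, Finsupp.filter_apply, extendExp, Finsupp.coe_equivFunOnFinite_symm]
  split_ifs <;> first | rfl | tauto

variable (k l : Fin m → ι) (v : Fin m → ι → ℤ)

/-- Values substituted for the variables, so that the linear forms of coefficients `v h` become
multiples of the variables of the coefficient ring. -/
noncomputable def adaptedSubst (x : Fin m × ι) :
    MvPolynomial (Fin m × ι) (MvPolynomial (Fin m) ℚ) :=
  if x.2 = k x.1 then
    C (X x.1 + C (-(v x.1 (l x.1) : ℚ) / v x.1 (k x.1))) -
      ∑ i ∈ (Finset.univ.erase (k x.1)).erase (l x.1),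
        C (C ((v x.1 i : ℚ) / v x.1 (k x.1))) * X (x.1, i)
  else if x.2 = l x.1 then 1 else X x

variable {k l v}

lemma sum_adaptedSubst (hkl : ∀ h, l h ≠ k h) (hv : ∀ h, v h (k h) ≠ 0) (h : Fin m) :
    ∑ i, C (C ((v h i : ℚ) / v h (k h))) * adaptedSubst k l v (h, i) = C (X h) := by
  have hv' : (v h (k h) : ℚ) ≠ 0 := by exact_mod_cast hv h
  rw [← Finset.add_sum_erase _ _ (Finset.mem_univ (k h)), ← Finset.add_sum_erase _ _
    (Finset.mem_erase.2 ⟨hkl h, Finset.mem_univ (l h)⟩)]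
  have h1 : ∀ i ∈ (Finset.univ.erase (k h)).erase (l h), adaptedSubst k l v (h, i) = X (h, i) := by
    intro i hi
    simp only [Finset.mem_erase, Finset.mem_univ, and_true] at hi
    simp [adaptedSubst, hi.1, hi.2]
  rw [Finset.sum_congr rfl fun i hi => by rw [h1 i hi]]
  have h2 : adaptedSubst k l v (h, l h) = 1 := by simp [adaptedSubst, hkl h]
  rw [h2, adaptedSubst, if_pos rfl, div_self hv']
  simp only [map_one, one_mul, mul_one, map_add, neg_div, map_neg]
  ring

lemma coeff_adaptedSubst_monomial (hkl : ∀ h, l h ≠ k h) {T κ : Fin m × ι →₀ ℕ}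
    (hdeg : κ.degree ≤ (restExp k l T).degree) (c : ℚ) :
    coeff κ (aeval (adaptedSubst k l v) (monomial T c)) =
      if restExp k l T = κ then
        C c * ∏ h, (X h + C (-(v h (l h) : ℚ) / v h (k h))) ^ T (h, k h) else 0 := by
  have hprod : aeval (adaptedSubst k l v) (monomial T c) =
      (C (C c) * ∏ h, adaptedSubst k l v (h, k h) ^ T (h, k h)) * monomial (restExp k l T) 1 := by
    rw [aeval_monomial, mul_assoc]
    congr 1
    rw [Finsupp.prod_fintype _ _ (by simp), Fintype.prod_prod_type]
    have hmon : (monomial (restExp k l T) 1 :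
        MvPolynomial (Fin m × ι) (MvPolynomial (Fin m) ℚ)) =
        ∏ h, ∏ i, X (h, i) ^ (restExp k l T (h, i)) := by
      rw [monomial_eq, C_1, one_mul, Finsupp.prod_fintype _ _ (by simp), Fintype.prod_prod_type]
    rw [hmon, ← Finset.prod_mul_distrib]
    refine Finset.prod_congr rfl fun h _ => ?_
    rw [← Finset.mul_prod_erase _ _ (Finset.mem_univ (k h))]
    congr 1
    rw [← Finset.mul_prod_erase _ (fun i => X (h, i) ^ (restExp k l T (h, i)))
      (Finset.mem_univ (k h))]
    have h0 : restExp k l T (h, k h) = 0 := by simp [restExp]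
    rw [h0, pow_zero, one_mul]
    refine Finset.prod_congr rfl fun i hi => ?_
    have hik : i ≠ k h := Finset.ne_of_mem_erase hi
    by_cases hil : i = l h
    · subst hil
      simp [adaptedSubst, restExp, hkl h]
    · simp [adaptedSubst, restExp, hik, hil]
  rw [hprod, coeff_mul_monomial', mul_one]
  by_cases hle : restExp k l T ≤ κ
  · have heq : restExp k l T = κ := by
      obtain ⟨d, rfl⟩ := exists_add_of_le hle
      rw [map_add] at hdeg
      have : d.degree = 0 := by omega
      rw [Finsupp.degree_eq_zero_iff] at this
      rw [this, add_zero]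
    rw [if_pos hle, if_pos heq, heq, tsub_self, ← constantCoeff_eq, map_mul, map_prod,
      constantCoeff_C]
    congr 1
    refine Finset.prod_congr rfl fun h _ => ?_
    rw [map_pow]
    congr 1
    simp [adaptedSubst]
  · rw [if_neg hle, if_neg]
    rintro rfl
    exact hle le_rfl

/-- A multihomogeneous polynomial of large order along a product of hyperplanes gives rise to a
polynomial in one variable per factor, of large order at the corresponding rational point. -/
theorem exists_restriction {r : Fin m → ℕ} {P : MvPolynomial (Fin m × ι) ℤ} (hP : P ≠ 0)
    (hhom : ∀ T ∈ P.support, ∀ h, ∑ i, T (h, i) = r h) {x : Fin m → Matrix ι ι ℤ}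
    (hdet : ∀ h, (x h).det ≠ 0) {o : ι} (hkl : ∀ h, l h ≠ k h)
    (hxv : ∀ h j, j ≠ o → ∑ i, x h j i * v h i = 0) (hv : ∀ h, v h (k h) ≠ 0)
    (hxo : ∀ h, x h o = Pi.single (k h) 1) {t : ℝ}
    (hF : ∀ T : Fin m × ι →₀ ℕ, ∑ h, (T (h, o) : ℝ) / r h < t →
      coeff T (aeval (fun y : Fin m × ι => ∑ j, C (x y.1 j y.2) * X (y.1, j)) P) = 0) :
    ∃ p : MvPolynomial (Fin m) ℤ, p ≠ 0 ∧ (∀ h, degreeOf h p ≤ r h) ∧ inorm p ≤ inorm P ∧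
      OrderGE r t (translate (fun h => -(v h (l h) : ℚ) / v h (k h))
        (map (Int.castRingHom ℚ) p)) := by
  obtain ⟨T₀, hT₀, hmin⟩ := P.support.exists_min_image (fun T => (restExp k l T).degree)
    (support_nonempty.2 hP)
  set κ := restExp k l T₀ with hκ
  set p := slice (extendExp r k l κ) (extendExp_injective r k l κ) P with hp
  have hcp : ∀ a, coeff a p = coeff (extendExp r k l κ a) P := fun a => coeff_slice _ _ _ _
  let top : (Fin m × ι →₀ ℕ) → (Fin m →₀ ℕ) := fun T =>
    Finsupp.equivFunOnFinite.symm fun h => T (h, k h)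
  have htop : ∀ T ∈ P.support, restExp k l T = κ → extendExp r k l κ (top T) = T := by
    intro T hT hTκ
    rw [← hTκ]
    exact extendExp_restExp hkl (hhom T hT) fun h => rfl
  have htop' : ∀ a, top (extendExp r k l κ a) = a := by
    intro a
    ext h
    simp [top, extendExp]
  refine ⟨p, ?_, ?_, inorm_slice_le _ _ _, ?_⟩
  · intro h0
    have := hcp (top T₀)
    rw [htop T₀ hT₀ rfl, h0, coeff_zero] at this
    exact mem_support_iff.1 hT₀ this.symm
  · intro h
    rw [degreeOf_le_iff]
    intro a ha
    rw [mem_support_iff, hcp] at ha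
    rw [← hhom _ (mem_support_iff.2 ha) h]
    have h1 : a h = extendExp r k l κ a (h, k h) := by simp [extendExp]
    rw [h1]
    exact Finset.single_le_sum (f := fun i => extendExp r k l κ a (h, i))
      (fun _ _ => Nat.zero_le _) (Finset.mem_univ _)
  -- `p` is a coefficient of `P` after the adapted substitution
  have hcoeff : coeff κ (aeval (adaptedSubst k l v) (map (Int.castRingHom ℚ) P)) =
      translate (fun h => -(v h (l h) : ℚ) / v h (k h)) (map (Int.castRingHom ℚ) p) := by
    conv_lhs => rw [P.as_sum]
    conv_rhs => rw [p.as_sum]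
    simp only [map_sum, map_monomial, coeff_sum]
    rw [Finset.sum_congr rfl fun T hT => coeff_adaptedSubst_monomial hkl (hmin T hT) _,
      ← Finset.sum_filter]
    refine Finset.sum_nbij' top (extendExp r k l κ) ?_ ?_ ?_ ?_ ?_
    · intro T hT
      rw [Finset.mem_filter] at hT
      rw [mem_support_iff, hcp, htop T hT.1 hT.2]
      exact mem_support_iff.1 hT.1
    · intro a ha
      rw [mem_support_iff, hcp] at ha
      exact Finset.mem_filter.2 ⟨mem_support_iff.2 ha, restExp_extendExp a⟩
    · intro T hT
      rw [Finset.mem_filter] at hT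
      exact htop T hT.1 hT.2
    · intro a _
      exact htop' a
    · intro T hT
      rw [Finset.mem_filter] at hT
      rw [translate, aeval_monomial, Finsupp.prod_fintype _ _ (by simp), algebraMap_eq, hcp,
        htop T hT.1 hT.2]
      rfl
  rw [← hcoeff]
  -- inverse change of variables
  set G : Fin m → Matrix ι ι ℚ := fun h => (x h).map (Int.cast : ℤ → ℚ) with hG
  have hGdet : ∀ h, IsUnit (G h).det := by
    intro h
    rw [isUnit_iff_ne_zero, hG]
    have := (Int.castRingHom ℚ).map_det (x h)
    rw [RingHom.mapMatrix_apply] at this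
    have h2 : ((x h).map (Int.cast : ℤ → ℚ)).det = ((x h).det : ℚ) := this.symm
    rw [h2]
    exact_mod_cast hdet h
  set F := aeval (fun y : Fin m × ι => ∑ j, C (x y.1 j y.2) * X (y.1, j)) P with hFdef
  set b : Fin m × ι → MvPolynomial (Fin m × ι) (MvPolynomial (Fin m) ℚ) := fun y =>
    ∑ i, C (C ((G y.1)⁻¹ i y.2)) * adaptedSubst k l v (y.1, i) with hb
  have hbo : ∀ h, b (h, o) = C (X h) := by
    intro h
    rw [← sum_adaptedSubst (v := v) hkl hv h, hb]
    refine Finset.sum_congr rfl fun i _ => ?_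
    congr 3
    have hv' : (v h (k h) : ℚ) ≠ 0 := by exact_mod_cast hv h
    have h1 : (G h).mulVec (fun i => (v h i : ℚ)) = Pi.single o (v h (k h) : ℚ) := by
      ext j
      simp only [Matrix.mulVec, dotProduct, hG, Matrix.map_apply]
      by_cases hj : j = o
      · subst hj
        rw [hxo]
        simp [Pi.single_apply]
      · rw [Pi.single_eq_of_ne hj]
        exact_mod_cast hxv h j hj
    have h2 : (fun i => (v h i : ℚ)) = (G h)⁻¹.mulVec (Pi.single o (v h (k h) : ℚ)) := by
      rw [← h1, Matrix.mulVec_mulVec, Matrix.nonsing_inv_mul _ (hGdet h), Matrix.one_mulVec]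
    have h3 := congrFun h2 i
    simp only [Matrix.mulVec_single, Pi.smul_apply, Matrix.col_apply] at h3
    rw [h3]
    field_simp
    simp [mul_comm]
  have hPF : aeval (adaptedSubst k l v) (map (Int.castRingHom ℚ) P) =
      aeval b (map (Int.castRingHom ℚ) F) := by
    have hcomp : (aeval (adaptedSubst k l v) :
        MvPolynomial (Fin m × ι) ℚ →ₐ[ℚ] _).toRingHom.comp (map (Int.castRingHom ℚ)) =
        ((aeval b : MvPolynomial (Fin m × ι) ℚ →ₐ[ℚ] _).toRingHom.comp
          (map (Int.castRingHom ℚ))).comp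
          (aeval (fun y : Fin m × ι => ∑ j, C (x y.1 j y.2) * X (y.1, j)) :
            MvPolynomial (Fin m × ι) ℤ →ₐ[ℤ] MvPolynomial (Fin m × ι) ℤ).toRingHom := by
      refine MvPolynomial.ringHom_ext (fun c => by simp) fun y => ?_
      obtain ⟨h, i⟩ := y
      simp only [AlgHom.toRingHom_eq_coe, RingHom.coe_comp, RingHom.coe_coe, Function.comp_apply,
        map_X, aeval_X, map_sum, map_mul, map_C]
      have hinv := Matrix.nonsing_inv_mul _ (hGdet h)
      have hC : ∀ c : ℚ, algebraMap ℚ (MvPolynomial (Fin m × ι) (MvPolynomial (Fin m) ℚ)) c =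
        C (C c) := fun c => rfl
      simp only [hb, aeval_C, hC, Finset.mul_sum]
      rw [Finset.sum_comm]
      have hrow : ∀ i', ∑ j, C (C ((Int.castRingHom ℚ) (x h j i))) *
          (C (C ((G h)⁻¹ i' j)) * adaptedSubst k l v (h, i')) =
          C (C ((1 : Matrix ι ι ℚ) i' i)) * adaptedSubst k l v (h, i') := by
        intro i'
        rw [← hinv, Matrix.mul_apply, map_sum, map_sum, Finset.sum_mul]
        refine Finset.sum_congr rfl fun j _ => ?_
        simp only [hG, Matrix.map_apply, map_mul, eq_intCast]
        ring
      rw [Finset.sum_congr rfl fun i' _ => hrow i', Finset.sum_eq_single i]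
      · simp
      · intro i' _ hne
        simp [Matrix.one_apply_ne hne]
      · simp
    exact RingHom.congr_fun hcomp P
  rw [hPF, F.as_sum]
  simp only [map_sum, map_monomial, coeff_sum]
  refine OrderGE.sum fun T hT => ?_
  have hTt : t ≤ ∑ h, (T (h, o) : ℝ) / r h := by
    by_contra hlt
    exact mem_support_iff.1 hT (hF T (not_le.1 hlt))
  rw [aeval_monomial, Finsupp.prod_fintype _ _ (by simp), Fintype.prod_prod_type]
  have hsplit : ∏ h, ∏ i, b (h, i) ^ T (h, i) =
      C (∏ h, X h ^ T (h, o)) * ∏ h, ∏ i ∈ Finset.univ.erase o, b (h, i) ^ T (h, i) := by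
    rw [map_prod, ← Finset.prod_mul_distrib]
    refine Finset.prod_congr rfl fun h _ => ?_
    rw [← Finset.mul_prod_erase _ _ (Finset.mem_univ o), hbo, map_pow]
  rw [hsplit, mul_left_comm, coeff_C_mul, mul_comm]
  refine OrderGE.mul_left ?_
  refine OrderGE.mono ?_ hTt
  refine OrderGE.prod fun h _ => ?_
  intro J hJ
  rw [coeff_X_pow, if_neg]
  rintro rfl
  rw [idx_single] at hJ
  exact lt_irrefl _ hJ

end Restriction

end SchmidtSubspace

namespace SchmidtSubspace

open MvPolynomial

section SmallCoefficients

variable {ι : Type*} [Fintype ι] {m : ℕ}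

lemma map_aeval_linear {M : Matrix ι ι ℝ} {P : MvPolynomial (Fin m × ι) ℤ}
    {G : MvPolynomial (Fin m × ι) ℝ}
    (hPG : map (Int.castRingHom ℝ) P = aeval (blockSubst m M) G) (x : Fin m → Matrix ι ι ℤ) :
    map (Int.castRingHom ℝ) (aeval (fun y : Fin m × ι =>
        ∑ j, (C (x y.1 j y.2) * X (y.1, j) : MvPolynomial (Fin m × ι) ℤ)) P) =
      aeval (fun y : Fin m × ι => ∑ j, (C (∑ k, M y.2 k * x y.1 j k) * X (y.1, j) :
        MvPolynomial (Fin m × ι) ℝ)) G := by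
  have h1 : map (Int.castRingHom ℝ) (aeval (fun y : Fin m × ι =>
        ∑ j, (C (x y.1 j y.2) * X (y.1, j) : MvPolynomial (Fin m × ι) ℤ)) P) =
      aeval (fun y : Fin m × ι => ∑ j, (C ((x y.1 j y.2 : ℤ) : ℝ) * X (y.1, j) :
        MvPolynomial (Fin m × ι) ℝ)) (map (Int.castRingHom ℝ) P) := by
    clear hPG
    induction P using MvPolynomial.induction_on with
    | C a => simp
    | add p q hp hq => simp only [map_add, hp, hq]
    | mul_X p i hp => simp only [map_mul, hp, aeval_X, map_X, map_sum, map_C, Int.coe_castRingHom]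
  rw [h1, hPG, ← AlgHom.comp_apply, comp_aeval]
  congr 2
  funext y
  simp only [blockSubst, map_sum, map_mul, algHom_C, aeval_X, algebraMap_eq, Finset.mul_sum,
    Finset.sum_mul]
  rw [Finset.sum_comm]
  refine Finset.sum_congr rfl fun k _ => Finset.sum_congr rfl fun j _ => ?_
  ring

lemma wnorm_linear_le [DecidableEq ι] {M : Matrix ι ι ℝ} {A B : ℝ} (hA : ∀ i k, |M i k| ≤ A) {e : ι → ℝ}
    (hB : ∀ i, |e i| ≤ B) {o : ι} {x : Fin m → Matrix ι ι ℤ} {k : Fin m → ι} {Q : Fin m → ℝ}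
    (hQ : ∀ h, 1 ≤ Q h) (hxo : ∀ h, x h o = Pi.single (k h) 1)
    (hx : ∀ h j i, j ≠ o → |∑ k, M i k * x h j k| ≤ Q h ^ e i) (y : Fin m × ι) :
    wnorm (normRingSeminorm ℝ) (fun z : Fin m × ι => if z.2 = o then Q z.1 ^ (-B) else 1)
      (∑ j, (C (∑ k, M y.2 k * x y.1 j k) * X (y.1, j))) ≤
        (Fintype.card ι + A) * Q y.1 ^ e y.2 := by
  have hQ0 : ∀ h, 0 < Q h := fun h => one_pos.trans_le (hQ h)
  have hA0 : 0 ≤ A := (abs_nonneg _).trans (hA o o)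
  refine (wnorm_sum_le (fun z => ?_) _ _).trans ?_
  · split_ifs
    · exact (Real.rpow_pos_of_pos (hQ0 _) _).le
    · exact zero_le_one
  have hterm : ∀ j : ι, wnorm (normRingSeminorm ℝ)
      (fun z : Fin m × ι => if z.2 = o then Q z.1 ^ (-B) else 1)
      (C (∑ k, M y.2 k * x y.1 j k) * X (y.1, j) : MvPolynomial (Fin m × ι) ℝ) ≤
        Q y.1 ^ e y.2 + if j = o then A * Q y.1 ^ e y.2 else 0 := by
    intro j
    have hpos := Real.rpow_pos_of_pos (hQ0 y.1) (e y.2)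
    rw [wnorm_C_mul_X, normRingSeminorm_real]
    by_cases hj : j = o
    · subst hj
      have h1 : ∑ k, M y.2 k * ((x y.1 j k : ℤ) : ℝ) = M y.2 (k y.1) := by
        rw [hxo, Finset.sum_eq_single (k y.1)]
        · simp
        · intro b _ hb; simp [hb]
        · simp
      have h2 : Q y.1 ^ (-B) ≤ Q y.1 ^ e y.2 :=
        Real.rpow_le_rpow_of_exponent_le (hQ _) (neg_le_of_abs_le (hB _))
      simp only [h1, if_true]
      have := mul_le_mul (hA y.2 (k y.1)) h2 (Real.rpow_pos_of_pos (hQ0 _) _).le hA0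
      linarith
    · simpa [hj] using hx y.1 j y.2 hj
  refine (Finset.sum_le_sum fun j _ => hterm j).trans ?_
  rw [Finset.sum_add_distrib, Finset.sum_ite_eq']
  simp [add_mul]

/-- A monomial with balanced exponents is small at the point with coordinates `Q h ^ e i`. -/
lemma sum_exponent_le [Nonempty ι] {e : ι → ℝ} {B η δ ρ θ : ℝ} (hB : ∀ i, |e i| ≤ B)
    (hδ : ∑ i, e i = - (Fintype.card ι * δ)) {r : Fin m → ℕ} (hr : ∀ h, 0 < r h) (hρ : 0 ≤ ρ)
    {l : Fin m → ℝ} (hl1 : ∀ h, ρ ≤ r h * l h) (hl2 : ∀ h, r h * l h ≤ (1 + θ) * ρ)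
    {I : Fin m → ι → ℕ} (hI : Balanced η r I) (hIr : ∀ h, ∑ i, I h i = r h) :
    ∑ h, ∑ i, e i * I h i * l h ≤ ρ * m * (-δ + Fintype.card ι * (B * η) + B * θ) := by
  have hB0 : 0 ≤ B := (abs_nonneg _).trans (hB (Classical.arbitrary ι))
  have hterm : ∀ h i, e i * I h i * l h ≤ e i * ρ * (I h i / r h) + B * θ * ρ * (I h i / r h) := by
    intro h i
    have hr' : (0 : ℝ) < r h := by exact_mod_cast hr h
    have h1 : e i * I h i * l h = e i * ρ * (I h i / r h) +
        e i * (r h * l h - ρ) * (I h i / r h) := by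
      field_simp; ring
    rw [h1]
    have h2 : e i * (r h * l h - ρ) ≤ B * θ * ρ := by
      have h3 : 0 ≤ r h * l h - ρ := sub_nonneg.2 (hl1 h)
      have h4 : r h * l h - ρ ≤ θ * ρ := by linarith [hl2 h]
      calc e i * (r h * l h - ρ) ≤ B * (r h * l h - ρ) :=
            mul_le_mul_of_nonneg_right ((le_abs_self _).trans (hB i)) h3
        _ ≤ B * (θ * ρ) := mul_le_mul_of_nonneg_left h4 hB0
        _ = _ := by ring
    have := mul_le_mul_of_nonneg_right h2 (by positivity : (0:ℝ) ≤ (I h i : ℝ) / r h)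
    linarith
  have hsum1 : ∑ h : Fin m, ∑ i, B * θ * ρ * ((I h i : ℝ) / r h) = B * θ * ρ * m := by
    simp_rw [← Finset.mul_sum, ← Finset.sum_div]
    congr 1
    rw [Finset.sum_congr rfl (g := fun _ => (1:ℝ))]
    · simp
    · intro h _
      have hr' : (r h : ℝ) ≠ 0 := by exact_mod_cast (hr h).ne'
      rw [div_eq_one_iff_eq hr']
      exact_mod_cast hIr h
  have hN : (Fintype.card ι : ℝ) ≠ 0 := by
    exact_mod_cast Fintype.card_ne_zero
  have hsum2 : ∑ h : Fin m, ∑ i, e i * ρ * ((I h i : ℝ) / r h) ≤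
      ρ * m * (-δ + Fintype.card ι * (B * η)) := by
    rw [Finset.sum_comm]
    simp_rw [← Finset.mul_sum]
    have h3 : ∀ i, e i * ρ * ∑ h, (I h i : ℝ) / r h ≤
        e i * ρ * (m / Fintype.card ι) + B * ρ * (η * m) := by
      intro i
      have h4 : e i * ρ * (∑ h, (I h i : ℝ) / r h - m / Fintype.card ι) ≤ B * ρ * (η * m) := by
        refine (le_abs_self _).trans ?_
        rw [abs_mul, abs_mul, abs_of_nonneg hρ]
        have := hI i
        have := hB i
        gcongr
      linarith
    refine (Finset.sum_le_sum fun i _ => h3 i).trans ?_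
    rw [Finset.sum_add_distrib, ← Finset.sum_mul, ← Finset.sum_mul, hδ]
    simp only [Finset.sum_const, Finset.card_univ, nsmul_eq_mul]
    apply le_of_eq
    field_simp
  refine (Finset.sum_le_sum fun h _ => Finset.sum_le_sum fun i _ => hterm h i).trans ?_
  simp_rw [Finset.sum_add_distrib]
  rw [hsum1]
  linarith

/-- Coefficients of low order at the coordinate `o` vanish, because they are integers of absolute
value less than one. -/
lemma coeff_eq_zero_of_small [DecidableEq ι] [Nonempty ι] {M : Matrix ι ι ℝ} {A B : ℝ}
    (hA : ∀ i k, |M i k| ≤ A) {e : ι → ℝ} (hB : ∀ i, |e i| ≤ B)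
    {δ η θ τ : ℝ} (hδ : ∑ i, e i = - (Fintype.card ι * δ))
    (hη : Fintype.card ι * (B * η) ≤ δ / 4) (hθ : B * θ ≤ δ / 4) (hθ1 : θ ≤ 1)
    (hτ : 2 * (B * τ) ≤ δ / 4) (hδ0 : 0 < δ)
    {o : ι} {x : Fin m → Matrix ι ι ℤ} {k : Fin m → ι} {Q : Fin m → ℝ}
    (hQ : ∀ h, 1 < Q h) (hxo : ∀ h, x h o = Pi.single (k h) 1)
    (hx : ∀ h j i, j ≠ o → |∑ k, M i k * x h j k| ≤ Q h ^ e i)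
    {r : Fin m → ℕ} (hr : ∀ h, 0 < r h) {ρ : ℝ} (hρ : 0 < ρ) (hm : 0 < m)
    (hl1 : ∀ h, ρ ≤ r h * Real.log (Q h)) (hl2 : ∀ h, r h * Real.log (Q h) ≤ (1 + θ) * ρ)
    {K : ℝ} (hK : 1 ≤ K)
    (hKQ : ∀ h, 8 * Real.log (K * (Fintype.card ι + A)) < δ * Real.log (Q h))
    {P : MvPolynomial (Fin m × ι) ℤ} {G : MvPolynomial (Fin m × ι) ℝ}
    (hPG : map (Int.castRingHom ℝ) P = aeval (blockSubst m M) G) (hG : rnorm G ≤ K ^ (∑ h, r h))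
    (hGhom : IsWeightedHomogeneous (blockWeight m ι) G r)
    (hbal : ∀ I ∈ G.support, Balanced η r fun h i => I (h, i)) (T : Fin m × ι →₀ ℕ)
    (hT : ∑ h, (T (h, o) : ℝ) / r h < τ * m) :
    coeff T (aeval (fun y : Fin m × ι =>
        ∑ j, (C (x y.1 j y.2) * X (y.1, j) : MvPolynomial (Fin m × ι) ℤ)) P) = 0 := by
  classical
  have hQ0 : ∀ h, 0 < Q h := fun h => one_pos.trans (hQ h)
  have hA0 : 0 ≤ A := (abs_nonneg _).trans (hA o o)
  have hB0 : 0 ≤ B := (abs_nonneg _).trans (hB o)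
  have hN : (1 : ℝ) ≤ Fintype.card ι := by exact_mod_cast Fintype.card_pos
  set E : ℝ := Fintype.card ι + A with hE
  have hE1 : 1 ≤ E := by linarith
  set w : Fin m × ι → ℝ := fun z => if z.2 = o then Q z.1 ^ (-B) else 1 with hw
  have hw0 : ∀ z, 0 ≤ w z := by
    intro z
    simp only [hw]
    split_ifs
    · exact (Real.rpow_pos_of_pos (hQ0 _) _).le
    · exact zero_le_one
  set F := aeval (fun y : Fin m × ι =>
        ∑ j, (C (x y.1 j y.2) * X (y.1, j) : MvPolynomial (Fin m × ι) ℤ)) P with hF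
  have hFG := map_aeval_linear hPG x
  rw [← hF] at hFG
  -- upper bound for the weighted norm
  have hup : wnorm (normRingSeminorm ℝ) w (map (Int.castRingHom ℝ) F) ≤
      (K * E) ^ (∑ h, r h) * Real.exp (ρ * m * (-δ + δ / 4 + δ / 4)) := by
    rw [hFG]
    refine (wnorm_aeval_le (by simp [normRingSeminorm_real]) hw0 (normRingSeminorm ℝ)
      (fun s => le_rfl) _ G).trans ?_
    refine (wnorm_mono_weight (fun y => wnorm_nonneg hw0 _)
      (fun y => wnorm_linear_le hA hB (fun h => (hQ h).le) hxo hx y) G).trans ?_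
    have hmon : ∀ I ∈ G.support, (I.prod fun y n => (E * Q y.1 ^ e y.2) ^ n) ≤
        E ^ (∑ h, r h) * Real.exp (ρ * m * (-δ + δ / 4 + δ / 4)) := by
      intro I hI
      rw [Finsupp.prod]
      simp_rw [mul_pow]
      rw [Finset.prod_mul_distrib, Finset.prod_pow_eq_pow_sum,
        sum_support_of_homogeneous hGhom hI]
      refine mul_le_mul_of_nonneg_left ?_ (by positivity)
      have hpr : ∏ y ∈ I.support, (Q y.1 ^ e y.2) ^ I y =
          Real.exp (∑ h, ∑ i, e i * I (h, i) * Real.log (Q h)) := by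
        rw [Finset.prod_subset (Finset.subset_univ _) (fun p _ hp => by
          rw [Finsupp.notMem_support_iff.1 hp, pow_zero]), Fintype.prod_prod_type, Real.exp_sum]
        refine Finset.prod_congr rfl fun h _ => ?_
        rw [Real.exp_sum]
        refine Finset.prod_congr rfl fun i _ => ?_
        rw [Real.rpow_def_of_pos (hQ0 h), ← Real.exp_nat_mul]
        congr 1; ring
      rw [hpr]
      refine Real.exp_le_exp.2 ?_
      refine (sum_exponent_le hB hδ hr hρ.le hl1 hl2 (hbal I hI) fun h => ?_).trans ?_
      · rw [← weight_blockWeight, hGhom (mem_support_iff.1 hI)]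
      · have : 0 ≤ ρ * m := by positivity
        refine mul_le_mul_of_nonneg_left ?_ this
        linarith
    calc wnorm (normRingSeminorm ℝ) (fun y : Fin m × ι => E * Q y.1 ^ e y.2) G
        ≤ rnorm G * (E ^ (∑ h, r h) * Real.exp (ρ * m * (-δ + δ / 4 + δ / 4))) := by
          rw [rnorm_eq, Finset.sum_mul, wnorm]
          refine Finset.sum_le_sum fun I hI => ?_
          rw [normRingSeminorm_real]
          exact mul_le_mul_of_nonneg_left (hmon I hI) (abs_nonneg _)
      _ ≤ K ^ (∑ h, r h) * (E ^ (∑ h, r h) * Real.exp (ρ * m * (-δ + δ / 4 + δ / 4))) :=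
          mul_le_mul_of_nonneg_right hG (by positivity)
      _ = _ := by rw [mul_pow]; ring
  -- lower bound for the weight of `T`
  have hlow : Real.exp (-(ρ * m * (δ / 4))) ≤ T.prod fun z n => w z ^ n := by
    have hpr : (T.prod fun z n => w z ^ n) =
        Real.exp (∑ h, -(B * (T (h, o) / r h * (r h * Real.log (Q h))))) := by
      rw [Finsupp.prod, Finset.prod_subset (Finset.subset_univ _) (fun p _ hp => by
          rw [Finsupp.notMem_support_iff.1 hp, pow_zero]), Fintype.prod_prod_type, Real.exp_sum]
      refine Finset.prod_congr rfl fun h _ => ?_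
      rw [Finset.prod_eq_single o]
      · have hr' : (r h : ℝ) ≠ 0 := by exact_mod_cast (hr h).ne'
        simp only [hw, if_true]
        rw [Real.rpow_def_of_pos (hQ0 h), ← Real.exp_nat_mul]
        congr 1; field_simp
      · intro i _ hi; simp [hw, hi]
      · simp
    rw [hpr]
    refine Real.exp_le_exp.2 ?_
    rw [Finset.sum_neg_distrib, neg_le_neg_iff]
    calc ∑ h, B * ((T (h, o) : ℝ) / r h * (r h * Real.log (Q h)))
        ≤ ∑ h, B * ((T (h, o) : ℝ) / r h * (2 * ρ)) := by
          refine Finset.sum_le_sum fun h _ => ?_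
          have : r h * Real.log (Q h) ≤ 2 * ρ := (hl2 h).trans (by nlinarith)
          gcongr
      _ = (B * (2 * ρ)) * ∑ h, (T (h, o) : ℝ) / r h := by
          rw [Finset.mul_sum]; exact Finset.sum_congr rfl fun h _ => by ring
      _ ≤ (B * (2 * ρ)) * (τ * m) := mul_le_mul_of_nonneg_left hT.le (by positivity)
      _ = (ρ * m) * (2 * (B * τ)) := by ring
      _ ≤ _ := mul_le_mul_of_nonneg_left hτ (by positivity)
  -- the geometric factor
  have hgeom : (K * E) ^ (∑ h, r h) < Real.exp (ρ * m * (δ / 4)) := by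
    have hKE : 1 ≤ K * E := one_le_mul_of_one_le_of_one_le hK hE1
    have hKE0 : 0 < K * E := one_pos.trans_le hKE
    rw [← Real.exp_log hKE0, ← Real.exp_nat_mul, Real.exp_lt_exp]
    push_cast
    rw [Finset.sum_mul]
    have : ∑ h : Fin m, (r h : ℝ) * Real.log (K * E) < ∑ _h : Fin m, ρ * (δ / 4) := by
      refine Finset.sum_lt_sum_of_nonempty (Finset.univ_nonempty_iff.2 ⟨⟨0, hm⟩⟩) fun h _ => ?_
      have h1 : (r h : ℝ) * (8 * Real.log (K * E)) < r h * (δ * Real.log (Q h)) :=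
        mul_lt_mul_of_pos_left (hKQ h) (by exact_mod_cast hr h)
      have h2 : r h * Real.log (Q h) ≤ 2 * ρ := (hl2 h).trans (by nlinarith)
      have h3 := mul_le_mul_of_nonneg_left h2 hδ0.le
      linarith
    refine this.trans_le (le_of_eq ?_)
    simp; ring
  by_contra hne
  have h1 : (1 : ℝ) ≤ |((coeff T F : ℤ) : ℝ)| := by exact_mod_cast Int.one_le_abs hne
  have h2 := coeff_mul_weight_le_wnorm (ν := normRingSeminorm ℝ) hw0
    (map (Int.castRingHom ℝ) F) T
  rw [coeff_map, normRingSeminorm_real, Int.coe_castRingHom] at h2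
  have h3 : Real.exp (-(ρ * m * (δ / 4))) ≤
      (K * E) ^ (∑ h, r h) * Real.exp (ρ * m * (-δ + δ / 4 + δ / 4)) := by
    refine le_trans ?_ (h2.trans hup)
    exact hlow.trans (le_mul_of_one_le_left ((Real.exp_pos _).le.trans hlow) h1)
  have h4 := mul_lt_mul_of_pos_right hgeom (Real.exp_pos (ρ * m * (-δ + δ / 4 + δ / 4)))
  have h5 := h3.trans_lt h4
  rw [← Real.exp_add, Real.exp_lt_exp] at h5
  linarith

end SmallCoefficients

end SchmidtSubspace

namespace SchmidtSubspace

section Denominators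

/-- A primitive integer vector has a ratio of coordinates of large denominator. -/
lemma exists_large_denominator {ι : Type*} [Fintype ι] [Nontrivial ι] (v : ι → ℤ)
    (hv : Finset.univ.gcd v = 1) :
    ∃ k l : ι, l ≠ k ∧ v k ≠ 0 ∧ (∀ i, |v i| ≤ |v k|) ∧
      |v k| ≤ ((-(v l : ℚ) / v k).den : ℤ) ^ Fintype.card ι := by
  classical
  obtain ⟨k, -, hk⟩ := Finset.exists_max_image (Finset.univ : Finset ι) (fun i => |v i|)
    Finset.univ_nonempty
  have hvk : v k ≠ 0 := by
    intro h0
    have : ∀ i, v i = 0 := fun i => by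
      have := hk i (Finset.mem_univ i)
      rw [h0, abs_zero] at this
      exact abs_eq_zero.1 (le_antisymm this (abs_nonneg _))
    have h1 : Finset.univ.gcd v = 0 := Finset.gcd_eq_zero_iff.2 fun i _ => this i
    rw [h1] at hv
    exact zero_ne_one hv
  let q : ι → ℕ := fun l => (-(v l : ℚ) / v k).den
  have hq : ∀ l, 1 ≤ q l := fun l => Rat.pos _
  have hdvd : ∀ l, v k ∣ v l * q l := by
    intro l
    have hvk' : (v k : ℚ) ≠ 0 := by exact_mod_cast hvk
    have key : ∀ z : ℚ, z = -(v l : ℚ) / v k → v k ∣ v l * (z.den : ℤ) := by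
      intro z hz
      have h1 := Rat.mul_den_eq_num z
      rw [eq_div_iff hvk'] at hz
      have h2 : v l * (z.den : ℤ) = v k * -z.num := by
        have : (v l : ℚ) * z.den = v k * -z.num := by rw [← h1]; linear_combination (z.den : ℚ) * hz
        exact_mod_cast this
      exact ⟨_, h2⟩
    exact key _ rfl
  have hne : (Finset.univ.erase k : Finset ι).Nonempty := by
    obtain ⟨l, hl⟩ := exists_ne k
    exact ⟨l, by simp [hl]⟩
  obtain ⟨l, hl, hmax⟩ := Finset.exists_max_image (Finset.univ.erase k : Finset ι) q hne
  refine ⟨k, l, Finset.ne_of_mem_erase hl, hvk, fun i => hk i (Finset.mem_univ i), ?_⟩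
  have hD : v k ∣ ((∏ i ∈ Finset.univ.erase k, q i : ℕ) : ℤ) := by
    have h1 : v k ∣ Finset.univ.gcd fun i => v i * ((∏ i ∈ Finset.univ.erase k, q i : ℕ) : ℤ) := by
      refine Finset.dvd_gcd fun i _ => ?_
      by_cases hi : i = k
      · rw [hi]; exact dvd_mul_right _ _
      · refine (hdvd i).trans (mul_dvd_mul_left _ ?_)
        exact_mod_cast Finset.dvd_prod_of_mem q (by simp [hi])
    rw [Finset.gcd_mul_right, hv, one_mul] at h1
    exact dvd_normalize_iff.1 h1
  have hpos : 0 < ∏ i ∈ Finset.univ.erase k, q i := Finset.prod_pos fun i _ => hq i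
  have h2 : |v k| ≤ ((∏ i ∈ Finset.univ.erase k, q i : ℕ) : ℤ) :=
    Int.le_of_dvd (by exact_mod_cast hpos) ((abs_dvd _ _).2 hD)
  refine h2.trans ?_
  have h3 : ∏ i ∈ Finset.univ.erase k, q i ≤ q l ^ Fintype.card ι := by
    refine (Finset.prod_le_pow_card _ _ _ hmax).trans (Nat.pow_le_pow_right (hq l) ?_)
    exact (Finset.card_le_card (Finset.subset_univ _)).trans_eq Finset.card_univ
  change _ ≤ ((q l : ℕ) : ℤ) ^ Fintype.card ι
  exact_mod_cast h3

end Denominators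

section LinearForms

/-- Liouville's inequality for finitely many linear forms with algebraic coefficients. -/
lemma exists_liouville_linear {ι κ : Type*} [Fintype ι] [Fintype κ] (γ : κ → ι → ℝ)
    (hγ : ∀ a i, IsAlgebraic ℚ (γ a i)) :
    ∃ (K : ℝ) (s : ℕ), 1 ≤ K ∧ ∀ a (v : ι → ℤ) (V : ℝ), 1 ≤ V → (∀ i, |((v i : ℤ) : ℝ)| ≤ V) →
      ∑ i, v i * γ a i ≠ 0 → 1 ≤ K * V ^ s * |∑ i, v i * γ a i| := by
  classical
  obtain ⟨D, hD, hint⟩ := exists_common_denominator (fun z : κ × ι => γ z.1 z.2)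
    fun z => hγ _ _
  obtain ⟨O, s, b, hO⟩ := exists_order _ hint
  obtain ⟨K, hK, hliou⟩ := exists_liouville b (algebraMap O ℝ)
  let β : κ → ι → O := fun a i => ⟨_, hO (a, i)⟩
  let c : ℝ := ∑ a, ∑ i, orderSeminorm b (β a i)
  have hc : 0 ≤ c := Finset.sum_nonneg fun a _ => Finset.sum_nonneg fun i _ => apply_nonneg _ _
  have hD1 : (1 : ℝ) ≤ |(D : ℝ)| := by exact_mod_cast Int.one_le_abs hD
  refine ⟨K * (1 + c) ^ s * |(D : ℝ)|, s, ?_, ?_⟩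
  · exact one_le_mul_of_one_le_of_one_le (one_le_mul_of_one_le_of_one_le hK
      (one_le_pow₀ (by linarith))) hD1
  intro a v V hV hv hne
  let x : O := ∑ i, (v i : O) * β a i
  have hx : algebraMap O ℝ x = D * ∑ i, v i * γ a i := by
    simp only [x, map_sum, map_mul, map_intCast, Finset.mul_sum]
    refine Finset.sum_congr rfl fun i _ => ?_
    change (v i : ℝ) * (D * γ a i) = _
    ring
  have hx0 : x ≠ 0 := by
    intro h0
    rw [h0, map_zero] at hx
    rcases mul_eq_zero.1 hx.symm with h | h
    · exact hD (by exact_mod_cast h)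
    · exact hne h
  have hν : orderSeminorm b x ≤ V * c := by
    calc orderSeminorm b x ≤ ∑ i, orderSeminorm b ((v i : O) * β a i) := by
          exact Finset.le_sum_of_subadditive (orderSeminorm b) (map_zero _).le
            (map_add_le_add _) _ _
      _ ≤ ∑ i, V * orderSeminorm b (β a i) := by
          refine Finset.sum_le_sum fun i _ => (map_mul_le_mul _ _ _).trans ?_
          exact mul_le_mul_of_nonneg_right ((orderSeminorm_intCast_le b _).trans (hv i))
            (apply_nonneg _ _)
      _ = V * ∑ i, orderSeminorm b (β a i) := by rw [Finset.mul_sum]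
      _ ≤ V * c := by
          refine mul_le_mul_of_nonneg_left ?_ (by linarith)
          exact Finset.single_le_sum (f := fun a => ∑ i, orderSeminorm b (β a i))
            (fun a _ => Finset.sum_nonneg fun i _ => apply_nonneg _ _) (Finset.mem_univ a)
  have h1 := hliou x hx0
  rw [hx, abs_mul] at h1
  refine h1.trans ?_
  have h2 : (1 + orderSeminorm b x) ^ s ≤ ((1 + c) * V) ^ s := by
    have : (0 : ℝ) ≤ orderSeminorm b x := apply_nonneg _ _
    refine pow_le_pow_left₀ (by linarith) ?_ s
    nlinarith
  rw [mul_pow] at h2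
  calc K * (1 + orderSeminorm b x) ^ s * (|(D : ℝ)| * |∑ i, v i * γ a i|)
      ≤ K * ((1 + c) ^ s * V ^ s) * (|(D : ℝ)| * |∑ i, v i * γ a i|) := by gcongr
    _ = _ := by ring

end LinearForms

section Normal

variable {ι : Type*} [Fintype ι] [DecidableEq ι]

/-- The vector of cofactors along the row `o`, orthogonal to all the other rows. -/
def cofactorRow {R : Type*} [CommRing R] (x : Matrix ι ι R) (o : ι) : ι → R :=
  fun k => (x.updateRow o (Pi.single k 1)).det

lemma sum_cofactorRow_mul {R : Type*} [CommRing R] (x : Matrix ι ι R) (o : ι) (y : ι → R) :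
    ∑ k, cofactorRow x o k * y k = (x.updateRow o y).det := by
  have : y = ∑ k, y k • (Pi.single k 1 : ι → R) := by
    funext i; simp [Finset.sum_apply, Pi.single_apply]
  conv_rhs => rw [this]
  have h1 := map_sum ((Matrix.detRowAlternating (R := R) (n := ι)).toMultilinearMap.toLinearMap x o)
    (fun k => y k • (Pi.single k 1 : ι → R)) Finset.univ
  simp only [map_smul] at h1
  refine Eq.trans ?_ h1.symm
  refine Finset.sum_congr rfl fun k _ => ?_
  rw [smul_eq_mul, mul_comm]; rfl

lemma sum_cofactorRow_mul_row {R : Type*} [CommRing R] (x : Matrix ι ι R) {o j : ι} (hj : j ≠ o) :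
    ∑ k, cofactorRow x o k * x j k = 0 := by
  rw [sum_cofactorRow_mul]
  exact Matrix.det_zero_of_row_eq hj (by rw [Matrix.updateRow_ne hj, Matrix.updateRow_self])

lemma abs_dual_form_cofactorRow_le {M : Matrix ι ι ℝ} (hM : M.det ≠ 0) {e : ι → ℝ} {o : ι} {Q : ℝ}
    (hQ : 0 < Q) {x : Matrix ι ι ℤ} (hx : ∀ j i, j ≠ o → |∑ k, M i k * x j k| ≤ Q ^ e i) (i : ι) :
    |∑ k, ((cofactorRow x o k : ℤ) : ℝ) * M⁻¹ k i| ≤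
      (Fintype.card ι).factorial / |M.det| * Q ^ (∑ i, e i - e i) := by
  let xr : Matrix ι ι ℝ := x.map (Int.castRingHom ℝ)
  let Y : Matrix ι ι ℝ := Matrix.of fun j i => ∑ k, M i k * x j k
  have hY : ∀ j i, Y j i = ∑ k, M i k * x j k := fun _ _ => rfl
  have h1 : ∑ k, ((cofactorRow x o k : ℤ) : ℝ) * M⁻¹ k i = (xr.updateRow o fun k => M⁻¹ k i).det := by
    rw [← sum_cofactorRow_mul]
    refine Finset.sum_congr rfl fun k _ => ?_
    congr 1
    simp only [cofactorRow, xr]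
    rw [← eq_intCast (Int.castRingHom ℝ), RingHom.map_det]
    congr 1
    ext a b
    by_cases ha : a = o
    · subst ha; simp [Matrix.updateRow_self, Pi.single_apply, apply_ite]
    · simp [Matrix.updateRow_ne ha]
  have h2 : (xr.updateRow o fun k => M⁻¹ k i) * M.transpose =
      Y.updateRow o (Pi.single i 1) := by
    ext a b
    rw [Matrix.mul_apply]
    by_cases ha : a = o
    · subst ha
      simp only [Matrix.updateRow_self, Matrix.transpose_apply]
      have := congrFun (congrFun (Matrix.mul_nonsing_inv M (isUnit_iff_ne_zero.2 hM)) b) i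
      rw [Matrix.mul_apply] at this
      simp_rw [mul_comm (M⁻¹ _ _)]
      rw [this, Matrix.one_apply, Pi.single_apply]
    · simp only [Matrix.updateRow_ne ha, Matrix.transpose_apply, xr, Matrix.map_apply, hY]
      exact Finset.sum_congr rfl fun k _ => mul_comm _ _
  have h3 := congrArg Matrix.det h2
  rw [Matrix.det_mul, Matrix.det_transpose, ← h1] at h3
  have h4 : |(Y.updateRow o (Pi.single i 1)).det| ≤
      (Fintype.card ι).factorial * Q ^ (∑ i, e i - e i) := by
    rw [← Matrix.det_transpose, Matrix.det_apply]
    refine (Finset.abs_sum_le_sum_abs _ _).trans ?_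
    have : ∀ σ : Equiv.Perm ι, |Equiv.Perm.sign σ • ∏ a,
        (Y.updateRow o (Pi.single i 1)).transpose (σ a) a| ≤
        Q ^ (∑ i, e i - e i) := by
      intro σ
      rw [Units.smul_def, zsmul_eq_mul, abs_mul]
      have hs : |(((Equiv.Perm.sign σ : ℤˣ) : ℤ) : ℝ)| = 1 := by
        rcases Int.units_eq_one_or (Equiv.Perm.sign σ) with h | h <;> simp [h]
      rw [hs, one_mul, ← Finset.mul_prod_erase _ _ (Finset.mem_univ o), abs_mul]
      simp only [Matrix.transpose_apply, Matrix.updateRow_self]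
      by_cases hσ : σ o = i
      · rw [hσ, Pi.single_eq_same, abs_one, one_mul, Finset.abs_prod]
        have h5 : ∑ i, e i - e i = ∑ a ∈ Finset.univ.erase o, e (σ a) := by
          rw [← Equiv.sum_comp σ e, ← Finset.add_sum_erase _ _ (Finset.mem_univ o), hσ]
          ring
        rw [h5, Real.rpow_sum_of_pos hQ]
        refine Finset.prod_le_prod (fun _ _ => abs_nonneg _) fun a ha => ?_
        rw [Matrix.updateRow_ne (Finset.ne_of_mem_erase ha)]
        rw [hY]
        exact hx a (σ a) (Finset.ne_of_mem_erase ha)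
      · rw [Pi.single_eq_of_ne hσ, abs_zero, zero_mul]
        exact (Real.rpow_pos_of_pos hQ _).le
    refine (Finset.sum_le_sum fun σ _ => this σ).trans ?_
    rw [Finset.sum_const, Finset.card_univ, Fintype.card_perm, nsmul_eq_mul]
  have hM0 : 0 < |M.det| := abs_pos.2 hM
  rw [div_mul_eq_mul_div, le_div_iff₀ hM0, ← abs_mul, h3]
  exact h4

/-- If no nonzero integer vector is annihilated by all dual forms of nonnegative exponent, then
the normal vector of the rows different from `o` has a ratio of large denominator. -/
lemma exists_normal_large_denominator {M : Matrix ι ι ℝ} (halg : ∀ i j, IsAlgebraic ℚ (M i j))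
    (hM : M.det ≠ 0) {e : ι → ℝ} (he : ∑ i, e i < 0) (o : ι)
    (hT : ∀ w : ι → ℤ, (∀ i, 0 ≤ e i → ∑ k, w k * M⁻¹ k i = 0) → w = 0) :
    ∃ κ : ℝ, 0 < κ ∧ ∃ Q₁ : ℝ, ∀ Q ≥ Q₁, ∀ x : Matrix ι ι ℤ, x.det ≠ 0 →
      (∀ j i, j ≠ o → |∑ k, M i k * x j k| ≤ Q ^ e i) →
      ∃ (v : ι → ℤ) (k l : ι), l ≠ k ∧ v k ≠ 0 ∧ (∀ j, j ≠ o → ∑ i, x j i * v i = 0) ∧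
        (x.updateRow o (Pi.single k 1)).det ≠ 0 ∧ Q ^ κ ≤ ((-(v l : ℚ) / v k).den : ℝ) := by
  have hnt : Nontrivial ι := by
    by_contra hcon
    rw [not_nontrivial_iff_subsingleton] at hcon
    rw [Fintype.sum_subsingleton e o] at he
    have := hT (fun _ => 1) fun i hi => by
      rw [Subsingleton.elim i o] at hi; exact absurd he (not_lt.2 hi)
    exact one_ne_zero (congrFun this o)
  obtain ⟨K, s, hK, hliou⟩ := exists_liouville_linear (fun i k => M⁻¹ k i)
    fun i k => isAlgebraic_inv_apply halg k i
  set S : ℝ := -∑ i, e i with hS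
  have hS0 : 0 < S := by rw [hS]; linarith
  set N : ℕ := Fintype.card ι with hN
  have hN0 : 0 < N := Fintype.card_pos
  have hM0 : 0 < |M.det| := abs_pos.2 hM
  set c : ℝ := N.factorial / |M.det| with hc
  have hc0 : 0 < c := by positivity
  have hev : ∀ᶠ Q : ℝ in Filter.atTop, K * c ≤ Q ^ (S / 2) :=
    (tendsto_rpow_atTop (by linarith)).eventually_ge_atTop _
  obtain ⟨Q₁, hQ₁⟩ := Filter.eventually_atTop.1 hev
  refine ⟨S / 2 / (N * (s + 1) : ℕ), by positivity, max 1 Q₁, fun Q hQ x hdet hx => ?_⟩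
  have hQ1 : 1 ≤ Q := (le_max_left _ _).trans hQ
  have hQ0 : 0 < Q := one_pos.trans_le hQ1
  have hQK := hQ₁ Q ((le_max_right _ _).trans hQ)
  obtain ⟨v, hv, hgcd⟩ := Finset.extract_gcd (cofactorRow x o) (s := Finset.univ)
    Finset.univ_nonempty
  set g : ℤ := Finset.univ.gcd (cofactorRow x o) with hg
  have hg0 : g ≠ 0 := by
    intro h0
    have h1 := sum_cofactorRow_mul x o (x o)
    rw [Matrix.updateRow_eq_self] at h1
    refine hdet (h1.symm.trans (Finset.sum_eq_zero fun k _ => ?_))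
    rw [hv k (Finset.mem_univ k), h0, zero_mul, zero_mul]
  obtain ⟨k, l, hlk, hvk, hmax, hden⟩ := exists_large_denominator v hgcd
  refine ⟨v, k, l, hlk, hvk, fun j hj => ?_, ?_, ?_⟩
  · have h1 := sum_cofactorRow_mul_row x hj
    have h2 : g * ∑ i, x j i * v i = 0 := by
      rw [← h1, Finset.mul_sum]
      refine Finset.sum_congr rfl fun i _ => ?_
      rw [hv i (Finset.mem_univ i)]; ring
    exact (mul_eq_zero.1 h2).resolve_left hg0
  · change cofactorRow x o k ≠ 0
    rw [hv k (Finset.mem_univ k)]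
    exact mul_ne_zero hg0 hvk
  have hvne : v ≠ 0 := fun h0 => hvk (by rw [h0]; rfl)
  obtain ⟨i, hi, hne⟩ : ∃ i, 0 ≤ e i ∧ ∑ k, (v k : ℝ) * M⁻¹ k i ≠ 0 := by
    by_contra hcon
    push Not at hcon
    exact hvne (hT v hcon)
  have hV1 : (1 : ℝ) ≤ |((v k : ℤ) : ℝ)| := by exact_mod_cast Int.one_le_abs hvk
  have h1 := hliou i v |((v k : ℤ) : ℝ)| hV1 (fun j => by exact_mod_cast hmax j) hne
  have h2 : |∑ k, (v k : ℝ) * M⁻¹ k i| ≤ c * Q ^ (-S) := by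
    have h3 := abs_dual_form_cofactorRow_le hM hQ0 hx i
    have h4 : ∑ k, ((cofactorRow x o k : ℤ) : ℝ) * M⁻¹ k i = g * ∑ k, (v k : ℝ) * M⁻¹ k i := by
      rw [Finset.mul_sum]
      refine Finset.sum_congr rfl fun j _ => ?_
      rw [hv j (Finset.mem_univ j)]; push_cast; ring
    rw [h4, abs_mul] at h3
    have hg1 : (1 : ℝ) ≤ |(g : ℝ)| := by exact_mod_cast Int.one_le_abs hg0
    refine (le_mul_of_one_le_left (abs_nonneg _) hg1).trans (h3.trans ?_)
    refine mul_le_mul_of_nonneg_left (Real.rpow_le_rpow_of_exponent_le hQ1 ?_) hc0.le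
    rw [hS]; linarith
  have h5 : Q ^ S ≤ K * c * |((v k : ℤ) : ℝ)| ^ (s + 1) := by
    have h6 : 1 ≤ K * |((v k : ℤ) : ℝ)| ^ (s + 1) * (c * Q ^ (-S)) := by
      refine h1.trans ?_
      gcongr
      exact Nat.le_succ s
    have h7 := mul_le_mul_of_nonneg_right h6 (Real.rpow_pos_of_pos hQ0 S).le
    have h8 : Q ^ (-S) * Q ^ S = 1 := by rw [← Real.rpow_add hQ0]; simp
    calc Q ^ S = 1 * Q ^ S := (one_mul _).symm
      _ ≤ _ := h7
      _ = K * c * |((v k : ℤ) : ℝ)| ^ (s + 1) * (Q ^ (-S) * Q ^ S) := by ring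
      _ = _ := by rw [h8, mul_one]
  have h9 : Q ^ (S / 2) ≤ |((v k : ℤ) : ℝ)| ^ (s + 1) := by
    have h10 : Q ^ S = Q ^ (S / 2) * Q ^ (S / 2) := by rw [← Real.rpow_add hQ0]; congr 1; ring
    have hpos := Real.rpow_pos_of_pos hQ0 (S / 2)
    have h11 : Q ^ (S / 2) * Q ^ (S / 2) ≤ Q ^ (S / 2) * |((v k : ℤ) : ℝ)| ^ (s + 1) := by
      rw [← h10]
      exact h5.trans (mul_le_mul_of_nonneg_right hQK (by positivity))
    exact le_of_mul_le_mul_left h11 hpos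
  have hden' : |((v k : ℤ) : ℝ)| ≤ ((-(v l : ℚ) / v k).den : ℝ) ^ N := by
    generalize (-(v l : ℚ) / v k).den = D at hden ⊢
    exact_mod_cast hden
  have hNs : N * (s + 1) ≠ 0 := by positivity
  rw [← pow_le_pow_iff_left₀ (Real.rpow_pos_of_pos hQ0 _).le (Nat.cast_nonneg _) hNs,
    ← Real.rpow_natCast, ← Real.rpow_mul hQ0.le, div_mul_cancel₀ _ (by exact_mod_cast hNs)]
  refine h9.trans ?_
  rw [pow_mul]
  exact pow_le_pow_left₀ (abs_nonneg _) hden' _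

end Normal

end SchmidtSubspace

namespace SchmidtSubspace

open MvPolynomial

/-- From an unbounded set of reals one can choose rapidly decreasing tuples. -/
lemma exists_lacunary {D : ℝ → Prop} (hD : ∀ Q₀ : ℝ, ∃ Q ≥ Q₀, D Q) (a Q₀ : ℝ) (m : ℕ) :
    ∃ Q : Fin m → ℝ, (∀ h, Q₀ ≤ Q h) ∧ (∀ h, D (Q h)) ∧
      ∀ i j, i < j → a * Real.log (Q j) ≤ Real.log (Q i) := by
  induction m with
  | zero => exact ⟨Fin.elim0, fun h => h.elim0, fun h => h.elim0, fun h => h.elim0⟩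
  | succ m ih =>
    obtain ⟨Q, hQ0, hQD, hQ⟩ := ih
    obtain ⟨q, hq, hqD⟩ := hD (max Q₀ (∑ h, Real.exp (a * Real.log (Q h))))
    refine ⟨Fin.cons q Q, fun h => ?_, fun h => ?_, fun i j hij => ?_⟩
    · refine Fin.cases ?_ (fun h => ?_) h
      · exact (le_max_left _ _).trans hq
      · exact hQ0 h
    · refine Fin.cases ?_ (fun h => ?_) h
      · exact hqD
      · exact hQD h
    · obtain ⟨j, rfl⟩ := Fin.exists_succ_eq.2 (Fin.ne_zero_of_lt hij)
      refine Fin.cases (fun _ => ?_) (fun i hij => ?_) i hij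
      · simp only [Fin.cons_succ, Fin.cons_zero]
        have h1 : Real.exp (a * Real.log (Q j)) ≤ q :=
          (Finset.single_le_sum (f := fun h => Real.exp (a * Real.log (Q h)))
            (fun _ _ => (Real.exp_pos _).le) (Finset.mem_univ j)).trans
            ((le_max_right _ _).trans hq)
        exact (Real.le_log_iff_exp_le ((Real.exp_pos _).trans_le h1)).2 h1
      · simp only [Fin.cons_succ]
        exact hQ i j (Fin.succ_lt_succ_iff.1 hij)

section

variable {ι : Type*} [Fintype ι] [DecidableEq ι]

/-- If no nonzero integer vector is annihilated by all dual forms of nonnegative exponent, then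
the system of inequalities has solutions for bounded `Q` only. -/
lemma bounded_of_dual_forms_ne_zero {M : Matrix ι ι ℝ} (halg : ∀ i j, IsAlgebraic ℚ (M i j))
    (hM : M.det ≠ 0) {e : ι → ℝ} (he : ∑ i, e i < 0) (o : ι)
    (hT : ∀ w : ι → ℤ, (∀ i, 0 ≤ e i → ∑ k, w k * M⁻¹ k i = 0) → w = 0) :
    ∃ Q₀ : ℝ, ∀ Q ≥ Q₀, ∀ x : Matrix ι ι ℤ, x.det ≠ 0 →
      ¬ ∀ j i, j ≠ o → |∑ k, M i k * x j k| ≤ Q ^ e i := by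
  by_contra hcon
  push Not at hcon
  have : Nonempty ι := ⟨o⟩
  obtain ⟨κ, hκ, Q₁, hnorm⟩ := exists_normal_large_denominator halg hM he o hT
  set N : ℝ := (Fintype.card ι : ℝ) with hN
  have hN1 : 1 ≤ N := by rw [hN]; exact_mod_cast Fintype.card_pos
  obtain ⟨A, hAdef⟩ : ∃ z : ℝ, z = ∑ i, ∑ k, |M i k| := ⟨_, rfl⟩
  have hA : ∀ i k, |M i k| ≤ A := fun i k =>
    hAdef ▸ (Finset.single_le_sum (f := fun k => |M i k|) (fun _ _ => abs_nonneg _)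
      (Finset.mem_univ k)).trans (Finset.single_le_sum (f := fun i => ∑ k, |M i k|)
        (fun _ _ => Finset.sum_nonneg fun _ _ => abs_nonneg _) (Finset.mem_univ i))
  obtain ⟨B, hBdef⟩ : ∃ z : ℝ, z = ∑ i, |e i| := ⟨_, rfl⟩
  have hB : ∀ i, |e i| ≤ B := fun i =>
    hBdef ▸ Finset.single_le_sum (f := fun i => |e i|) (fun _ _ => abs_nonneg _) (Finset.mem_univ i)
  have hA0 : 0 ≤ A := (abs_nonneg _).trans (hA o o)
  have hB0 : 0 ≤ B := (abs_nonneg _).trans (hB o)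
  obtain ⟨δ, hδdef⟩ : ∃ z : ℝ, z = -(∑ i, e i) / N := ⟨_, rfl⟩
  have hδ0 : 0 < δ := by rw [hδdef]; exact div_pos (by linarith) (by linarith)
  have hδB : δ ≤ B := by
    rw [hδdef, div_le_iff₀ (by linarith)]
    calc -(∑ i, e i) ≤ |∑ i, e i| := neg_le_abs _
      _ ≤ B := hBdef ▸ Finset.abs_sum_le_sum_abs _ _
      _ ≤ B * N := le_mul_of_one_le_right hB0 hN1
  have hδ : ∑ i, e i = -(N * δ) := by rw [hδdef]; field_simp
  obtain ⟨η, hηdef⟩ : ∃ z : ℝ, z = δ / (4 * (N * B + 1)) := ⟨_, rfl⟩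
  have hNB : 0 ≤ N * B := by positivity
  have hη0 : 0 < η := by rw [hηdef]; positivity
  have hη2 : η ≤ 2 := by
    rw [hηdef, div_le_iff₀ (by positivity)]
    nlinarith
  have hη : N * (B * η) ≤ δ / 4 := by
    rw [hηdef, ← mul_assoc, mul_div_assoc', div_le_div_iff₀ (by positivity) (by norm_num)]
    nlinarith
  obtain ⟨θ, hθdef⟩ : ∃ z : ℝ, z = δ / (4 * (B + 1)) := ⟨_, rfl⟩
  have hθ0 : 0 < θ := by rw [hθdef]; positivity
  have hθ1 : θ ≤ 1 := by
    rw [hθdef, div_le_iff₀ (by positivity)]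
    nlinarith
  have hθ : B * θ ≤ δ / 4 := by
    rw [hθdef, mul_div_assoc', div_le_div_iff₀ (by positivity) (by norm_num)]
    nlinarith
  obtain ⟨τ, hτdef⟩ : ∃ z : ℝ, z = δ / (8 * (B + 1)) := ⟨_, rfl⟩
  have hτ0 : 0 < τ := by rw [hτdef]; positivity
  have hτ : 2 * (B * τ) ≤ δ / 4 := by
    rw [hτdef, mul_div_assoc', mul_div_assoc', div_le_div_iff₀ (by positivity) (by norm_num)]
    nlinarith
  obtain ⟨m₀, haux⟩ :=
    exists_auxiliary_polynomial M halg (by convert hM) hη0 hη2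
  obtain ⟨m, hm, hmm₀⟩ : ∃ m : ℕ, 0 < m ∧ m₀ ≤ m :=
    ⟨max m₀ 1, lt_of_lt_of_le one_pos (le_max_right _ _), le_max_left _ _⟩
  obtain ⟨K, hK, haux⟩ := haux m hmm₀
  have hm0 : (0 : ℝ) < m := by exact_mod_cast hm
  have hεR0 : 0 < min 1 (τ * m / 2) := lt_min one_pos (by positivity)
  obtain ⟨ω, hω, hroth⟩ := roth_lemma m (min 1 (τ * m / 2)) hεR0 (min_le_left _ _)
  obtain ⟨C₀, hC₀⟩ : ∃ z : ℝ, z = (2 : ℝ) ^ ((m + 1) ^ 2) := ⟨_, rfl⟩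
  have hC₀1 : 1 ≤ C₀ := hC₀ ▸ one_le_pow₀ (by norm_num)
  obtain ⟨Λ, hΛ⟩ : ∃ z : ℝ,
    z = 1 + 8 * |Real.log (K * (N + A))| / δ + 2 * m * Real.log (C₀ * K) / (ω * κ) := ⟨_, rfl⟩
  have hlogCK : 0 ≤ Real.log (C₀ * K) := Real.log_nonneg (one_le_mul_of_one_le_of_one_le hC₀1 hK)
  have hD : ∀ Q₀ : ℝ, ∃ Q ≥ Q₀, ∃ x : Matrix ι ι ℤ, x.det ≠ 0 ∧
      ∀ j i, j ≠ o → |∑ k, M i k * x j k| ≤ Q ^ e i := fun Q₀ => by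
    obtain ⟨Q, h1, x, h2, h3⟩ := hcon Q₀
    exact ⟨Q, h1, x, h2, h3⟩
  obtain ⟨Q, hQ0, hQD, hQlac⟩ := exists_lacunary hD (2 / ω) (max Q₁ (Real.exp Λ)) m
  choose x hdet hx using hQD
  have hex := fun h => hnorm (Q h) ((le_max_left _ _).trans (hQ0 h)) (x h) (hdet h) (hx h)
  choose v k l hlk hvk hperp hdet' hden using hex
  have hQpos : ∀ h, 0 < Q h := fun h =>
    (Real.exp_pos Λ).trans_le ((le_max_right _ _).trans (hQ0 h))
  have hlogQ : ∀ h, Λ ≤ Real.log (Q h) := fun h =>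
    (Real.le_log_iff_exp_le (hQpos h)).2 ((le_max_right _ _).trans (hQ0 h))
  have hΛ1 : 1 ≤ Λ := by
    have h1 : 0 ≤ 8 * |Real.log (K * (N + A))| / δ := by positivity
    have h2 : 0 ≤ 2 * m * Real.log (C₀ * K) / (ω * κ) := by positivity
    rw [hΛ]; linarith
  have hΛ2 : 8 * Real.log (K * (N + A)) < δ * Λ := by
    have h2 : 0 ≤ 2 * m * Real.log (C₀ * K) / (ω * κ) := by positivity
    have h3 : 8 * |Real.log (K * (N + A))| / δ < Λ := by rw [hΛ]; linarith
    rw [div_lt_iff₀ hδ0] at h3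
    linarith [le_abs_self (Real.log (K * (N + A)))]
  have hΛ3 : 2 * m * Real.log (C₀ * K) ≤ ω * κ * Λ := by
    have h1 : 0 ≤ 8 * |Real.log (K * (N + A))| / δ := by positivity
    have h3 : 2 * m * Real.log (C₀ * K) / (ω * κ) ≤ Λ := by rw [hΛ]; linarith
    rw [div_le_iff₀ (by positivity)] at h3
    linarith
  have hlpos : ∀ h, 0 < Real.log (Q h) := fun h => by linarith [hlogQ h]
  have hQ1 : ∀ h, 1 < Q h := fun h => (Real.log_pos_iff (hQpos h).le).1 (hlpos h)
  obtain ⟨ρ, hρdef⟩ : ∃ z : ℝ, z = (∑ h, Real.log (Q h)) / θ := ⟨_, rfl⟩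
  have hρ0 : 0 < ρ := hρdef ▸
    div_pos (Finset.sum_pos (fun h _ => hlpos h) ⟨⟨0, hm⟩, Finset.mem_univ _⟩) hθ0
  have hρQ : ∀ h, Real.log (Q h) ≤ θ * ρ := fun h => by
    rw [hρdef, mul_div_cancel₀ _ hθ0.ne']
    exact Finset.single_le_sum (f := fun h => Real.log (Q h)) (fun h _ => (hlpos h).le)
      (Finset.mem_univ h)
  obtain ⟨r, hrdef⟩ : ∃ r : Fin m → ℕ, ∀ h, r h = ⌈ρ / Real.log (Q h)⌉₊ := ⟨_, fun _ => rfl⟩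
  have hr : ∀ h, 0 < r h := fun h => hrdef h ▸ Nat.ceil_pos.2 (div_pos hρ0 (hlpos h))
  have hl1 : ∀ h, ρ ≤ r h * Real.log (Q h) := fun h =>
    (div_le_iff₀ (hlpos h)).1 (hrdef h ▸ Nat.le_ceil _)
  have hl2 : ∀ h, r h * Real.log (Q h) ≤ (1 + θ) * ρ := fun h => by
    have h1 : (r h : ℝ) < ρ / Real.log (Q h) + 1 :=
      hrdef h ▸ Nat.ceil_lt_add_one (div_pos hρ0 (hlpos h)).le
    have h2 := mul_le_mul_of_nonneg_right h1.le (hlpos h).le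
    rw [add_mul, div_mul_cancel₀ _ (hlpos h).ne'] at h2
    linarith [hρQ h]
  have hl3 : ∀ h, r h * Real.log (Q h) ≤ 2 * ρ := fun h => (hl2 h).trans (by nlinarith)
  obtain ⟨P, hP0, hPhom, hPnorm, G, hPG, hGnorm, hGhom, hbal⟩ := haux r hr
  let y : Fin m → Matrix ι ι ℤ := fun h => (x h).updateRow o (Pi.single (k h) 1)
  have hyo : ∀ h, y h o = Pi.single (k h) 1 := fun h => Matrix.updateRow_self
  have hyj : ∀ h j, j ≠ o → y h j = x h j := fun h j hj => Matrix.updateRow_ne hj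
  have hvanish := coeff_eq_zero_of_small (x := y) (k := k) hA hB hδ hη hθ hθ1 hτ hδ0 hQ1 hyo
    (fun h j i hj => by rw [hyj h j hj]; exact hx h j i hj) hr hρ0 hm hl1 hl2 hK
    (fun h => hΛ2.trans_le (mul_le_mul_of_nonneg_left (hlogQ h) hδ0.le)) hPG hGnorm hGhom hbal
  obtain ⟨p, hp0, hpdeg, hpnorm, hpord⟩ := exists_restriction (k := k) (l := l) (v := v) (r := r)
    (x := y) (o := o) (t := τ * m) hP0
    (fun T hT h => by rw [← weight_blockWeight, hPhom (mem_support_iff.1 hT)])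
    hdet' hlk (fun h j hj => by rw [hyj h j hj]; exact hperp h j hj) hvk hyo hvanish
  let ξ : Fin m → ℚ := fun h => -(v h (l h) : ℚ) / v h (k h)
  have hR : ∀ h, r h ≤ ∑ h, r h := fun h =>
    Finset.single_le_sum (f := r) (fun _ _ => Nat.zero_le _) (Finset.mem_univ h)
  obtain ⟨J, hJ, hcoeff⟩ := hroth r (∑ h, r h) (fun h => (ξ h).num) (fun h => ((ξ h).den : ℤ)) p hr hR
    ((hr ⟨0, hm⟩).trans_le (hR _)) (fun h => by exact_mod_cast (ξ h).pos)
    (fun h => by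
      rw [Int.isCoprime_iff_gcd_eq_one]
      exact (ξ h).reduced) hp0 hpdeg
    (fun i j hij => by
      have h1 : 2 / ω * Real.log (Q j) ≤ Real.log (Q i) := hQlac i j hij
      have h2 : (r i : ℝ) * (2 / ω * Real.log (Q j)) ≤ 2 * ρ :=
        (mul_le_mul_of_nonneg_left h1 (Nat.cast_nonneg _)).trans (hl3 i)
      have h3 : (r i : ℝ) * (2 / ω * Real.log (Q j)) ≤ 2 * (r j * Real.log (Q j)) :=
        h2.trans (by linarith [hl1 j])
      have h4 : (r i : ℝ) * (2 / ω * Real.log (Q j)) = (2 * (r i / ω)) * Real.log (Q j) := by ring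
      rw [h4, ← mul_assoc] at h3
      have h5 := le_of_mul_le_mul_right h3 (hlpos j)
      have h6 : (r i : ℝ) / ω ≤ r j := by linarith
      rw [div_le_iff₀ hω] at h6
      linarith)
    (fun h => by
      rw [← hC₀]
      have hCK : 0 < C₀ * K := by positivity
      have h1 : C₀ ^ (∑ h, r h) * inorm p ≤ (C₀ * K) ^ (∑ h, r h) := by
        rw [mul_pow]
        exact mul_le_mul_of_nonneg_left (hpnorm.trans hPnorm) (by positivity)
      refine h1.trans ?_
      have h2 : (C₀ * K) ^ (∑ h, r h) ≤ Real.exp (ω * κ * ρ) := by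
        rw [← Real.exp_log hCK, ← Real.exp_nat_mul, Real.exp_le_exp]
        push_cast
        rw [Finset.sum_mul]
        have hterm : ∀ h ∈ (Finset.univ : Finset (Fin m)),
            (r h : ℝ) * Real.log (C₀ * K) ≤ ω * κ * ρ / m := by
          intro h _
          rw [le_div_iff₀ hm0]
          have h3 : (r h : ℝ) * (2 * m * Real.log (C₀ * K)) ≤ r h * (ω * κ * Real.log (Q h)) :=
            mul_le_mul_of_nonneg_left (hΛ3.trans
              (mul_le_mul_of_nonneg_left (hlogQ h) (by positivity))) (Nat.cast_nonneg _)
          have h4 := mul_le_mul_of_nonneg_left (hl3 h) (by positivity : 0 ≤ ω * κ)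
          linarith
        refine (Finset.sum_le_sum hterm).trans (le_of_eq ?_)
        simp only [Finset.sum_const, Finset.card_univ, Fintype.card_fin, nsmul_eq_mul]
        field_simp
      refine h2.trans ?_
      have hq0 : (0 : ℝ) < ((ξ h).den : ℝ) := by exact_mod_cast (ξ h).pos
      have h5 : Q h ^ κ ≤ ((ξ h).den : ℝ) := hden h
      have h6 : Real.log (Q h) * κ ≤ Real.log ((ξ h).den : ℝ) := by
        have := Real.log_le_log (Real.rpow_pos_of_pos (hQpos h) κ) h5
        rw [Real.log_rpow (hQpos h)] at this
        linarith
      rw [Int.cast_natCast, Real.rpow_def_of_pos hq0, Real.exp_le_exp]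
      have h7 := mul_le_mul_of_nonneg_right h6 (by positivity : 0 ≤ ω * r h)
      have h8 := mul_le_mul_of_nonneg_left (hl1 h) (by positivity : 0 ≤ ω * κ)
      linarith)
  refine hcoeff ?_
  have hξ : (fun h => (((ξ h).num : ℤ) : ℚ) / (((ξ h).den : ℤ) : ℚ)) = ξ := by
    funext h
    rw [Int.cast_natCast]
    exact Rat.num_div_den _
  rw [hξ]
  refine hpord J (hJ.trans_lt ?_)
  refine (min_le_right _ _).trans_lt ?_
  have : 0 < τ * m := by positivity
  linarith

/-- The rows of index different from `o` of all integral solutions of a system of inequalities with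
negative total exponent lie in a fixed rational hyperplane. -/
theorem exists_common_normal {M : Matrix ι ι ℝ} (halg : ∀ i j, IsAlgebraic ℚ (M i j))
    (hM : M.det ≠ 0) {e : ι → ℝ} (he : ∑ i, e i < 0) (o : ι) :
    ∃ v : ι → ℤ, v ≠ 0 ∧ ∃ Q₀ : ℝ, ∀ Q ≥ Q₀, ∀ x : Matrix ι ι ℤ, x.det ≠ 0 →
      (∀ j i, j ≠ o → |∑ k, M i k * x j k| ≤ Q ^ e i) → ∀ j, j ≠ o → ∑ k, v k * x j k = 0 := by
  by_cases hT : ∀ w : ι → ℤ, (∀ i, 0 ≤ e i → ∑ k, w k * M⁻¹ k i = 0) → w = 0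
  · obtain ⟨Q₀, hQ₀⟩ := bounded_of_dual_forms_ne_zero halg hM he o hT
    exact ⟨Pi.single o 1, by simp, Q₀, fun Q hQ x hdet hx => absurd hx (hQ₀ Q hQ x hdet)⟩
  push Not at hT
  obtain ⟨w, hw, hw0⟩ := hT
  let μ : ι → ℝ := fun i => ∑ k, w k * M⁻¹ k i
  have hlim : Filter.Tendsto (fun Q : ℝ => ∑ i, |μ i| * if 0 ≤ e i then 0 else Q ^ e i)
      Filter.atTop (nhds (∑ i : ι, 0)) := by
    refine tendsto_finsetSum _ fun i _ => ?_
    by_cases hi : 0 ≤ e i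
    · simp [hi]
    · simp only [hi, if_false]
      have := tendsto_rpow_neg_atTop (y := -e i) (by linarith)
      rw [neg_neg] at this
      simpa using this.const_mul |μ i|
  rw [Finset.sum_const_zero] at hlim
  obtain ⟨Q₀, hQ₀⟩ := Filter.eventually_atTop.1 (hlim.eventually_lt_const one_pos)
  refine ⟨w, hw0, Q₀, fun Q hQ x _ hx j hj => ?_⟩
  have hid : ((∑ k, w k * x j k : ℤ) : ℝ) = ∑ i, μ i * ∑ k, M i k * x j k := by
    have h1 : Matrix.vecMul (fun k => (w k : ℝ)) (M⁻¹ * M) ⬝ᵥ (fun k => (x j k : ℝ)) =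
        ∑ i, μ i * ∑ k, M i k * x j k := by
      rw [← Matrix.vecMul_vecMul, ← Matrix.dotProduct_mulVec]
      rfl
    rw [← h1, Matrix.nonsing_inv_mul _ (isUnit_iff_ne_zero.2 hM), Matrix.vecMul_one]
    simp [dotProduct]
  have hlt : |((∑ k, w k * x j k : ℤ) : ℝ)| < 1 := by
    rw [hid]
    refine ((Finset.abs_sum_le_sum_abs _ _).trans (Finset.sum_le_sum fun i _ => ?_)).trans_lt
      (hQ₀ Q hQ)
    rw [abs_mul]
    by_cases hi : 0 ≤ e i
    · have : μ i = 0 := hw i hi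
      simp [this]
    · simp only [hi, if_false]
      exact mul_le_mul_of_nonneg_left (hx j i hj) (abs_nonneg _)
  exact Int.abs_lt_one_iff.1 (by exact_mod_cast hlt)

end

end SchmidtSubspace

namespace SchmidtSubspace

/-- Gaussian elimination with partial pivoting. -/
lemma exists_lu (n : ℕ) (Y : Matrix (Fin n) (Fin n) ℝ) :
    ∃ (σ : Equiv.Perm (Fin n)) (L U : Matrix (Fin n) (Fin n) ℝ),
      (∀ i, L i i = 1) ∧ (∀ i l, i < l → L i l = 0) ∧ (∀ i l, |L i l| ≤ 1) ∧
      (∀ l j, j < l → U l j = 0) ∧ Y.submatrix σ id = L * U := by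
  induction n with
  | zero => exact ⟨1, 0, 0, fun i => i.elim0, fun i => i.elim0, fun i => i.elim0,
      fun i => i.elim0, by ext i; exact i.elim0⟩
  | succ n ih =>
    obtain ⟨a, -, ha⟩ := Finset.exists_max_image (Finset.univ : Finset (Fin (n + 1)))
      (fun i => |Y i 0|) Finset.univ_nonempty
    let τ : Equiv.Perm (Fin (n + 1)) := Equiv.swap 0 a
    let q : Fin n → ℝ := fun i => Y (τ i.succ) 0 / Y a 0
    have hq : ∀ i, |q i| ≤ 1 := fun i => by
      rw [abs_div]
      exact div_le_one_of_le₀ (ha _ (Finset.mem_univ _)) (abs_nonneg _)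
    have hqa : ∀ i, q i * Y a 0 = Y (τ i.succ) 0 := fun i => by
      by_cases h0 : Y a 0 = 0
      · have := ha (τ i.succ) (Finset.mem_univ _)
        rw [h0, abs_zero] at this
        rw [h0, mul_zero, abs_eq_zero.1 (le_antisymm this (abs_nonneg _))]
      · exact div_mul_cancel₀ _ h0
    obtain ⟨σ, L, U, hL1, hL0, hLb, hU0, hLU⟩ :=
      ih (Matrix.of fun i j => Y (τ i.succ) j.succ - q i * Y a j.succ)
    have hLU' : ∀ i j, Y (τ (σ i).succ) j.succ - q (σ i) * Y a j.succ = ∑ l, L i l * U l j :=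
      fun i j => by
        have := congrFun (congrFun hLU i) j
        rw [Matrix.mul_apply] at this
        exact this
    refine ⟨(Equiv.Perm.decomposeFin.symm (0, σ)).trans τ,
      Matrix.of (Fin.cons (Fin.cons 1 0) fun i => Fin.cons (q (σ i)) (L i)),
      Matrix.of (Fin.cons (Y a) fun l => Fin.cons 0 (U l)), ?_, ?_, ?_, ?_, ?_⟩
    · intro i
      refine Fin.cases ?_ (fun i => ?_) i
      · simp
      · simpa using hL1 i
    · intro i l hil
      obtain ⟨l, rfl⟩ := Fin.exists_succ_eq.2 (Fin.ne_zero_of_lt hil)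
      refine Fin.cases (fun _ => ?_) (fun i hil => ?_) i hil
      · simp
      · simpa using hL0 i l (Fin.succ_lt_succ_iff.1 hil)
    · intro i l
      refine Fin.cases ?_ (fun i => ?_) i
      · refine Fin.cases ?_ (fun l => ?_) l <;> simp
      · refine Fin.cases ?_ (fun l => ?_) l
        · simpa using hq (σ i)
        · simpa using hLb i l
    · intro l j hjl
      obtain ⟨l, rfl⟩ := Fin.exists_succ_eq.2 (Fin.ne_zero_of_lt hjl)
      refine Fin.cases (fun _ => ?_) (fun j hjl => ?_) j hjl
      · simp
      · simpa using hU0 l j (Fin.succ_lt_succ_iff.1 hjl)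
    · ext i j
      rw [Matrix.mul_apply, Fin.sum_univ_succ]
      refine Fin.cases ?_ (fun i => ?_) i
      · simp [τ]
      · refine Fin.cases ?_ (fun j => ?_) j
        · simp [hqa]
        · simp [← hLU']

/-- A triangular change of coordinates with bounded entries has bounded inverse. -/
lemma abs_le_of_unitriangular {n : ℕ} {L : Matrix (Fin n) (Fin n) ℝ} (hL1 : ∀ i, L i i = 1)
    (hL0 : ∀ i l, i < l → L i l = 0) (hLb : ∀ i l, |L i l| ≤ 1) {z : Fin n → ℝ} {g : ℝ}
    (hz : ∀ i, |∑ l, L i l * z l| ≤ g) (i : Fin n) : |z i| ≤ 2 ^ (i : ℕ) * g := by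
  obtain ⟨k, hk⟩ := i
  induction k using Nat.strong_induction_on with
  | _ k ih =>
    have hsplit : ∑ l, L ⟨k, hk⟩ l * z l =
        z ⟨k, hk⟩ + ∑ l ∈ Finset.Iio (⟨k, hk⟩ : Fin n), L ⟨k, hk⟩ l * z l := by
      rw [← Finset.sum_subset (Finset.subset_univ (Finset.Iic (⟨k, hk⟩ : Fin n))),
        ← Finset.Iio_insert, Finset.sum_insert (by simp), hL1, one_mul]
      intro l _ hl
      rw [hL0 _ _ (by simpa using hl), zero_mul]
    have hsum : |∑ l ∈ Finset.Iio (⟨k, hk⟩ : Fin n), L ⟨k, hk⟩ l * z l| ≤ (2 ^ k - 1) * g := by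
      calc _ ≤ ∑ l ∈ Finset.Iio (⟨k, hk⟩ : Fin n), |L ⟨k, hk⟩ l * z l| :=
            Finset.abs_sum_le_sum_abs _ _
        _ ≤ ∑ l ∈ Finset.Iio (⟨k, hk⟩ : Fin n), 2 ^ (l : ℕ) * g := by
            refine Finset.sum_le_sum fun l hl => ?_
            rw [abs_mul]
            exact (mul_le_of_le_one_left (abs_nonneg _) (hLb _ _)).trans
              (ih l (Fin.lt_def.1 (Finset.mem_Iio.1 hl)) l.2)
        _ = ∑ l ∈ Finset.range k, 2 ^ l * g := by
            refine Finset.sum_bij (fun l _ => (l : ℕ)) ?_ ?_ ?_ ?_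
            · intro l hl
              exact Finset.mem_range.2 (Fin.lt_def.1 (Finset.mem_Iio.1 hl))
            · intro a _ b _ h
              exact Fin.ext h
            · intro b hb
              have hbk : b < k := Finset.mem_range.1 hb
              exact ⟨⟨b, hbk.trans hk⟩, by simpa using hbk, rfl⟩
            · intros; rfl
        _ = (2 ^ k - 1) * g := by
            rw [← Finset.sum_mul, geom_sum_eq (by norm_num)]
            norm_num
    have h := hz ⟨k, hk⟩
    rw [hsplit] at h
    rw [abs_le] at h hsum ⊢
    constructor <;> nlinarith [h.1, h.2, hsum.1, hsum.2]

/-- Minkowski's theorem on linear forms, with a crude constant. -/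
lemma prod_le_of_forall_int {n : ℕ} (F : Matrix (Fin n) (Fin n) ℝ) (hF : F.det ≠ 0)
    {b : Fin n → ℝ} (hb : ∀ l, 0 < b l)
    (h : ∀ y : Fin n → ℤ, y ≠ 0 → ∃ l, b l ≤ |∑ k, F l k * y k|) :
    ∏ l, b l ≤ |F.det| := by
  classical
  by_contra! hlt
  let E := Fin n → ℝ
  let bas : Module.Basis (Fin n) ℝ E := Pi.basisFun ℝ (Fin n)
  let s : Set E := (Matrix.toLin' F) ⁻¹' (Set.univ.pi fun l => Set.Ioo (-b l) (b l))
  have hdet : LinearMap.det (Matrix.toLin' F) = F.det := LinearMap.det_toLin' F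
  have hvol : MeasureTheory.volume s =
      ENNReal.ofReal (|F.det|⁻¹) * ENNReal.ofReal (∏ l, (2 * b l)) := by
    rw [MeasureTheory.Measure.addHaar_preimage_linearMap _ (by rwa [hdet]), hdet, abs_inv,
      Real.volume_pi_Ioo, ENNReal.ofReal_prod_of_nonneg fun l _ => by linarith [hb l]]
    congr 2 with l
    congr 1
    ring
  have hfund := ZSpan.isAddFundamentalDomain' bas
    (MeasureTheory.volume : MeasureTheory.Measure E)
  have hF1 : MeasureTheory.volume (ZSpan.fundamentalDomain bas) = 1 := by
    rw [ZSpan.fundamentalDomain_pi_basisFun, MeasureTheory.volume_pi, MeasureTheory.Measure.pi_pi]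
    simp
  have : Countable (Submodule.span ℤ (Set.range bas)).toAddSubgroup :=
    inferInstanceAs (Countable (Submodule.span ℤ (Set.range bas)))
  have hbpos : (0 : ℝ) < |F.det| := abs_pos.2 hF
  obtain ⟨⟨x, hx⟩, hx0, hxs⟩ :=
    MeasureTheory.exists_ne_zero_mem_lattice_of_measure_mul_two_pow_lt_measure
      (s := s) hfund (by
        intro x hx l hl
        have := hx l hl
        rw [map_neg]
        simp only [Set.mem_Ioo, Pi.neg_apply] at this ⊢
        constructor <;> linarith [this.1, this.2])
      (Convex.linear_preimage (convex_pi fun l _ => convex_Ioo _ _) _) (by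
        rw [hF1, hvol, one_mul, ← ENNReal.ofReal_mul (by positivity), Finset.prod_mul_distrib]
        have h2 : (2 : ENNReal) ^ Module.finrank ℝ E = ENNReal.ofReal (2 ^ n) := by
          rw [ENNReal.ofReal_pow (by norm_num)]
          simp [E]
        rw [h2]
        refine (ENNReal.ofReal_lt_ofReal_iff' ).2 ⟨?_, ?_⟩
        · simp only [Finset.prod_const, Finset.card_univ, Fintype.card_fin]
          rw [← div_eq_inv_mul, lt_div_iff₀ hbpos]
          exact mul_lt_mul_of_pos_left hlt (by positivity)
        · have : 0 < ∏ l, b l := Finset.prod_pos fun l _ => hb l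
          positivity)
  have hx' : x ∈ Submodule.span ℤ (Set.range bas) := hx
  rw [bas.mem_span_iff_repr_mem ℤ] at hx'
  choose y hy using hx'
  have hxy : ∀ k, x k = y k := fun k => by
    have := (hy k).symm
    rw [Pi.basisFun_repr] at this
    exact this
  obtain ⟨l, hl⟩ := h y (by
    rintro rfl
    refine hx0 (Subtype.ext (funext fun k => ?_))
    exact (hxy k).trans Int.cast_zero)
  have hxl := hxs l (Set.mem_univ l)
  rw [Set.mem_Ioo, ← abs_lt, Matrix.toLin'_apply, Matrix.mulVec, dotProduct] at hxl
  simp only [hxy] at hxl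
  exact absurd hxl (not_lt.2 hl)

end SchmidtSubspace

namespace SchmidtSubspace

/-- An integer vector, viewed as a real one. -/
def realVec {ι : Type*} (y : ι → ℤ) : ι → ℝ := fun k => y k

lemma realVec_ne_zero {ι : Type*} {y : ι → ℤ} (hy : y ≠ 0) : realVec y ≠ 0 := fun h =>
  hy (funext fun k => by simpa [realVec] using congrFun h k)

/-- Among the integer points outside a proper subspace, one is shortest. -/
lemma exists_shortest_not_mem {n : ℕ} {A : Matrix (Fin n) (Fin n) ℝ} (hA : A.det ≠ 0)
    {W : Submodule ℝ (Fin n → ℝ)} (hW : W ≠ ⊤) :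
    ∃ x : Fin n → ℤ, realVec x ∉ W ∧
      ∀ y : Fin n → ℤ, realVec y ∉ W → ‖A.mulVec (realVec x)‖ ≤ ‖A.mulVec (realVec y)‖ := by
  classical
  obtain ⟨y₀, hy₀⟩ : ∃ y : Fin n → ℤ, realVec y ∉ W := by
    by_contra! hall
    refine hW (eq_top_iff.2 ?_)
    rw [← (Pi.basisFun ℝ (Fin n)).span_eq, Submodule.span_le]
    rintro _ ⟨i, rfl⟩
    have hi : Pi.basisFun ℝ (Fin n) i = realVec (Pi.single i 1) := by
      ext k
      simp only [Pi.basisFun_apply, realVec, Pi.single_apply]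
      split_ifs <;> simp
    rw [hi]
    exact hall _
  have hfin : {y : Fin n → ℤ | ‖A.mulVec (realVec y)‖ ≤ ‖A.mulVec (realVec y₀)‖}.Finite := by
    let B := (Matrix.toLin' A⁻¹).toContinuousLinearMap
    obtain ⟨N, hN⟩ := exists_nat_ge (‖B‖ * ‖A.mulVec (realVec y₀)‖)
    refine (Set.Finite.pi' fun _ : Fin n => Set.finite_Icc (-(N : ℤ)) N).subset fun y hy k => ?_
    have h1 : realVec y = B (A.mulVec (realVec y)) := by
      have : A⁻¹.mulVec (A.mulVec (realVec y)) = realVec y := by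
        rw [Matrix.mulVec_mulVec, Matrix.nonsing_inv_mul _ (isUnit_iff_ne_zero.2 hA),
          Matrix.one_mulVec]
      exact this.symm
    have h2 : |(y k : ℝ)| ≤ N := calc
      |(y k : ℝ)| ≤ ‖realVec y‖ := norm_le_pi_norm (realVec y) k
      _ = ‖B (A.mulVec (realVec y))‖ := by rw [← h1]
      _ ≤ ‖B‖ * ‖A.mulVec (realVec y)‖ := B.le_opNorm _
      _ ≤ ‖B‖ * ‖A.mulVec (realVec y₀)‖ := mul_le_mul_of_nonneg_left hy (norm_nonneg _)
      _ ≤ N := hN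
    rw [abs_le] at h2
    exact ⟨by exact_mod_cast h2.1, by exact_mod_cast h2.2⟩
  have hfin' := hfin.subset (Set.inter_subset_left (t := {y : Fin n → ℤ | realVec y ∉ W}))
  obtain ⟨x, hx, hmin⟩ := Set.exists_min_image _ (fun y => ‖A.mulVec (realVec y)‖) hfin'
    ⟨y₀, le_refl ‖A.mulVec (realVec y₀)‖, hy₀⟩
  refine ⟨x, hx.2, fun y hy => ?_⟩
  rcases le_total ‖A.mulVec (realVec y)‖ ‖A.mulVec (realVec y₀)‖ with h | h
  · exact hmin y ⟨h, hy⟩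
  · exact le_trans hx.1 h

/-- Integer points realising the successive minima. -/
lemma exists_successive_minima {n : ℕ} {A : Matrix (Fin n) (Fin n) ℝ} (hA : A.det ≠ 0) :
    ∃ x : Fin n → Fin n → ℤ, LinearIndependent ℝ (fun j => realVec (x j)) ∧
      ∀ (j : Fin n) (y : Fin n → ℤ),
        realVec y ∉ Submodule.span ℝ ((fun j => realVec (x j)) '' Set.Iio j) →
        ‖A.mulVec (realVec (x j))‖ ≤ ‖A.mulVec (realVec y)‖ := by
  classical
  choose! g hg hmin using fun (W : Submodule ℝ (Fin n → ℝ)) (hW : W ≠ ⊤) =>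
    exists_shortest_not_mem hA hW
  let W : ℕ → Submodule ℝ (Fin n → ℝ) :=
    fun k => Nat.rec ⊥ (fun _ W => Submodule.span ℝ {realVec (g W)} ⊔ W) k
  let x : ℕ → Fin n → ℤ := fun k => g (W k)
  have hW : ∀ k, W k = Submodule.span ℝ (Set.range fun i : Fin k => realVec (x i)) := by
    intro k
    induction k with
    | zero => simp [W]
    | succ k ih =>
      have : Set.range (fun i : Fin (k + 1) => realVec (x i)) =
          insert (realVec (x k)) (Set.range fun i : Fin k => realVec (x i)) := by
        ext z
        simp only [Set.mem_range, Set.mem_insert_iff, Fin.exists_fin_succ', Fin.val_castSucc,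
          Fin.val_last]
        tauto
      rw [this, Submodule.span_insert, ← ih]
  have htop : ∀ k < n, W k ≠ ⊤ := fun k hk h => by
    have h1 := finrank_range_le_card (R := ℝ) (b := fun i : Fin k => realVec (x i))
    rw [Set.finrank, ← hW, h, finrank_top] at h1
    simp at h1
    omega
  have hli : ∀ k ≤ n, LinearIndependent ℝ (fun i : Fin k => realVec (x i)) := by
    intro k
    induction k with
    | zero => exact fun _ => linearIndependent_empty_type
    | succ k ih =>
      intro hk
      rw [linearIndependent_finSucc']
      refine ⟨ih (by omega), ?_⟩
      have h1 := hg (W k) (htop k hk)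
      intro h2
      exact h1 ((hW k).ge h2)
  refine ⟨fun j => x j, hli n le_rfl, fun j y hy => ?_⟩
  refine hmin (W j) (htop j j.2) y ?_
  convert hy
  rw [hW]
  congr 1
  ext z
  constructor
  · rintro ⟨i, rfl⟩
    exact ⟨⟨i, i.2.trans j.2⟩, i.2, rfl⟩
  · rintro ⟨i, hi, rfl⟩
    exact ⟨⟨i, hi⟩, rfl⟩

/-- Rounding a vector modulo a triangular lattice. -/
lemma exists_rounding {n : ℕ} {U : Matrix (Fin n) (Fin n) ℝ} (hU0 : ∀ l j, j < l → U l j = 0)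
    (hU : ∀ l, U l l ≠ 0) (k : ℕ) (z : Fin n → ℝ) :
    ∃ a : Fin n → ℤ, (∀ l : Fin n, k ≤ l → a l = 0) ∧
      ∀ i : Fin n, (i : ℕ) < k → |z i - ∑ l, a l * U i l| ≤ |U i i| := by
  induction k generalizing z with
  | zero => exact ⟨0, fun _ _ => rfl, fun i hi => absurd hi (Nat.not_lt_zero _)⟩
  | succ k ih =>
    by_cases hk : k < n
    · obtain ⟨t, ht⟩ : ∃ t : ℤ, t = round (z ⟨k, hk⟩ / U ⟨k, hk⟩ ⟨k, hk⟩) := ⟨_, rfl⟩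
      obtain ⟨a, ha0, ha⟩ := ih fun i => z i - t * U i ⟨k, hk⟩
      have hsum : ∀ i, ∑ l, ((a + Pi.single (⟨k, hk⟩ : Fin n) t : Fin n → ℤ) l : ℝ) * U i l =
          ∑ l, a l * U i l + t * U i ⟨k, hk⟩ := fun i => by
        simp only [Pi.add_apply, Int.cast_add, add_mul, Finset.sum_add_distrib]
        congr 1
        rw [Finset.sum_eq_single ⟨k, hk⟩ (fun b _ hb => by simp [Pi.single_eq_of_ne hb])
          (fun h => absurd (Finset.mem_univ _) h)]
        simp
      refine ⟨a + Pi.single ⟨k, hk⟩ t, fun l hl => ?_, fun i hi => ?_⟩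
      · have : l ≠ ⟨k, hk⟩ := fun h => by
          rw [h] at hl
          simp at hl
        simp [ha0 l (by omega), Pi.single_eq_of_ne this]
      · rw [hsum]
        rcases Nat.lt_succ_iff_lt_or_eq.1 hi with h | h
        · convert ha i h using 2
          ring
        · obtain rfl : i = ⟨k, hk⟩ := Fin.ext h
          have h0 : ∑ l, (a l : ℝ) * U ⟨k, hk⟩ l = 0 := Finset.sum_eq_zero fun l _ => by
            rcases lt_or_ge (l : ℕ) k with hl | hl
            · rw [hU0 ⟨k, hk⟩ l hl, mul_zero]
            · rw [ha0 l hl]; simp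
          rw [h0, zero_add]
          have h1 := abs_sub_round (z ⟨k, hk⟩ / U ⟨k, hk⟩ ⟨k, hk⟩)
          rw [← ht] at h1
          have h2 : z ⟨k, hk⟩ - t * U ⟨k, hk⟩ ⟨k, hk⟩ =
              (z ⟨k, hk⟩ / U ⟨k, hk⟩ ⟨k, hk⟩ - t) * U ⟨k, hk⟩ ⟨k, hk⟩ := by
            field_simp [hU ⟨k, hk⟩]
          rw [h2, abs_mul]
          exact mul_le_of_le_one_left (abs_nonneg _) (h1.trans (by norm_num))
    · obtain ⟨a, ha0, ha⟩ := ih z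
      exact ⟨a, fun l hl => ha0 l (by omega), fun i _ => ha i (by omega)⟩

/-- A basis adapted to the successive minima of a parallelepiped. -/
theorem exists_reduced_basis (n : ℕ) : ∃ C : ℝ, 1 ≤ C ∧
    ∀ A : Matrix (Fin n) (Fin n) ℝ, A.det ≠ 0 →
      ∃ (u : Matrix (Fin n) (Fin n) ℤ) (b : Fin n → ℝ) (σ : Equiv.Perm (Fin n)),
        u.det ≠ 0 ∧ Monotone b ∧
        (∀ j i, |A.mulVec (realVec (u j)) (σ i)| ≤ C * b (min i j)) ∧
        ∏ l, b l ≤ C * |A.det| ∧ |A.det| ≤ C * ∏ l, b l ∧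
        (∀ j (y : Fin n → ℤ), ‖A.mulVec (realVec y)‖ < b j →
          realVec y ∈ Submodule.span ℝ ((fun j => realVec (u j)) '' Set.Iio j)) ∧
        ∀ j, ∃ y : Fin n → ℤ, y ≠ 0 ∧ b j = ‖A.mulVec (realVec y)‖ := by
  classical
  refine ⟨(n : ℝ) ^ n + n * 2 ^ n + (2 ^ n) ^ n, ?_, fun A hA => ?_⟩
  · have : (1 : ℝ) ≤ (2 ^ n) ^ n := one_le_pow₀ (one_le_pow₀ (by norm_num))
    have : (0 : ℝ) ≤ (n : ℝ) ^ n + n * 2 ^ n := by positivity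
    linarith
  obtain ⟨x, hli, hmin⟩ := exists_successive_minima hA
  obtain ⟨X, hX⟩ : ∃ X : Matrix (Fin n) (Fin n) ℝ, X = Matrix.of fun k j => realVec (x j) k :=
    ⟨_, rfl⟩
  obtain ⟨σ, L, U, hL1, hL0, hLb, hU0, hLU⟩ := exists_lu n (A * X)
  obtain ⟨b, hb⟩ : ∃ b : Fin n → ℝ, ∀ j, b j = ‖A.mulVec (realVec (x j))‖ := ⟨_, fun _ => rfl⟩
  have hLdet : L.det = 1 := by
    rw [Matrix.det_of_isLowerTriangular L fun i j h => hL0 i j h]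
    simp [hL1]
  have hLunit : IsUnit L.det := by rw [hLdet]; exact isUnit_one
  obtain ⟨F, hF⟩ : ∃ F : Matrix (Fin n) (Fin n) ℝ, F = L⁻¹ * A.submatrix σ id := ⟨_, rfl⟩
  have hLF : L * F = A.submatrix σ id := by
    rw [hF, ← Matrix.mul_assoc, Matrix.mul_nonsing_inv _ hLunit, Matrix.one_mul]
  have hFX : F * X = U := by
    have h1 : A.submatrix σ id * X = L * U := by
      rw [← hLU]
      rfl
    rw [hF, Matrix.mul_assoc, h1, ← Matrix.mul_assoc, Matrix.nonsing_inv_mul _ hLunit,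
      Matrix.one_mul]
  have hFdet : |F.det| = |A.det| := by
    have h1 := congrArg Matrix.det hLF
    rw [Matrix.det_mul, hLdet, one_mul, Matrix.det_permute] at h1
    rw [h1, abs_mul]
    rcases Int.units_eq_one_or (Equiv.Perm.sign σ) with h | h <;> simp [h]
  have hAF : ∀ (z : Fin n → ℝ) i, A.mulVec z (σ i) = ∑ l, L i l * F.mulVec z l := by
    intro z i
    have : (A.submatrix σ id).mulVec z i = (L.mulVec (F.mulVec z)) i := by
      rw [Matrix.mulVec_mulVec, hLF]
    exact this
  have hFA : ∀ (z : Fin n → ℝ) i, |F.mulVec z i| ≤ 2 ^ n * ‖A.mulVec z‖ := by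
    intro z i
    refine (abs_le_of_unitriangular hL1 hL0 hLb (z := F.mulVec z) (fun i => ?_) i).trans
      (mul_le_mul_of_nonneg_right (pow_le_pow_right₀ (by norm_num) i.2.le) (norm_nonneg _))
    rw [← hAF]
    exact norm_le_pi_norm (A.mulVec z) (σ i)
  have hFx : ∀ j, F.mulVec (realVec (x j)) = fun l => U l j := by
    intro j
    ext l
    rw [← hFX, hX]
    rfl
  have hXdet : X.det ≠ 0 := by
    rw [← isUnit_iff_ne_zero, ← Matrix.isUnit_iff_isUnit_det,
      ← Matrix.linearIndependent_cols_iff_isUnit, hX]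
    exact hli
  have hUdet : U.det ≠ 0 := by
    rw [← hFX, Matrix.det_mul]
    refine mul_ne_zero (fun h => hA ?_) hXdet
    rw [← abs_eq_zero, ← hFdet, h, abs_zero]
  have hUprod : U.det = ∏ l, U l l := Matrix.det_of_isUpperTriangular fun l j h => hU0 l j h
  have hUne : ∀ l, U l l ≠ 0 := fun l h =>
    hUdet (hUprod.trans (Finset.prod_eq_zero (Finset.mem_univ l) h))
  have hUb : ∀ l j, |U l j| ≤ 2 ^ n * b j := fun l j => by
    have := hFA (realVec (x j)) l
    rwa [hFx, ← hb] at this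
  have hbpos : ∀ l, 0 < b l := fun l => by
    have h1 := hUb l l
    have h2 := abs_pos.2 (hUne l)
    by_contra! h3
    nlinarith [pow_pos (zero_lt_two' ℝ) n]
  have hbmono : Monotone b := by
    intro i j hij
    rw [hb, hb]
    refine hmin i (x j) fun h => ?_
    refine (hli.notMem_span_image (s := Set.Iio i) (x := j) ?_) h
    exact fun h => absurd hij (not_le.2 h)
  choose a ha0 ha using fun j : Fin n => exists_rounding hU0 hUne j (fun l => U l j)
  obtain ⟨u, hu⟩ : ∃ u : Matrix (Fin n) (Fin n) ℤ, ∀ j, u j = x j - ∑ l, a j l • x l :=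
    ⟨fun j => x j - ∑ l, a j l • x l, fun _ => rfl⟩
  have hur : ∀ j, realVec (u j) = realVec (x j) - ∑ l, (a j l : ℝ) • realVec (x l) := by
    intro j
    ext k
    simp [realVec, hu, Finset.sum_apply]
  have hFu : ∀ j l, F.mulVec (realVec (u j)) l = U l j - ∑ i, a j i * U l i := by
    intro j l
    rw [hur, Matrix.mulVec_sub, Matrix.mulVec_sum]
    simp only [Matrix.mulVec_smul, hFx, Pi.sub_apply, Finset.sum_apply, Pi.smul_apply, smul_eq_mul]
  have hFu0 : ∀ j l, j < l → F.mulVec (realVec (u j)) l = 0 := by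
    intro j l hjl
    rw [hFu, hU0 l j hjl, zero_sub, neg_eq_zero]
    refine Finset.sum_eq_zero fun i _ => ?_
    rcases lt_or_ge i j with h | h
    · rw [hU0 l i (h.trans hjl), mul_zero]
    · rw [ha0 j i h]; simp
  have hFub : ∀ j l, l ≤ j → |F.mulVec (realVec (u j)) l| ≤ 2 ^ n * b l := by
    intro j l hlj
    rw [hFu]
    rcases lt_or_eq_of_le hlj with h | rfl
    · exact (ha j l h).trans (hUb l l)
    · rw [Finset.sum_eq_zero, sub_zero]
      · exact hUb l l
      · intro i _
        rcases lt_or_ge i l with h | h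
        · rw [hU0 l i h, mul_zero]
        · rw [ha0 l i h]; simp
  have hxu : ∀ S : Set (Fin n), IsLowerSet S → ∀ i ∈ S, realVec (x i) ∈
      Submodule.span ℝ ((fun j => realVec (u j)) '' S) := by
    intro S hS i
    induction i using WellFoundedLT.induction with
    | _ i ih =>
      intro hij
      have h1 : realVec (x i) = realVec (u i) + ∑ l, (a i l : ℝ) • realVec (x l) := by
        rw [hur]; abel
      rw [h1]
      refine Submodule.add_mem _ (Submodule.subset_span ⟨i, hij, rfl⟩)
        (Submodule.sum_mem _ fun l _ => ?_)
      rcases lt_or_ge l i with h | h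
      · exact Submodule.smul_mem _ _ (ih l h (hS h.le hij))
      · rw [ha0 i l h]; simp
  have hudet : u.det ≠ 0 := by
    intro h
    have hind : LinearIndependent ℝ (fun j => realVec (u j)) := by
      refine linearIndependent_of_top_le_span_of_card_eq_finrank ?_ (by simp)
      rw [← hli.span_eq_top_of_card_eq_finrank' (by simp), Submodule.span_le]
      rintro _ ⟨i, rfl⟩
      rw [← Set.image_univ]
      exact hxu _ isLowerSet_univ i trivial
    have h1 : IsUnit (u.map (Int.cast : ℤ → ℝ)) := by
      rw [← Matrix.linearIndependent_rows_iff_isUnit]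
      exact hind
    rw [Matrix.isUnit_iff_isUnit_det, isUnit_iff_ne_zero] at h1
    refine h1 ?_
    have := (Int.castRingHom ℝ).map_det u
    rw [h, map_zero] at this
    exact this.symm
  refine ⟨u, b, σ, hudet, hbmono, fun j i => ?_, ?_, ?_, fun j y hy => ?_, fun j =>
    ⟨x j, fun h => ?_, hb j⟩⟩
  · rw [hAF]
    calc |∑ l, L i l * F.mulVec (realVec (u j)) l|
        ≤ ∑ l, |L i l * F.mulVec (realVec (u j)) l| := Finset.abs_sum_le_sum_abs _ _
      _ ≤ ∑ _l : Fin n, 2 ^ n * b (min i j) := Finset.sum_le_sum fun l _ => by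
          have hnn : 0 ≤ 2 ^ n * b (min i j) := mul_nonneg (by positivity) (hbpos _).le
          rcases lt_or_ge i l with hil | hil
          · rwa [hL0 i l hil, zero_mul, abs_zero]
          rcases lt_or_ge j l with hjl | hjl
          · rwa [hFu0 j l hjl, mul_zero, abs_zero]
          rw [abs_mul]
          refine (mul_le_of_le_one_left (abs_nonneg _) (hLb _ _)).trans ((hFub j l hjl).trans ?_)
          exact mul_le_mul_of_nonneg_left (hbmono (le_min hil hjl)) (by positivity)
      _ = (n * 2 ^ n) * b (min i j) := by simp [mul_assoc]
      _ ≤ _ := by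
          refine mul_le_mul_of_nonneg_right ?_ (hbpos _).le
          have h1 : (0 : ℝ) ≤ (n : ℝ) ^ n := by positivity
          have h2 : (0 : ℝ) ≤ (2 ^ n) ^ n := by positivity
          linarith
  · have hmink : ∏ l, b l / n ≤ |F.det| := by
      refine prod_le_of_forall_int F (fun h => hA ?_)
        (fun l => div_pos (hbpos l) (Nat.cast_pos.2 l.pos)) fun y hy => ?_
      · rw [← abs_eq_zero, ← hFdet, h, abs_zero]
      by_contra! hlt
      have hlt' : ∀ l, |F.mulVec (realVec y) l| < b l / n := hlt
      have hne : ∃ l, F.mulVec (realVec y) l ≠ 0 := by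
        by_contra! h0
        refine realVec_ne_zero hy (Matrix.eq_zero_of_mulVec_eq_zero (M := F) (fun h => hA ?_)
          (funext h0))
        rw [← abs_eq_zero, ← hFdet, h, abs_zero]
      obtain ⟨j, hj, hjmax⟩ := Finset.exists_max_image
        (Finset.univ.filter fun l => F.mulVec (realVec y) l ≠ 0) id
        (hne.imp fun l hl => Finset.mem_filter.2 ⟨Finset.mem_univ _, hl⟩)
      have hjne := (Finset.mem_filter.1 hj).2
      have hnpos : (0 : ℝ) < n := Nat.cast_pos.2 j.pos
      have h1 : b j ≤ ‖A.mulVec (realVec y)‖ := by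
        rw [hb]
        refine hmin j y fun hmem => hjne ?_
        have hle : Submodule.span ℝ ((fun j => realVec (x j)) '' Set.Iio j) ≤
            LinearMap.ker ((LinearMap.proj j).comp (Matrix.mulVecLin F)) := by
          rw [Submodule.span_le]
          rintro _ ⟨i, hi, rfl⟩
          have : F.mulVec (realVec (x i)) j = 0 :=
            (congrFun (hFx i) j).trans (hU0 j i hi)
          exact this
        exact hle hmem
      have h2 : ‖A.mulVec (realVec y)‖ < b j := by
        rw [pi_norm_lt_iff (hbpos j)]
        intro i'
        obtain ⟨i, rfl⟩ := σ.surjective i'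
        rw [hAF, Real.norm_eq_abs]
        calc |∑ l, L i l * F.mulVec (realVec y) l|
            ≤ ∑ l, |L i l * F.mulVec (realVec y) l| := Finset.abs_sum_le_sum_abs _ _
          _ < ∑ _l : Fin n, b j / n := by
            refine Finset.sum_lt_sum_of_nonempty ⟨j, Finset.mem_univ j⟩ fun l _ => ?_
            rw [abs_mul]
            refine (mul_le_of_le_one_left (abs_nonneg _) (hLb _ _)).trans_lt ?_
            rcases le_or_gt l j with hlj | hlj
            · exact (hlt' l).trans_le (div_le_div_of_nonneg_right (hbmono hlj) hnpos.le)
            · have : F.mulVec (realVec y) l = 0 := by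
                by_contra h
                exact absurd (hjmax l (Finset.mem_filter.2 ⟨Finset.mem_univ _, h⟩))
                  (not_le.2 hlj)
              rw [this, abs_zero]
              exact div_pos (hbpos j) hnpos
          _ = b j := by
            simp only [Finset.sum_const, Finset.card_univ, Fintype.card_fin, nsmul_eq_mul]
            field_simp
      exact absurd h1 (not_le.2 h2)
    rw [Finset.prod_div_distrib, hFdet] at hmink
    simp only [Finset.prod_const, Finset.card_univ, Fintype.card_fin] at hmink
    have hn : (0 : ℝ) < (n : ℝ) ^ n := by
      rcases Nat.eq_zero_or_pos n with rfl | h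
      · simp
      · exact pow_pos (Nat.cast_pos.2 h) n
    rw [div_le_iff₀ hn, mul_comm] at hmink
    refine hmink.trans (mul_le_mul_of_nonneg_right ?_ (abs_nonneg _))
    have h1 : (0 : ℝ) ≤ n * 2 ^ n := by positivity
    have h2 : (0 : ℝ) ≤ (2 ^ n) ^ n := by positivity
    linarith
  · have hX1 : 1 ≤ |X.det| := by
      have h1 := (Int.castRingHom ℝ).map_det (Matrix.of fun k j => x j k)
      have h2 : (Int.castRingHom ℝ).mapMatrix (Matrix.of fun k j => x j k) = X := by
        rw [hX]; rfl
      rw [h2] at h1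
      rw [← h1] at hXdet ⊢
      have h3 : (Matrix.of fun k j => x j k).det ≠ 0 := fun h => hXdet (by rw [h, map_zero])
      have h4 := Int.one_le_abs h3
      simp only [eq_intCast]
      exact_mod_cast h4
    calc |A.det| = |F.det| * 1 := by rw [hFdet, mul_one]
      _ ≤ |F.det| * |X.det| := mul_le_mul_of_nonneg_left hX1 (abs_nonneg _)
      _ = ∏ l, |U l l| := by rw [← abs_mul, ← Matrix.det_mul, hFX, hUprod, Finset.abs_prod]
      _ ≤ ∏ l, (2 ^ n * b l) := Finset.prod_le_prod (fun _ _ => abs_nonneg _) fun l _ => hUb l l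
      _ = (2 ^ n) ^ n * ∏ l, b l := by rw [Finset.prod_mul_distrib]; simp
      _ ≤ _ := by
        refine mul_le_mul_of_nonneg_right ?_ (Finset.prod_nonneg fun l _ => (hbpos l).le)
        have h1 : (0 : ℝ) ≤ (n : ℝ) ^ n + n * 2 ^ n := by positivity
        linarith
  · have h1 : realVec y ∈ Submodule.span ℝ ((fun j => realVec (x j)) '' Set.Iio j) := by
      by_contra h
      rw [hb] at hy
      exact absurd hy (not_lt.2 (hmin j y h))
    refine (Submodule.span_le.2 ?_) h1
    rintro _ ⟨i, hi, rfl⟩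
    exact hxu _ (isLowerSet_Iio j) i hi
  · exact hli.ne_zero j (by rw [h]; ext; simp [realVec])

end SchmidtSubspace

namespace SchmidtSubspace

section Alternating

variable {R : Type*} [CommRing R] {n p : ℕ}

/-- An injective tuple is an increasing one up to a permutation. -/
lemma exists_orderEmbedding_comp_perm {v : Fin p → Fin n} (hv : Function.Injective v) :
    ∃ (T : Fin p ↪o Fin n) (τ : Equiv.Perm (Fin p)), v ∘ τ = T :=
  ⟨OrderEmbedding.ofStrictMono (v ∘ Tuple.sort v)
    ((Tuple.monotone_sort v).strictMono_of_injective (hv.comp (Tuple.sort v).injective)),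
    Tuple.sort v, rfl⟩

/-- An alternating map vanishes on a tuple of basis vectors if it does so on the sorted tuple. -/
lemma alternatingMap_eq_zero {M : Type*} [AddCommGroup M] [Module R M]
    (f : M [⋀^Fin p]→ₗ[R] R) (e : Fin n → M) {P : (Fin p → Fin n) → Prop}
    (hP : ∀ v τ, P v → P (v ∘ (τ : Equiv.Perm (Fin p))))
    (hf : ∀ T : Fin p ↪o Fin n, P T → f (e ∘ T) = 0) (v : Fin p → Fin n) (hv : P v) :
    f (e ∘ v) = 0 := by
  by_cases hinj : Function.Injective v
  · obtain ⟨T, τ, hT⟩ := exists_orderEmbedding_comp_perm hinj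
    have h1 := f.map_perm (e ∘ v) τ
    rw [Function.comp_assoc, hT, hf T (hT ▸ hP v τ hv)] at h1
    rcases Int.units_eq_one_or (Equiv.Perm.sign τ) with h | h <;> simpa [h] using h1.symm
  · exact f.map_eq_zero_of_not_injective _ fun h => hinj h.of_comp

/-- Alternating maps agreeing on increasing tuples of basis vectors are equal. -/
lemma alternatingMap_ext {M : Type*} [AddCommGroup M] [Module R M]
    {f g : M [⋀^Fin p]→ₗ[R] R} (e : Module.Basis (Fin n) R M)
    (h : ∀ T : Fin p ↪o Fin n, f (e ∘ T) = g (e ∘ T)) : f = g := by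
  refine e.ext_alternating fun v _ => sub_eq_zero.1 ?_
  exact alternatingMap_eq_zero (f - g) e (P := fun _ => True) (fun _ _ _ => trivial)
    (fun T _ => sub_eq_zero.2 (h T)) v trivial

lemma det_one_submatrix (S T : Fin p ↪o Fin n) [Decidable (S = T)] :
    ((1 : Matrix (Fin n) (Fin n) R).submatrix S T).det = if S = T then 1 else 0 := by
  split_ifs with h
  · rw [h, Matrix.submatrix_one _ T.injective, Matrix.det_one]
  · obtain ⟨a, ha⟩ : ∃ a, S a ∉ Set.range T := by
      by_contra! hall
      refine h (OrderEmbedding.range_inj.1 (Set.eq_of_subset_of_ncard_le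
        (Set.range_subset_iff.2 hall) ?_ (Set.finite_range _)))
      rw [Set.ncard_range_of_injective S.injective, Set.ncard_range_of_injective T.injective]
    refine Matrix.det_eq_zero_of_row_eq_zero a fun b => ?_
    rw [Matrix.submatrix_apply, Matrix.one_apply_ne]
    exact fun hab => ha ⟨b, hab.symm⟩

lemma alternatingMap_sum_apply {ι M : Type*} [Fintype ι] [AddCommGroup M] [Module R M]
    (f : ι → M [⋀^Fin p]→ₗ[R] R) (y : Fin p → M) : (∑ i, f i) y = ∑ i, f i y := by
  classical
  induction (Finset.univ : Finset ι) using Finset.induction_on with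
  | empty => rfl
  | insert i s hi ih => rw [Finset.sum_insert hi, Finset.sum_insert hi, AlternatingMap.add_apply, ih]

/-- The alternating map with given Plücker coordinates. -/
noncomputable def pluecker (w : (Fin p ↪o Fin n) → R) : (Fin n → R) [⋀^Fin p]→ₗ[R] R :=
  ∑ S, w S • (Matrix.detRowAlternating (n := Fin p) (R := R)).compLinearMap (LinearMap.funLeft R R S)

lemma pluecker_apply (w : (Fin p ↪o Fin n) → R) (y : Fin p → Fin n → R) :
    pluecker w y = ∑ S, w S * (Matrix.of fun a b => y a (S b)).det := by
  rw [pluecker, alternatingMap_sum_apply]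
  rfl

lemma pluecker_basisFun (w : (Fin p ↪o Fin n) → R) (T : Fin p ↪o Fin n) :
    pluecker w (Pi.basisFun R (Fin n) ∘ T) = w T := by
  classical
  rw [pluecker_apply]
  have h : ∀ S : Fin p ↪o Fin n,
      (Matrix.of fun a b => (Pi.basisFun R (Fin n) ∘ T) a (S b)).det = if T = S then 1 else 0 := by
    intro S
    rw [← det_one_submatrix (R := R)]
    congr 1
    ext a b
    simp [Matrix.one_apply, Pi.single_apply, eq_comm]
  simp only [h, mul_ite, mul_one, mul_zero, Finset.sum_ite_eq, Finset.mem_univ, if_true]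

/-- The Cauchy–Binet formula. -/
lemma det_sum_mul (A : Matrix (Fin p) (Fin n) R) (y : Fin p → Fin n → R) :
    (Matrix.of fun a b => ∑ k, A b k * y a k).det =
      ∑ S : Fin p ↪o Fin n, (A.submatrix id S).det * (Matrix.of fun a b => y a (S b)).det := by
  have h : (Matrix.detRowAlternating (n := Fin p) (R := R)).compLinearMap (Matrix.mulVecLin A) =
      pluecker fun S : Fin p ↪o Fin n => (A.submatrix id S).det := by
    refine alternatingMap_ext (Pi.basisFun R (Fin n)) fun T => ?_
    rw [pluecker_basisFun, ← Matrix.det_transpose, AlternatingMap.compLinearMap_apply]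
    change Matrix.det _ = _
    congr 1
    ext a b
    simp
  rw [← pluecker_apply, ← h]
  rfl

/-- The matrix of minors. -/
def compound (p : ℕ) (M : Matrix (Fin n) (Fin n) R) :
    Matrix (Fin p ↪o Fin n) (Fin p ↪o Fin n) R :=
  Matrix.of fun S T => (M.submatrix S T).det

lemma compound_mul (M N : Matrix (Fin n) (Fin n) R) :
    compound p (M * N) = compound p M * compound p N := by
  ext S T
  have h := det_sum_mul (M.submatrix S id) fun a k => N k (T a)
  rw [Matrix.mul_apply]
  calc compound p (M * N) S T = ((M * N).submatrix S T).transpose.det := (Matrix.det_transpose _).symm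
    _ = (Matrix.of fun a b => ∑ k, (M.submatrix S id) b k * N k (T a)).det := by
      congr 1
    _ = _ := h.trans (Finset.sum_congr rfl fun U _ => by
      congr 1
      rw [← Matrix.det_transpose]
      rfl)

lemma compound_one [DecidableEq (Fin p ↪o Fin n)] :
    compound p (1 : Matrix (Fin n) (Fin n) R) = 1 := by
  ext S T
  rw [Matrix.one_apply]
  exact det_one_submatrix S T

lemma compound_det_ne_zero [DecidableEq (Fin p ↪o Fin n)] {M : Matrix (Fin n) (Fin n) ℝ}
    (hM : M.det ≠ 0) : (compound p M).det ≠ 0 := by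
  intro h
  have h1 := congrArg Matrix.det (compound_mul (p := p) M M⁻¹)
  rw [Matrix.mul_nonsing_inv _ (isUnit_iff_ne_zero.2 hM), compound_one, Matrix.det_mul, h,
    zero_mul, Matrix.det_one] at h1
  exact one_ne_zero h1

lemma compound_int_det_ne_zero [DecidableEq (Fin p ↪o Fin n)] {u : Matrix (Fin n) (Fin n) ℤ}
    (hu : u.det ≠ 0) : (compound p u).det ≠ 0 := by
  have h1 : (u.map (Int.cast : ℤ → ℝ)).det ≠ 0 := by
    have := (Int.castRingHom ℝ).map_det u
    rw [eq_intCast] at this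
    intro h
    exact hu (by exact_mod_cast this.trans h)
  have h2 := compound_det_ne_zero (p := p) h1
  have h3 : compound p (u.map (Int.cast : ℤ → ℝ)) = (compound p u).map (Int.cast : ℤ → ℝ) := by
    ext S T
    exact ((Int.castRingHom ℝ).map_det (u.submatrix S T)).symm
  intro h
  refine h2 ?_
  rw [h3]
  have := (Int.castRingHom ℝ).map_det (compound p u)
  rw [h, map_zero] at this
  exact this.symm

end Alternating

/-- A hyperplane containing all but one of the decomposable `p`-vectors of a basis gives a
hyperplane containing the remaining basis vectors. -/
lemma exists_normal_of_compound {n q : ℕ} (w : (Fin (q + 1) ↪o Fin n) → ℤ) (hw : w ≠ 0) :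
    ∃ v : Fin n → ℤ, v ≠ 0 ∧ ∀ (u : Matrix (Fin n) (Fin n) ℤ) (o : Fin (q + 1) ↪o Fin n),
      u.det ≠ 0 → (∀ T, T ≠ o → ∑ S, w S * compound (q + 1) u T S = 0) →
      ∀ i, i ∉ Set.range o → ∑ k, v k * u i k = 0 := by
  classical
  obtain ⟨S₀, hS₀⟩ := Function.ne_iff.1 hw
  obtain ⟨Φ, hΦ⟩ : ∃ Φ : (Fin n → ℝ) [⋀^Fin (q + 1)]→ₗ[ℝ] ℝ,
    Φ = pluecker fun S => (w S : ℝ) := ⟨_, rfl⟩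
  let t : Fin q → Fin n → ℤ := fun a => Pi.single (S₀ a.succ) 1
  let v : Fin n → ℤ := fun k => pluecker w (Fin.cons (Pi.single k 1) t)
  have hcast : ∀ y : Fin (q + 1) → Fin n → ℤ,
      ((pluecker w y : ℤ) : ℝ) = Φ fun a => realVec (y a) := by
    intro y
    rw [hΦ, pluecker_apply, pluecker_apply]
    push_cast
    rfl
  have hsum : ∀ y : Fin n → ℤ, ∑ k, v k * y k = pluecker w (Fin.cons y t) := by
    intro y
    have h1 : y = ∑ k, y k • (Pi.single k 1 : Fin n → ℤ) := by
      ext l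
      simp [Finset.sum_apply, Pi.single_apply]
    have h2 : ∀ z, pluecker w (Fin.cons z t) = (pluecker w).curryLeft z t := fun z => rfl
    conv_rhs => rw [h2, h1, map_sum]
    rw [alternatingMap_sum_apply]
    refine Finset.sum_congr rfl fun k _ => ?_
    rw [map_smul, AlternatingMap.smul_apply, smul_eq_mul, mul_comm]
    rfl
  refine ⟨v, fun h => hS₀ ?_, fun u o hu hT i hi => ?_⟩
  · have h1 := pluecker_basisFun w S₀
    refine h1.symm.trans (Eq.trans ?_ (congrFun h (S₀ 0)))
    refine congrArg (pluecker w) ?_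
    ext a
    refine Fin.cases ?_ (fun a => ?_) a <;> simp [t]
  · rw [hsum]
    have hbas : ∀ y : Fin q → Fin n → ℝ, Φ (Fin.cons (realVec (u i)) y) = 0 := by
      have hind : LinearIndependent ℝ (fun j => realVec (u j)) := by
        have h1 : IsUnit (u.map (Int.cast : ℤ → ℝ)) := by
          rw [Matrix.isUnit_iff_isUnit_det, isUnit_iff_ne_zero]
          have := (Int.castRingHom ℝ).map_det u
          rw [eq_intCast] at this
          exact fun h => hu (by exact_mod_cast this.trans h)
        exact Matrix.linearIndependent_rows_iff_isUnit.2 h1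
      obtain ⟨e, he⟩ : ∃ e : Module.Basis (Fin n) ℝ (Fin n → ℝ), ∀ j, e j = realVec (u j) := by
        refine ⟨Module.Basis.mk hind ?_, fun j => Module.Basis.mk_apply _ _ _⟩
        rw [hind.span_eq_top_of_card_eq_finrank' (by simp)]
      have hzero : Φ.curryLeft (realVec (u i)) = 0 := by
        refine e.ext_alternating fun r _ => ?_
        have h1 := alternatingMap_eq_zero Φ (fun j => realVec (u j))
          (P := fun r => ∃ a, r a = i) ?_ ?_ (Fin.cons i r) ⟨0, rfl⟩
        · refine Eq.trans (congrArg Φ (funext fun a => ?_)) h1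
          refine Fin.cases ?_ (fun a => ?_) a
          · rfl
          · exact he (r a)
        · rintro r τ ⟨a, ha⟩
          exact ⟨τ.symm a, by simpa using ha⟩
        · rintro T ⟨a, ha⟩
          have h2 := hT T (by rintro rfl; exact hi ⟨a, ha⟩)
          have h3 := hcast (u ∘ T)
          rw [pluecker_apply] at h3
          refine h3.symm.trans ?_
          exact_mod_cast h2
      intro y
      exact congrArg (fun f => f y) hzero
    have h1 := hcast (Fin.cons (u i) t)
    have h2 : (fun a => realVec ((Fin.cons (u i) t : Fin (q + 1) → Fin n → ℤ) a)) =
        (Fin.cons (realVec (u i)) fun a => realVec (t a) : Fin (q + 1) → Fin n → ℝ) := by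
      funext a
      refine Fin.cases rfl (fun a => rfl) a
    rw [h2, hbas] at h1
    exact_mod_cast h1

/-- If all minors of the forms at a basis are small, with one set of rows of the basis omitted,
then the other vectors of the basis lie in a fixed rational hyperplane. -/
lemma exists_normal_of_minors {n q : ℕ} {M : Matrix (Fin n) (Fin n) ℝ}
    (halg : ∀ i j, IsAlgebraic ℚ (M i j)) (hM : M.det ≠ 0) (o : Fin (q + 1) ↪o Fin n)
    {e : (Fin (q + 1) ↪o Fin n) → ℝ} (he : ∑ S, e S < 0) :
    ∃ v : Fin n → ℤ, v ≠ 0 ∧ ∃ Q₀ : ℝ, ∀ Q ≥ Q₀, ∀ u : Matrix (Fin n) (Fin n) ℤ, u.det ≠ 0 →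
      (∀ T S, T ≠ o → |(Matrix.of fun a b => ∑ k, M (S b) k * u (T a) k).det| ≤ Q ^ e S) →
      ∀ i, i ∉ Set.range o → ∑ k, v k * u i k = 0 := by
  classical
  obtain ⟨w, hw, Q₀, hQ⟩ := exists_common_normal (M := compound (q + 1) M)
    (fun S T => isAlgebraic_det fun a b => halg _ _) (compound_det_ne_zero hM) he o
  obtain ⟨v, hv, h⟩ := exists_normal_of_compound w hw
  refine ⟨v, hv, Q₀, fun Q hQQ u hu hb => h u o hu ?_⟩
  refine hQ Q hQQ (compound (q + 1) u) (compound_int_det_ne_zero hu) fun T S hT => ?_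
  convert hb T S hT using 2
  have h1 := det_sum_mul (M.submatrix S id) fun a k => (u (T a) k : ℝ)
  refine Eq.trans ?_ h1.symm
  refine Finset.sum_congr rfl fun R _ => ?_
  congr 1
  exact (Int.castRingHom ℝ).map_det (u.submatrix T R)

end SchmidtSubspace

namespace SchmidtSubspace

lemma card_orderEmbedding_mem {p n : ℕ} (s : Finset (Fin n)) :
    (Finset.univ.filter fun S : Fin p ↪o Fin n => ∀ a, S a ∈ s).card = s.card.choose p := by
  classical
  rw [← Finset.card_powersetCard]
  refine Finset.card_bij (fun S _ => Finset.univ.map S.toEmbedding) ?_ ?_ ?_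
  · intro S hS
    rw [Finset.mem_powersetCard]
    refine ⟨fun i hi => ?_, by simp⟩
    obtain ⟨a, -, rfl⟩ := Finset.mem_map.1 hi
    exact (Finset.mem_filter.1 hS).2 a
  · intro S _ T _ h
    rw [← OrderEmbedding.range_inj]
    have := congrArg (fun t : Finset (Fin n) => (t : Set (Fin n))) h
    simpa using this
  · intro t ht
    rw [Finset.mem_powersetCard] at ht
    refine ⟨t.orderEmbOfFin ht.2, Finset.mem_filter.2 ⟨Finset.mem_univ _, fun a =>
      ht.1 (Finset.orderEmbOfFin_mem t ht.2 a)⟩, ?_⟩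
    apply Finset.coe_injective
    simp

/-- Each index belongs to the same number of subsets of given cardinality. -/
lemma exists_sum_orderEmbedding_eq (p n : ℕ) : ∃ K : ℝ, 0 ≤ K ∧ ∀ x : Fin n → ℝ,
    ∑ S : Fin p ↪o Fin n, ∑ a, x (S a) = K * ∑ i, x i := by
  classical
  have hcount : ∀ i : Fin n, ((Finset.univ.filter fun S : Fin p ↪o Fin n =>
      i ∈ Set.range S).card : ℝ) = n.choose p - (n - 1).choose p := by
    intro i
    have h1 := Finset.card_filter_add_card_filter_not (s := Finset.univ)
      (fun S : Fin p ↪o Fin n => i ∈ Set.range S)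
    have h2 := card_orderEmbedding_mem (p := p) (Finset.univ : Finset (Fin n))
    have h3 := card_orderEmbedding_mem (p := p) ((Finset.univ : Finset (Fin n)).erase i)
    rw [Finset.card_erase_of_mem (Finset.mem_univ i)] at h3
    simp only [Finset.mem_univ, implies_true, Finset.filter_true, Finset.card_univ,
      Fintype.card_fin] at h1 h2 h3
    have h4 : (Finset.univ.filter fun S : Fin p ↪o Fin n => i ∉ Set.range S) =
        Finset.univ.filter fun S : Fin p ↪o Fin n => ∀ a, S a ∈ Finset.univ.erase i := by
      ext S
      simp
    rw [h4, h3, h2] at h1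
    rw [eq_sub_iff_add_eq]
    exact_mod_cast h1
  rcases Nat.eq_zero_or_pos n with rfl | hn
  · refine ⟨0, le_rfl, fun x => ?_⟩
    rw [zero_mul]
    exact Finset.sum_eq_zero fun S _ => Finset.sum_eq_zero fun a _ => (S a).elim0
  refine ⟨n.choose p - (n - 1).choose p, ?_, fun x => ?_⟩
  · rw [← hcount ⟨0, hn⟩]
    positivity
  calc ∑ S : Fin p ↪o Fin n, ∑ a, x (S a)
      = ∑ S : Fin p ↪o Fin n, ∑ i, if i ∈ Set.range S then x i else 0 := by
        refine Finset.sum_congr rfl fun S _ => ?_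
        rw [← Finset.sum_filter, ← Finset.sum_image (f := x) (s := Finset.univ) (g := S)
          (S.injective.injOn)]
        refine Finset.sum_congr ?_ fun _ _ => rfl
        ext i
        simp
    _ = ∑ i, ∑ S : Fin p ↪o Fin n, if i ∈ Set.range S then x i else 0 := Finset.sum_comm
    _ = ∑ i, (n.choose p - (n - 1).choose p) * x i := by
        refine Finset.sum_congr rfl fun i _ => ?_
        rw [← Finset.sum_filter, Finset.sum_const, nsmul_eq_mul, hcount]
    _ = _ := by rw [Finset.mul_sum]

lemma abs_det_le_factorial_mul {p : ℕ} {D : Matrix (Fin p) (Fin p) ℝ} {K : ℝ}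
    (h : ∀ τ : Equiv.Perm (Fin p), ∏ b, |D (τ b) b| ≤ K) : |D.det| ≤ p.factorial * K := by
  rw [Matrix.det_apply]
  calc _ ≤ ∑ τ : Equiv.Perm (Fin p), |Equiv.Perm.sign τ • ∏ b, D (τ b) b| :=
        Finset.abs_sum_le_sum_abs _ _
    _ ≤ ∑ _τ : Equiv.Perm (Fin p), K := Finset.sum_le_sum fun τ _ => by
        refine le_trans (le_of_eq ?_) (h τ)
        rw [← Finset.abs_prod]
        rcases Int.units_eq_one_or (Equiv.Perm.sign τ) with h | h <;> simp [h]
    _ = p.factorial * K := by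
        rw [Finset.sum_const, Finset.card_univ, Fintype.card_perm, Fintype.card_fin, nsmul_eq_mul]

/-- Bounded vectors of exponents can be rounded up to finitely many. -/
lemma exists_finite_grid (ι : Type*) [Fintype ι] (B : ℝ) {θ : ℝ} (hθ : 0 < θ) :
    ∃ E : Set (ι → ℝ), E.Finite ∧ (∀ e ∈ E, ∑ i, e i < 0) ∧
      ∀ f : ι → ℝ, (∀ i, |f i| ≤ B) → ∑ i, f i ≤ -θ → ∃ e ∈ E, ∀ i, f i ≤ e i := by
  obtain ⟨s, hs, hsN⟩ : ∃ s : ℝ, 0 < s ∧ Fintype.card ι * s < θ := by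
    refine ⟨θ / (Fintype.card ι + 1), by positivity, ?_⟩
    rw [← mul_div_assoc, div_lt_iff₀ (by positivity)]
    linarith
  obtain ⟨K, hK⟩ := exists_nat_ge (B / s + 1)
  refine ⟨{e | ∑ i, e i < 0} ∩
    (fun t : ι → ℤ => fun i => s * t i) '' {t | ∀ i, t i ∈ Set.Icc (-(K : ℤ)) K}, ?_, ?_, ?_⟩
  · exact ((Set.Finite.pi' fun _ => Set.finite_Icc _ _).image _).inter_of_right _
  · exact fun e he => he.1
  · intro f hf hsum
    have hup : ∀ i, s * ⌈f i / s⌉ ≤ f i + s := fun i => by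
      have := (Int.ceil_lt_add_one (f i / s)).le
      calc s * ⌈f i / s⌉ ≤ s * (f i / s + 1) := mul_le_mul_of_nonneg_left this hs.le
        _ = f i + s := by field_simp
    refine ⟨fun i => s * ⌈f i / s⌉, ⟨?_, fun i => ⌈f i / s⌉, fun i => ?_, rfl⟩, fun i => ?_⟩
    · have : ∑ i, s * (⌈f i / s⌉ : ℝ) ≤ ∑ i, (f i + s) := Finset.sum_le_sum fun i _ => hup i
      rw [Finset.sum_add_distrib, Finset.sum_const, Finset.card_univ, nsmul_eq_mul] at this
      rw [Set.mem_ofPred_eq]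
      linarith
    · have h1 := abs_le.1 (hf i)
      have h2 : f i / s ≤ B / s := div_le_div_of_nonneg_right h1.2 hs.le
      have h3 : -(B / s) ≤ f i / s := by
        rw [← neg_div]
        exact div_le_div_of_nonneg_right h1.1 hs.le
      constructor
      · have : (-(K : ℝ)) ≤ (⌈f i / s⌉ : ℤ) := by linarith [Int.le_ceil (f i / s)]
        exact_mod_cast this
      · refine Int.ceil_le.2 ?_
        push_cast
        linarith
    · have := mul_le_mul_of_nonneg_left (Int.le_ceil (f i / s)) hs.le
      rwa [mul_div_cancel₀ _ hs.ne'] at this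

/-- A strictly increasing sequence of indices grows at least linearly. -/
lemma orderEmbedding_add_le {n p : ℕ} (T : Fin p ↪o Fin n) {a b : Fin p} (hab : a ≤ b) :
    (T a : ℕ) + (b - a : ℕ) ≤ T b := by
  obtain ⟨b, hb⟩ := b
  induction b with
  | zero =>
    have : a = ⟨0, hb⟩ := Fin.ext (Nat.le_zero.1 hab)
    simp [this]
  | succ b ih =>
    rcases eq_or_lt_of_le hab with rfl | h
    · simp
    · have h1 : (a : ℕ) ≤ b := Nat.lt_succ_iff.1 h
      have h2 := ih (by omega) h1
      have h3 : T ⟨b, by omega⟩ < T ⟨b + 1, hb⟩ := T.strictMono (Fin.mk_lt_mk.2 (Nat.lt_succ_self b))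
      have h4 : (T ⟨b, by omega⟩ : ℕ) < T ⟨b + 1, hb⟩ := h3
      simp only at h2 ⊢
      omega

/-- Along any index set other than the last one, the exponents lose the gap. -/
lemma sum_add_le_of_ne_last {n q j : ℕ} (hj : j + (q + 1) = n) {o : Fin (q + 1) ↪o Fin n}
    (ho : ∀ a, (o a : ℕ) = j + a) {β : Fin n → ℝ} (hβ : Monotone β) {g : ℝ}
    (hg : ∀ i : Fin n, (i : ℕ) < j → β i + g ≤ β (o 0)) {T : Fin (q + 1) ↪o Fin n} (hT : T ≠ o) :
    ∑ a, β (T a) + g ≤ ∑ a, β (o a) := by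
  have hle : ∀ a, T a ≤ o a := fun a => by
    have h1 := orderEmbedding_add_le T (Fin.le_last a)
    have h2 := (T (Fin.last q)).2
    have h3 := ho a
    have h4 : (a : ℕ) ≤ q := Nat.lt_succ_iff.1 a.2
    rw [Fin.le_def]
    simp only [Fin.val_last] at h1
    omega
  have h0 : (T 0 : ℕ) < j := by
    obtain ⟨a, ha⟩ : ∃ a, T a ≠ o a := by
      by_contra! h
      exact hT (DFunLike.ext _ _ h)
    have h1 := orderEmbedding_add_le T (Fin.zero_le a)
    have h2 : (T a : ℕ) < o a := lt_of_le_of_ne (hle a) fun h => ha (Fin.ext h)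
    rw [ho] at h2
    simp only [Fin.val_zero] at h1
    omega
  rw [Fin.sum_univ_succ, Fin.sum_univ_succ (fun a => β (o a))]
  have h1 : ∑ a : Fin q, β (T a.succ) ≤ ∑ a : Fin q, β (o a.succ) :=
    Finset.sum_le_sum fun a _ => hβ (hle _)
  linarith [hg (T 0) h0]

/-- A finite family of normal vectors can be chosen uniformly. -/
lemma exists_uniform {P V : Type*} [Finite P] {R : P → V → ℝ → Prop}
    (h : ∀ s, ∃ v, ∃ Q₀ : ℝ, ∀ Q ≥ Q₀, R s v Q) :
    ∃ v : P → V, ∃ Q₀ : ℝ, ∀ Q ≥ Q₀, ∀ s, R s (v s) Q := by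
  choose v Q₀ hQ using h
  obtain ⟨B, hB⟩ := (Set.finite_range Q₀).bddAbove
  exact ⟨v, B, fun Q hQB s => hQ s Q ((hB ⟨s, rfl⟩).trans hQB)⟩

/-- A gap between consecutive minima puts the lower basis vectors into finitely many rational
hyperplanes. -/
lemma exists_normals_of_gap {n q j : ℕ} (hj : j + (q + 1) = n) {o : Fin (q + 1) ↪o Fin n}
    (ho : ∀ a, (o a : ℕ) = j + a) {M : Matrix (Fin n) (Fin n) ℝ}
    (halg : ∀ i j, IsAlgebraic ℚ (M i j)) (hM : M.det ≠ 0) {γ : Fin n → ℝ} (hγ : ∑ i, γ i = 0)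
    {g : ℝ} (hg : 0 < g) {C : ℝ} (hC : 1 ≤ C) (B : ℝ) :
    ∃ V : Set (Fin n → ℤ), V.Finite ∧ (∀ v ∈ V, v ≠ 0) ∧ ∃ Q₀ : ℝ, ∀ Q ≥ Q₀,
      ∀ u : Matrix (Fin n) (Fin n) ℤ, u.det ≠ 0 → ∀ (σ : Equiv.Perm (Fin n)) (β : Fin n → ℝ),
        Monotone β → (∀ l, |β l| ≤ B) →
        (∀ i l, |∑ k, M (σ i) k * u l k| ≤ C * Q ^ (γ (σ i) + β (min i l))) →
        Q ^ (∑ l, β l) ≤ C → (∀ i : Fin n, (i : ℕ) < j → β i + g ≤ β (o 0)) →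
        ∃ v ∈ V, ∀ i : Fin n, (i : ℕ) < j → ∑ k, v k * u i k = 0 := by
  classical
  obtain ⟨K, hK0, hK⟩ := exists_sum_orderEmbedding_eq (q + 1) n
  obtain ⟨N, hN⟩ : ∃ N : ℝ, N = Fintype.card (Fin (q + 1) ↪o Fin n) := ⟨_, rfl⟩
  have hN0 : 0 ≤ N := by rw [hN]; positivity
  obtain ⟨η, hη, hηg⟩ : ∃ η : ℝ, 0 < η ∧ (K + N) * η ≤ g / 2 := by
    refine ⟨g / (2 * (K + N + 1)), by positivity, ?_⟩
    rw [← mul_div_assoc, div_le_div_iff₀ (by positivity) (by norm_num)]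
    nlinarith
  obtain ⟨Γ, hΓ⟩ : ∃ Γ : ℝ, ∀ i, |γ i| ≤ Γ := by
    obtain ⟨Γ, hΓ⟩ := (Set.finite_range fun i => |γ i|).bddAbove
    exact ⟨Γ, fun i => hΓ ⟨i, rfl⟩⟩
  obtain ⟨E, hEfin, hEneg, hE⟩ := exists_finite_grid (Fin (q + 1) ↪o Fin n)
    ((q + 1) * (Γ + B) + η + g) (half_pos hg)
  have : Finite E := hEfin
  obtain ⟨v, Q₁, hv⟩ := exists_uniform (P := Equiv.Perm (Fin n) × E) (V := Fin n → ℤ)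
    (R := fun s v Q => v ≠ 0 ∧ ∀ u : Matrix (Fin n) (Fin n) ℤ, u.det ≠ 0 →
      (∀ T S, T ≠ o → |(Matrix.of fun a b => ∑ k, M (s.1 (S b)) k * u (T a) k).det| ≤
        Q ^ s.2.1 S) → ∀ i, i ∉ Set.range o → ∑ k, v k * u i k = 0) (by
    rintro ⟨σ, e, he⟩
    have hσ : (M.submatrix σ id).det ≠ 0 := by
      rw [Matrix.det_permute]
      rcases Int.units_eq_one_or (Equiv.Perm.sign σ) with h | h <;> simp [h, hM]
    obtain ⟨v, hv, Q₀, hQ⟩ := exists_normal_of_minors (M := M.submatrix σ id)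
      (fun i j => halg _ _) hσ o (hEneg e he)
    exact ⟨v, Q₀, fun Q hQQ => ⟨hv, hQ Q hQQ⟩⟩)
  obtain ⟨Q₂, hQ₂⟩ : ∃ Q₂ : ℝ, ∀ Q ≥ Q₂, 1 < Q ∧ (q + 1).factorial * C ^ (q + 1) ≤ Q ^ η := by
    have h1 := (tendsto_rpow_atTop hη).eventually_ge_atTop ((q + 1).factorial * C ^ (q + 1))
    obtain ⟨Q₂, h⟩ := Filter.eventually_atTop.1 ((Filter.eventually_gt_atTop 1).and h1)
    exact ⟨Q₂, h⟩
  refine ⟨Set.range v, Set.finite_range v, ?_, max Q₁ Q₂, ?_⟩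
  · rintro _ ⟨s, rfl⟩
    exact (hv Q₁ le_rfl s).1
  intro Q hQ u hu σ β hβ hβB hM hprod hgap
  obtain ⟨hQ1, hQη⟩ := hQ₂ Q ((le_max_right _ _).trans hQ)
  have hQ0 : 0 < Q := zero_lt_one.trans hQ1
  have hCη : C ≤ Q ^ η := by
    refine le_trans ?_ hQη
    calc C = 1 * C ^ 1 := by ring
      _ ≤ _ := mul_le_mul (by exact_mod_cast Nat.factorial_pos _)
        (pow_le_pow_right₀ hC (by omega)) (by positivity) (by positivity)
  have hβη : ∑ l, β l ≤ η := (Real.rpow_le_rpow_left_iff hQ1).1 (hprod.trans hCη)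
  obtain ⟨f, hf⟩ : ∃ f : (Fin (q + 1) ↪o Fin n) → ℝ, ∀ S, f S =
    (∑ a, (γ (σ (S a)) + β (S a))) + η - if S = o then g else 0 := ⟨_, fun _ => rfl⟩
  obtain ⟨e, he, hfe⟩ := hE f (fun S => by
    rw [hf]
    have h1 : |∑ a, (γ (σ (S a)) + β (S a))| ≤ (q + 1) * (Γ + B) := by
      refine (Finset.abs_sum_le_sum_abs _ _).trans ?_
      calc _ ≤ ∑ _a : Fin (q + 1), (Γ + B) := Finset.sum_le_sum fun a _ =>
            (abs_add_le _ _).trans (add_le_add (hΓ _) (hβB _))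
        _ = (q + 1) * (Γ + B) := by
            rw [Finset.sum_const, Finset.card_univ, Fintype.card_fin, nsmul_eq_mul]
            push_cast
            rfl
    have h2 := abs_le.1 h1
    split_ifs <;> rw [abs_le] <;> constructor <;> linarith) (by
    have h1 := hK fun i => γ (σ i) + β i
    rw [Finset.sum_add_distrib, Equiv.sum_comp σ γ, hγ, zero_add] at h1
    simp only [hf]
    rw [Finset.sum_sub_distrib, Finset.sum_add_distrib, h1, Finset.sum_const, Finset.card_univ,
      nsmul_eq_mul, ← hN, Finset.sum_ite_eq' Finset.univ o, if_pos (Finset.mem_univ _)]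
    linarith [mul_le_mul_of_nonneg_left hβη hK0])
  refine ⟨v (σ, ⟨e, he⟩), ⟨_, rfl⟩, fun i hi => ?_⟩
  refine (hv Q ((le_max_left _ _).trans hQ) (σ, ⟨e, he⟩)).2 u hu (fun T S hT => ?_) i ?_
  · refine le_trans ?_ (Real.rpow_le_rpow_of_exponent_le hQ1.le (hfe S))
    have hexp : ∀ τ : Equiv.Perm (Fin (q + 1)),
        ∑ b, (γ (σ (S b)) + β (min (S b) (T (τ b)))) ≤ f S - η := by
      intro τ
      rw [hf]
      split_ifs with hS
      · subst hS
        have h1 : ∑ b, β (min (S b) (T (τ b))) ≤ ∑ b, β (T (τ b)) :=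
          Finset.sum_le_sum fun b _ => hβ (min_le_right _ _)
        rw [Equiv.sum_comp τ fun a => β (T a)] at h1
        have h2 := sum_add_le_of_ne_last hj ho hβ hgap hT
        rw [Finset.sum_add_distrib, Finset.sum_add_distrib]
        linarith
      · have h1 : ∑ b, (γ (σ (S b)) + β (min (S b) (T (τ b)))) ≤ ∑ b, (γ (σ (S b)) + β (S b)) :=
          Finset.sum_le_sum fun b _ => add_le_add le_rfl (hβ (min_le_left _ _))
        linarith
    have hdet := abs_det_le_factorial_mul (K := C ^ (q + 1) * Q ^ (f S - η))
      (D := Matrix.of fun a b => ∑ k, M (σ (S b)) k * (u (T a) k : ℝ)) fun τ => by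
        calc _ ≤ ∏ b, C * Q ^ (γ (σ (S b)) + β (min (S b) (T (τ b)))) :=
              Finset.prod_le_prod (fun b _ => abs_nonneg _) fun b _ => hM _ _
          _ = C ^ (q + 1) * Q ^ (∑ b, (γ (σ (S b)) + β (min (S b) (T (τ b))))) := by
              rw [Finset.prod_mul_distrib, Finset.prod_const, Finset.card_univ, Fintype.card_fin,
                Real.rpow_sum_of_pos hQ0]
          _ ≤ _ := mul_le_mul_of_nonneg_left
              (Real.rpow_le_rpow_of_exponent_le hQ1.le (hexp τ)) (by positivity)
    refine hdet.trans ?_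
    rw [← mul_assoc]
    calc _ ≤ Q ^ η * Q ^ (f S - η) := mul_le_mul_of_nonneg_right hQη (by positivity)
      _ = Q ^ f S := by rw [← Real.rpow_add hQ0]; congr 1; ring
  · rintro ⟨a, rfl⟩
    rw [ho] at hi
    omega

end SchmidtSubspace

namespace SchmidtSubspace

/-- A sequence climbing from a tiny to a moderate value has a large ratio above the tiny value. -/
lemma exists_gap {m : ℕ} {b : Fin (m + 1) → ℝ} {t c g : ℝ} (h0 : b 0 ≤ t)
    (hlast : c ≤ b (Fin.last m)) (hc : 0 ≤ c) (hg0 : 0 ≤ g) (hg1 : g ≤ 1) (ht : t < c * g ^ m) :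
    ∃ i : Fin m, b i.castSucc ≤ g * b i.succ ∧ t < b i.succ := by
  by_contra! h
  have key : ∀ i : Fin (m + 1), c * g ^ (m - i : ℕ) ≤ b i := by
    intro i
    induction i using Fin.reverseInduction with
    | last => simpa using hlast
    | cast i ih =>
      by_contra! hlt
      have h1 : m - (i.castSucc : ℕ) = (m - (i.succ : ℕ)) + 1 := by
        have := i.2
        simp only [Fin.val_castSucc, Fin.val_succ]
        omega
      have h2 : b i.castSucc ≤ g * b i.succ := by
        refine hlt.le.trans ?_
        rw [h1, pow_succ]
        nlinarith [mul_le_mul_of_nonneg_left ih hg0]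
      have h3 : c * g ^ m ≤ c * g ^ (m - (i.succ : ℕ)) :=
        mul_le_mul_of_nonneg_left (pow_le_pow_of_le_one hg0 hg1 (Nat.sub_le _ _)) hc
      linarith [h i h2]
  have := key 0
  simp only [Fin.val_zero, Nat.sub_zero] at this
  linarith

/-- A nonsingular matrix is bounded below on nonzero integer vectors. -/
lemma exists_pos_le_norm_mulVec {n : ℕ} {M : Matrix (Fin n) (Fin n) ℝ} (hM : M.det ≠ 0) :
    ∃ κ : ℝ, 0 < κ ∧ ∀ y : Fin n → ℤ, y ≠ 0 → κ ≤ ‖M.mulVec (realVec y)‖ := by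
  obtain ⟨f, hf⟩ : ∃ f : (Fin n → ℝ) →L[ℝ] (Fin n → ℝ), ∀ z, f z = M⁻¹.mulVec z :=
    ⟨LinearMap.toContinuousLinearMap (Matrix.toLin' M⁻¹), fun z => by simp⟩
  refine ⟨(‖f‖ + 1)⁻¹, by positivity, fun y hy => ?_⟩
  obtain ⟨k, hk⟩ := Function.ne_iff.1 hy
  have h1 : (1 : ℝ) ≤ ‖realVec y‖ := by
    refine le_trans ?_ (norm_le_pi_norm (realVec y) k)
    rw [realVec, Real.norm_eq_abs]
    exact_mod_cast Int.one_le_abs hk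
  have h2 : f (M.mulVec (realVec y)) = realVec y := by
    rw [hf, Matrix.mulVec_mulVec, Matrix.nonsing_inv_mul _ (isUnit_iff_ne_zero.2 hM),
      Matrix.one_mulVec]
  have h3 := f.le_opNorm (M.mulVec (realVec y))
  rw [h2] at h3
  rw [inv_le_iff_one_le_mul₀ (by positivity)]
  nlinarith [norm_nonneg (M.mulVec (realVec y))]

/-- Numbers bounded below with bounded product have bounded logarithms. -/
lemma abs_logb_le {n : ℕ} {b : Fin n → ℝ} {Q Γ D : ℝ} (hQ : 1 < Q) (hΓ : 0 ≤ Γ)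
    (hb : ∀ l, Q ^ (-Γ) ≤ b l) (hD : ∏ l, b l ≤ D) (hDQ : D ≤ Q) (l : Fin n) :
    |logb Q (b l)| ≤ 1 + n * Γ := by
  have hQ0 : 0 < Q := zero_lt_one.trans hQ
  have hpos : ∀ l, 0 < b l := fun l => (Real.rpow_pos_of_pos hQ0 _).trans_le (hb l)
  have hlow : ∀ l, -Γ ≤ logb Q (b l) := fun l => (Real.le_logb_iff_rpow_le hQ (hpos l)).2 (hb l)
  have hsum : ∑ l, logb Q (b l) ≤ 1 := by
    rw [← Real.logb_prod Finset.univ b fun l _ => (hpos l).ne',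
      Real.logb_le_iff_le_rpow hQ (Finset.prod_pos fun l _ => hpos l), Real.rpow_one]
    exact hD.trans hDQ
  have h1 : logb Q (b l) + Γ ≤ ∑ l, (logb Q (b l) + Γ) :=
    Finset.single_le_sum (f := fun l => logb Q (b l) + Γ) (fun l _ => by linarith [hlow l])
      (Finset.mem_univ l)
  rw [Finset.sum_add_distrib, Finset.sum_const, Finset.card_univ, Fintype.card_fin,
    nsmul_eq_mul] at h1
  have h2 : (1 : ℝ) ≤ n := by exact_mod_cast (Nat.one_le_iff_ne_zero.2 fun h => by
    subst h; exact l.elim0)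
  rw [abs_le]
  constructor
  · nlinarith [hlow l]
  · linarith

/-- The integer points on which linear forms with algebraic coefficients are small lie in finitely
many rational hyperplanes. -/
theorem exists_finite_normals {n : ℕ} {M : Matrix (Fin n) (Fin n) ℝ}
    (halg : ∀ i j, IsAlgebraic ℚ (M i j)) (hM : M.det ≠ 0) {c : Fin n → ℝ} (hc : ∑ i, c i < 0) :
    ∃ V : Set (Fin n → ℤ), V.Finite ∧ (∀ v ∈ V, v ≠ 0) ∧ ∃ Q₀ : ℝ, ∀ Q ≥ Q₀,
      ∀ x : Fin n → ℤ, x ≠ 0 → (∀ i, |∑ k, M i k * x k| ≤ Q ^ c i) →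
        ∃ v ∈ V, ∑ k, v k * x k = 0 := by
  rcases n with _ | m
  · simp at hc
  obtain ⟨δ, hδ, hδc⟩ : ∃ δ : ℝ, 0 < δ ∧ ∑ i, c i + (m + 1) * δ = 0 :=
    ⟨-(∑ i, c i) / (m + 1), div_pos (by linarith) (by positivity), by field_simp; ring⟩
  obtain ⟨γ, hγ⟩ : ∃ γ : Fin (m + 1) → ℝ, ∀ i, γ i = c i + δ := ⟨_, fun _ => rfl⟩
  have hγ0 : ∑ i, γ i = 0 := by
    simp only [hγ]
    rw [Finset.sum_add_distrib, Finset.sum_const, Finset.card_univ, Fintype.card_fin, nsmul_eq_mul]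
    push_cast
    exact hδc
  obtain ⟨C, hC, hbasis⟩ := exists_reduced_basis (m + 1)
  obtain ⟨κ, hκ, hκM⟩ := exists_pos_le_norm_mulVec hM
  obtain ⟨Γ, hΓ0, hΓ⟩ : ∃ Γ : ℝ, 0 ≤ Γ ∧ ∀ i, γ i ≤ Γ := by
    obtain ⟨Γ, hΓ⟩ := (Set.finite_range γ).bddAbove
    exact ⟨max 0 Γ, le_max_left _ _, fun i => (hΓ ⟨i, rfl⟩).trans (le_max_right _ _)⟩
  obtain ⟨D, hD⟩ : ∃ D : ℝ, D = |M.det| := ⟨_, rfl⟩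
  have hD0 : 0 < D := hD ▸ abs_pos.2 hM
  obtain ⟨g, hg, hgδ⟩ : ∃ g : ℝ, 0 < g ∧ g * m ≤ δ / 2 := by
    refine ⟨δ / (2 * (m + 1)), by positivity, ?_⟩
    rw [div_mul_eq_mul_div, div_le_div_iff₀ (by positivity) (by positivity)]
    nlinarith
  obtain ⟨C', hC', hCC', hDC'⟩ : ∃ C' : ℝ, 1 ≤ C' ∧ C ≤ C' ∧ C * D ≤ C' :=
    ⟨max C (C * D), hC.trans (le_max_left _ _), le_max_left _ _, le_max_right _ _⟩
  have hidx : ∀ i : Fin m, (i : ℕ) + 1 + ((m - i - 1) + 1) = m + 1 := fun i => by omega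
  have hgap := fun i : Fin m => exists_normals_of_gap (hidx i)
    (o := OrderEmbedding.ofStrictMono
      (fun a => (⟨i + 1 + a, by have := a.2; omega⟩ : Fin (m + 1)))
      fun a b hab => Fin.mk_lt_mk.2 (Nat.add_lt_add_left hab _))
    (fun a => rfl) halg hM hγ0 hg hC' (1 + ((m + 1 : ℕ) : ℝ) * (Γ + 1))
  choose V hVfin hVne Q₁ hV using hgap
  obtain ⟨Q₂, hQ₂⟩ := (Set.finite_range Q₁).bddAbove
  obtain ⟨c', hc'0, hc'1, hc'D⟩ : ∃ c' : ℝ, 0 < c' ∧ c' ≤ 1 ∧ C * c' ≤ D := by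
    have hC0 : 0 < C := zero_lt_one.trans_le hC
    refine ⟨min 1 (D / C), lt_min one_pos (div_pos hD0 hC0), min_le_left _ _, ?_⟩
    rw [mul_comm, ← le_div_iff₀ hC0]
    exact min_le_right _ _
  obtain ⟨Q₃, hQ₃⟩ : ∃ Q₃ : ℝ, ∀ Q ≥ Q₃, 1 < Q ∧ C * D ≤ Q ∧ κ⁻¹ ≤ Q ∧ c'⁻¹ < Q ^ (δ / 2) := by
    have h1 := (tendsto_rpow_atTop (half_pos hδ)).eventually_gt_atTop c'⁻¹
    exact Filter.eventually_atTop.1 ((Filter.eventually_gt_atTop 1).and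
      ((Filter.eventually_ge_atTop _).and ((Filter.eventually_ge_atTop _).and h1)))
  refine ⟨⋃ i, V i, Set.finite_iUnion hVfin, fun v hv => ?_, max Q₂ Q₃, ?_⟩
  · obtain ⟨i, hi⟩ := Set.mem_iUnion.1 hv
    exact hVne i v hi
  intro Q hQ x hx hxM
  obtain ⟨hQ1, hCDQ, hκQ, hcQ⟩ := hQ₃ Q ((le_max_right _ _).trans hQ)
  have hQ0 : 0 < Q := zero_lt_one.trans hQ1
  obtain ⟨A, hA⟩ : ∃ A : Matrix (Fin (m + 1)) (Fin (m + 1)) ℝ,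
    A = Matrix.diagonal (fun i => Q ^ (-γ i)) * M := ⟨_, rfl⟩
  have hAdet : |A.det| = D := by
    rw [hA, Matrix.det_mul, Matrix.det_diagonal, ← Real.rpow_sum_of_pos hQ0,
      Finset.sum_neg_distrib, hγ0, neg_zero, Real.rpow_zero, one_mul, hD]
  have hAdet0 : A.det ≠ 0 := abs_pos.1 (hAdet ▸ hD0)
  have hAv : ∀ z i, A.mulVec z i = Q ^ (-γ i) * M.mulVec z i := fun z i => by
    rw [hA, ← Matrix.mulVec_mulVec, Matrix.mulVec_diagonal]
  have hMv : ∀ z i, M.mulVec z i = Q ^ γ i * A.mulVec z i := fun z i => by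
    rw [hAv, ← mul_assoc, ← Real.rpow_add hQ0, add_neg_cancel, Real.rpow_zero, one_mul]
  have hlow : ∀ y : Fin (m + 1) → ℤ, y ≠ 0 → Q ^ (-(Γ + 1)) ≤ ‖A.mulVec (realVec y)‖ := by
    intro y hy
    have h1 : ‖M.mulVec (realVec y)‖ ≤ Q ^ Γ * ‖A.mulVec (realVec y)‖ := by
      rw [pi_norm_le_iff_of_nonneg (by positivity)]
      intro i
      rw [hMv, norm_mul, Real.norm_of_nonneg (by positivity)]
      exact mul_le_mul (Real.rpow_le_rpow_of_exponent_le hQ1.le (hΓ i)) (norm_le_pi_norm _ i)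
        (norm_nonneg _) (by positivity)
    have h2 : Q⁻¹ ≤ κ := inv_le_of_inv_le₀ hκ hκQ
    have h3 : Q⁻¹ ≤ Q ^ Γ * ‖A.mulVec (realVec y)‖ := h2.trans ((hκM y hy).trans h1)
    rw [neg_add, Real.rpow_add hQ0, Real.rpow_neg_one, Real.rpow_neg hQ0.le,
      inv_mul_le_iff₀ (by positivity)]
    exact h3
  obtain ⟨u, b, σ, hu, hbmono, hub, hbC, hCb, hbspan, hbatt⟩ := hbasis A hAdet0
  rw [hAdet] at hbC hCb
  have hblow : ∀ l, Q ^ (-(Γ + 1)) ≤ b l := fun l => by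
    obtain ⟨y, hy, hby⟩ := hbatt l
    rw [hby]
    exact hlow y hy
  have hbpos : ∀ l, 0 < b l := fun l => (Real.rpow_pos_of_pos hQ0 _).trans_le (hblow l)
  have hxA : ‖A.mulVec (realVec x)‖ ≤ Q ^ (-δ) := by
    rw [pi_norm_le_iff_of_nonneg (by positivity)]
    intro i
    rw [hAv, norm_mul, Real.norm_of_nonneg (by positivity)]
    calc _ ≤ Q ^ (-γ i) * Q ^ c i := mul_le_mul_of_nonneg_left (hxM i) (by positivity)
      _ = Q ^ (-δ) := by rw [← Real.rpow_add hQ0, hγ]; congr 1; ring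
  have hb0 : b 0 ≤ Q ^ (-δ) := by
    by_contra! h
    have h1 := hbspan 0 x (hxA.trans_lt h)
    have h2 : Set.Iio (0 : Fin (m + 1)) = ∅ := by ext i; simp
    rw [h2, Set.image_empty, Submodule.span_empty, Submodule.mem_bot] at h1
    exact realVec_ne_zero hx h1
  have hblast : c' ≤ b (Fin.last m) := by
    by_contra! h
    have h1 : ∏ l, b l ≤ b (Fin.last m) ^ (m + 1) := by
      calc _ ≤ ∏ _l : Fin (m + 1), b (Fin.last m) :=
            Finset.prod_le_prod (fun l _ => (hbpos l).le) fun l _ => hbmono (Fin.le_last l)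
        _ = _ := by simp
    have h2 : b (Fin.last m) ^ (m + 1) ≤ b (Fin.last m) :=
      pow_le_of_le_one (hbpos _).le (h.le.trans hc'1) (Nat.succ_ne_zero m)
    have h3 : C * ∏ l, b l < C * c' :=
      mul_lt_mul_of_pos_left ((h1.trans h2).trans_lt h) (zero_lt_one.trans_le hC)
    linarith
  obtain ⟨i, hi, hti⟩ := exists_gap hb0 hblast hc'0.le (Real.rpow_nonneg hQ0.le (-g))
    (Real.rpow_le_one_of_one_le_of_nonpos hQ1.le (by linarith)) (by
      rw [← Real.rpow_natCast, ← Real.rpow_mul hQ0.le]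
      have h1 : Q ^ (-(δ / 2)) ≤ Q ^ (-g * m) :=
        Real.rpow_le_rpow_of_exponent_le hQ1.le (by linarith)
      have h2 : Q ^ (-(δ / 2)) < c' := by
        rw [Real.rpow_neg hQ0.le]
        exact inv_lt_of_inv_lt₀ hc'0 hcQ
      calc Q ^ (-δ) = Q ^ (-(δ / 2)) * Q ^ (-(δ / 2)) := by
            rw [← Real.rpow_add hQ0]; congr 1; ring
        _ < c' * Q ^ (-(δ / 2)) := mul_lt_mul_of_pos_right h2 (by positivity)
        _ ≤ _ := mul_le_mul_of_nonneg_left h1 hc'0.le)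
  have hβ : ∀ l, Q ^ logb Q (b l) = b l := fun l => Real.rpow_logb hQ0 hQ1.ne' (hbpos l)
  have hβmono : Monotone fun l => logb Q (b l) := fun l l' hl =>
    Real.logb_le_logb_of_le hQ1 (hbpos l) (hbmono hl)
  obtain ⟨v, hv, hvu⟩ := hV i Q ((hQ₂ ⟨i, rfl⟩).trans ((le_max_left _ _).trans hQ)) u hu σ
    (fun l => logb Q (b l)) hβmono
    (abs_logb_le hQ1 (by linarith) hblow hbC hCDQ)
    (fun k l => by
      have h1 := hub l k
      have h2 := hMv (realVec (u l)) (σ k)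
      have h3 : ∑ k', M (σ k) k' * (u l k' : ℝ) = M.mulVec (realVec (u l)) (σ k) := rfl
      rw [h3, h2, abs_mul, abs_of_nonneg (Real.rpow_nonneg hQ0.le _), Real.rpow_add hQ0, hβ]
      calc _ ≤ Q ^ γ (σ k) * (C * b (min k l)) :=
            mul_le_mul_of_nonneg_left h1 (Real.rpow_nonneg hQ0.le _)
        _ = C * (Q ^ γ (σ k) * b (min k l)) := by ring
        _ ≤ _ := mul_le_mul_of_nonneg_right hCC'
            (mul_nonneg (Real.rpow_nonneg hQ0.le _) (hbpos _).le))
    (by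
      rw [Real.rpow_sum_of_pos hQ0]
      simp only [hβ]
      exact hbC.trans hDC')
    (fun l hl => by
      have h1 : logb Q (b l) ≤ logb Q (b i.castSucc) :=
        hβmono (Fin.le_def.2 (by simpa using Nat.lt_succ_iff.1 hl))
      have h2 : logb Q (b i.castSucc) ≤ logb Q (Q ^ (-g) * b i.succ) :=
        Real.logb_le_logb_of_le hQ1 (hbpos _) hi
      rw [Real.logb_mul (Real.rpow_pos_of_pos hQ0 _).ne' (hbpos _).ne',
        Real.logb_rpow hQ0 hQ1.ne'] at h2
      have h3 : logb Q (b l) + g ≤ logb Q (b i.succ) := by linarith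
      exact h3)
  refine ⟨v, Set.mem_iUnion.2 ⟨i, hv⟩, ?_⟩
  have hspan := hbspan i.succ x (hxA.trans_lt hti)
  have key : ∀ z ∈ Submodule.span ℝ ((fun j => realVec (u j)) '' Set.Iio i.succ),
      ∑ k, (v k : ℝ) * z k = 0 := by
    intro z hz
    induction hz using Submodule.span_induction with
    | mem z hz =>
      obtain ⟨l, hl, rfl⟩ := hz
      simp only [realVec]
      exact_mod_cast hvu l (Fin.lt_def.1 hl)
    | zero => simp
    | add y z _ _ hy hz => simp [mul_add, Finset.sum_add_distrib, hy, hz]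
    | smul a z _ hz =>
      simp only [Pi.smul_apply, smul_eq_mul, mul_left_comm _ a]
      rw [← Finset.mul_sum, hz, mul_zero]
  have h0 := key _ hspan
  simp only [realVec] at h0
  exact_mod_cast h0

end SchmidtSubspace

namespace SchmidtSubspace

lemma finite_setOf_norm_realVec_le {ι : Type*} [Fintype ι] (R : ℝ) :
    {x : ι → ℤ | ‖realVec x‖ ≤ R}.Finite := by
  refine (Set.Finite.pi' fun _ : ι => Set.finite_Icc (-⌈R⌉) ⌈R⌉).subset fun x hx i => ?_
  have h1 : |(x i : ℝ)| ≤ R := (norm_le_pi_norm (realVec x) i).trans hx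
  have h2 := abs_le.1 (h1.trans (Int.le_ceil R))
  exact ⟨by exact_mod_cast h2.1, by exact_mod_cast h2.2⟩

/-- A nonzero form can be completed to a nonsingular system by forms that span with it. -/
lemma exists_selection {m r : ℕ} {ℓ₀ : Fin (m + 1) → ℝ} {ℓ : Fin r → Fin (m + 1) → ℝ}
    (h0 : ℓ₀ ≠ 0) (hspan : ⊤ ≤ Submodule.span ℝ (insert ℓ₀ (Set.range ℓ))) :
    ∃ e : Fin m → Fin r, e.Injective ∧
      (Matrix.of (Fin.cons ℓ₀ fun i => ℓ (e i) : Fin (m + 1) → Fin (m + 1) → ℝ)).det ≠ 0 := by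
  classical
  obtain ⟨b, hbt, hsb, hspanb, hb⟩ := exists_linearIndepOn_id_extension
    (K := ℝ) (s := {ℓ₀}) (t := insert ℓ₀ (Set.range ℓ))
    ((linearIndepOn_singleton_iff ℝ).2 h0) (by simp)
  have hbtop : ⊤ ≤ Submodule.span ℝ b := hspan.trans (Submodule.span_le.2 hspanb)
  have hbfin : b.Finite := hb.linearIndependent.setFinite
  have hcard : b.ncard = m + 1 := by
    have : Fintype b := hbfin.fintype
    have hB := Module.finrank_eq_card_basis (Module.Basis.mk (v := ((↑) : b → Fin (m + 1) → ℝ))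
      hb.linearIndependent (by simpa using hbtop))
    rw [Module.finrank_fin_fun] at hB
    rw [← Nat.card_coe_set_eq, Nat.card_eq_fintype_card]
    exact hB.symm
  have hcard' : Nat.card (b \ {ℓ₀} : Set _) = m := by
    rw [Nat.card_coe_set_eq, Set.ncard_sdiff_singleton_of_mem (hsb rfl), hcard]
    rfl
  have : Finite (b \ {ℓ₀} : Set _) := hbfin.sdiff
  obtain ⟨φ⟩ : Nonempty (Fin m ≃ (b \ {ℓ₀} : Set _)) :=
    ⟨(Finite.equivFinOfCardEq hcard').symm⟩
  have hrange : ∀ i, ∃ k, ℓ k = φ i := fun i =>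
    (hbt (φ i).2.1).resolve_left fun h => (φ i).2.2 h
  choose e he using hrange
  refine ⟨e, fun i i' h => φ.injective (Subtype.ext ?_), ?_⟩
  · rw [← he, ← he, h]
  · have hli : LinearIndependent ℝ (Fin.cons ℓ₀ fun i => ℓ (e i) :
        Fin (m + 1) → Fin (m + 1) → ℝ) := by
      have hmem : ∀ i, (Fin.cons ℓ₀ fun i => ℓ (e i) : Fin (m + 1) → Fin (m + 1) → ℝ) i ∈ b := by
        intro i
        refine Fin.cases ?_ (fun i => ?_) i
        · exact hsb rfl
        · rw [Fin.cons_succ, he]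
          exact (φ i).2.1
      refine hb.linearIndependent.comp (fun i => ⟨_, hmem i⟩) fun i i' h => ?_
      have h' := congrArg Subtype.val h
      revert h'
      have hinj : Function.Injective (Fin.cons ℓ₀ fun i => ℓ (e i) :
          Fin (m + 1) → Fin (m + 1) → ℝ) := by
        rw [Fin.cons_injective_iff]
        constructor
        · rintro ⟨i, hi⟩
          exact (φ i).2.2 ((he i).symm.trans hi)
        · intro i i' h
          simp only [he] at h
          exact φ.injective (Subtype.ext h)
      exact fun h => hinj h
    have := (Matrix.linearIndependent_rows_iff_isUnit
      (A := Matrix.of (Fin.cons ℓ₀ fun i => ℓ (e i) : Fin (m + 1) → Fin (m + 1) → ℝ))).1 hli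
    exact ((Matrix.isUnit_iff_isUnit_det _).1 this).ne_zero

/-- Large solutions of a product inequality lie in finitely many rational hyperplanes. -/
lemma exists_finite_normals_of_prod_lt {m r : ℕ} {ε : ℝ} (hε : 0 < ε) {ℓ₀ : Fin (m + 1) → ℝ}
    {ℓ : Fin r → Fin (m + 1) → ℝ} (halg₀ : ∀ j, IsAlgebraic ℚ (ℓ₀ j))
    (halg : ∀ i j, IsAlgebraic ℚ (ℓ i j)) (h0 : ℓ₀ ≠ 0)
    (hspan : ⊤ ≤ Submodule.span ℝ (insert ℓ₀ (Set.range ℓ))) :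
    ∃ V : Set (Fin (m + 1) → ℤ), V.Finite ∧ (∀ v ∈ V, v ≠ 0) ∧ ∃ Q₀ : ℝ,
      ∀ x : Fin (m + 1) → ℤ, Q₀ ≤ ‖realVec x‖ →
        |∑ j, ℓ₀ j * x j| * ∏ i, (|∑ j, ℓ i j * x j| + 1) < ‖realVec x‖ ^ (-ε) →
        ∃ v ∈ V, ∑ k, v k * x k = 0 := by
  classical
  obtain ⟨e, he, hdet⟩ := exists_selection h0 hspan
  obtain ⟨M, hM⟩ : ∃ M : Matrix (Fin (m + 1)) (Fin (m + 1)) ℝ,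
    M = Matrix.of (Fin.cons ℓ₀ fun i => ℓ (e i)) := ⟨_, rfl⟩
  rw [← hM] at hdet
  have hM0 : ∀ j, M 0 j = ℓ₀ j := fun j => by rw [hM]; rfl
  have hMs : ∀ i j, M (Fin.succ i) j = ℓ (e i) j := fun i j => by rw [hM]; rfl
  have hMalg : ∀ i j, IsAlgebraic ℚ (M i j) := fun i j => by
    refine Fin.cases ?_ (fun i => ?_) i
    · rw [hM0]; exact halg₀ j
    · rw [hMs]; exact halg _ j
  obtain ⟨E, hEfin, hEneg, hE⟩ := exists_finite_grid (Fin (m + 1)) (ε + m * 2 + 2) hε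
  have : Finite E := hEfin
  choose V hVfin hVne Q₁ hV using fun s : E => exists_finite_normals hMalg hdet (hEneg s.1 s.2)
  obtain ⟨Q₂, hQ₂⟩ := (Set.finite_range Q₁).bddAbove
  obtain ⟨H, hH⟩ : ∃ H : ℝ, ∀ i, ∑ j, |ℓ i j| ≤ H := by
    obtain ⟨H, hH⟩ := (Set.finite_range fun i => ∑ j, |ℓ i j|).bddAbove
    exact ⟨H, fun i => hH ⟨i, rfl⟩⟩
  refine ⟨⋃ s, V s, Set.finite_iUnion hVfin, fun v hv => ?_, max Q₂ (max 2 (H + 1)), ?_⟩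
  · obtain ⟨s, hs⟩ := Set.mem_iUnion.1 hv
    exact hVne s v hs
  intro x hxQ hlt
  obtain ⟨Q, hQ⟩ : ∃ Q : ℝ, Q = ‖realVec x‖ := ⟨_, rfl⟩
  rw [← hQ] at hxQ hlt
  have hQ2 : 2 ≤ Q := (le_max_left _ _).trans ((le_max_right _ _).trans hxQ)
  have hQH : H + 1 ≤ Q := (le_max_right _ _).trans ((le_max_right _ _).trans hxQ)
  have hQ1 : 1 < Q := by linarith
  have hQ0 : 0 < Q := by linarith
  have hx0 : x ≠ 0 := by
    rintro rfl
    have : realVec (0 : Fin (m + 1) → ℤ) = 0 := by ext; simp [realVec]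
    rw [this, norm_zero] at hQ
    linarith
  obtain ⟨w, hw⟩ : ∃ w : Fin r → ℝ, ∀ i, w i = |∑ j, ℓ i j * x j| + 1 := ⟨_, fun _ => rfl⟩
  have hw1 : ∀ i, 1 ≤ w i := fun i => by rw [hw]; linarith [abs_nonneg (∑ j, ℓ i j * x j)]
  have hwQ : ∀ i, w i ≤ Q ^ (2 : ℝ) := fun i => by
    have h1 : |∑ j, ℓ i j * x j| ≤ H * Q := by
      calc _ ≤ ∑ j, |ℓ i j * x j| := Finset.abs_sum_le_sum_abs _ _
        _ ≤ ∑ j, |ℓ i j| * Q := Finset.sum_le_sum fun j _ => by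
            rw [abs_mul, hQ]
            exact mul_le_mul_of_nonneg_left (norm_le_pi_norm (realVec x) j) (abs_nonneg _)
        _ = (∑ j, |ℓ i j|) * Q := by rw [Finset.sum_mul]
        _ ≤ _ := mul_le_mul_of_nonneg_right (hH i) hQ0.le
    rw [hw, Real.rpow_two]
    nlinarith
  have hwprod : ∏ i, w (e i) ≤ ∏ i, w i := by
    rw [← Finset.prod_image (f := w) (s := Finset.univ) (g := e) he.injOn,
      ← Finset.prod_mul_prod_compl (Finset.univ.image e) w]
    exact le_mul_of_one_le_right (Finset.prod_nonneg fun i _ => zero_le_one.trans (hw1 i))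
      (Finset.one_le_prod fun i _ => hw1 i)
  have hs : ∀ i, Q ^ logb Q (w i) = w i := fun i =>
    Real.rpow_logb hQ0 hQ1.ne' (zero_lt_one.trans_le (hw1 i))
  have hs0 : ∀ i, 0 ≤ logb Q (w i) := fun i => Real.logb_nonneg hQ1 (hw1 i)
  have hs2 : ∀ i, logb Q (w i) ≤ 2 := fun i =>
    (Real.logb_le_iff_le_rpow hQ1 (zero_lt_one.trans_le (hw1 i))).2 (hwQ i)
  obtain ⟨S, hS⟩ : ∃ S : ℝ, S = ∑ i, logb Q (w (e i)) := ⟨_, rfl⟩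
  have hS0 : 0 ≤ S := hS ▸ Finset.sum_nonneg fun i _ => hs0 _
  have hS2 : S ≤ m * 2 := by
    rw [hS]
    calc _ ≤ ∑ _i : Fin m, (2 : ℝ) := Finset.sum_le_sum fun i _ => hs2 _
      _ = m * 2 := by simp
  obtain ⟨c, hc, hfc⟩ := hE (Fin.cons (-ε - S) fun i => logb Q (w (e i)))
    (fun i => by
      refine Fin.cases ?_ (fun i => ?_) i
      · rw [Fin.cons_zero, abs_le]
        constructor <;> linarith
      · rw [Fin.cons_succ, abs_of_nonneg (hs0 _)]
        have : (0 : ℝ) ≤ m := Nat.cast_nonneg m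
        linarith [hs2 (e i)])
    (by
      rw [Fin.sum_univ_succ]
      simp only [Fin.cons_zero, Fin.cons_succ]
      rw [← hS]
      linarith)
  obtain ⟨v, hv, hvx⟩ := hV ⟨c, hc⟩ Q ((hQ₂ ⟨_, rfl⟩).trans ((le_max_left _ _).trans hxQ)) x hx0
    (fun i => by
      refine le_trans ?_ (Real.rpow_le_rpow_of_exponent_le hQ1.le (hfc i))
      refine Fin.cases ?_ (fun i => ?_) i
      · simp only [hM0, Fin.cons_zero]
        have h1 : |∑ j, ℓ₀ j * x j| * Q ^ S ≤ Q ^ (-ε) := by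
          rw [hS, Real.rpow_sum_of_pos hQ0]
          simp only [hs]
          simp only [← hw] at hlt
          exact (mul_le_mul_of_nonneg_left hwprod (abs_nonneg _)).trans hlt.le
        rw [Real.rpow_sub hQ0, le_div_iff₀ (by positivity)]
        exact h1
      · simp only [hMs, Fin.cons_succ, hs]
        rw [hw]
        linarith)
  exact ⟨v, Set.mem_iUnion.2 ⟨_, hv⟩, hvx⟩

/-- A product inequality whose distinguished form does not vanish at nonzero integer points has
finitely many solutions. -/
theorem finite_setOf_prod_lt {r : ℕ} {ε : ℝ} (hε : 0 < ε) : ∀ (k : ℕ) {ℓ₀ : Fin k → ℝ}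
    {ℓ : Fin r → Fin k → ℝ}, (∀ j, IsAlgebraic ℚ (ℓ₀ j)) → (∀ i j, IsAlgebraic ℚ (ℓ i j)) →
    (∀ x : Fin k → ℤ, x ≠ 0 → ∑ j, ℓ₀ j * x j ≠ 0) →
    ⊤ ≤ Submodule.span ℝ (insert ℓ₀ (Set.range ℓ)) →
    {x : Fin k → ℤ | |∑ j, ℓ₀ j * x j| * ∏ i, (|∑ j, ℓ i j * x j| + 1) <
      ‖realVec x‖ ^ (-ε)}.Finite
  | 0, _, _, _, _, _, _ => Set.toFinite _
  | m + 1, ℓ₀, ℓ, halg₀, halg, hne, hspan => by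
    have h0 : ℓ₀ ≠ 0 := by
      rintro rfl
      exact hne 1 one_ne_zero (by simp)
    obtain ⟨V, hVfin, hVne, Q₀, hV⟩ := exists_finite_normals_of_prod_lt hε halg₀ halg h0 hspan
    refine ((finite_setOf_norm_realVec_le Q₀).union (hVfin.biUnion (t := fun v =>
      {x : Fin (m + 1) → ℤ | (|∑ j, ℓ₀ j * x j| * ∏ i, (|∑ j, ℓ i j * x j| + 1) <
        ‖realVec x‖ ^ (-ε)) ∧ ∑ k, v k * x k = 0}) fun v hv => ?_)).subset fun x hx => ?_
    swap
    · rcases le_total ‖realVec x‖ Q₀ with h | h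
      · exact Or.inl h
      · obtain ⟨v, hv, hvx⟩ := hV x h hx
        exact Or.inr (Set.mem_biUnion hv ⟨hx, hvx⟩)
    obtain ⟨p, hp⟩ := Function.ne_iff.1 (hVne v hv)
    have hpR : (v p : ℝ) ≠ 0 := Int.cast_ne_zero.2 hp
    obtain ⟨R, hR⟩ : ∃ R : (Fin (m + 1) → ℝ) →ₗ[ℝ] (Fin m → ℝ),
        ∀ z j, R z j = z (p.succAbove j) - z p * (v (p.succAbove j) / v p) :=
      ⟨{ toFun := fun z j => z (p.succAbove j) - z p * (v (p.succAbove j) / v p)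
         map_add' := fun y z => by ext j; simp only [Pi.add_apply]; ring
         map_smul' := fun a z => by
          ext j; simp only [Pi.smul_apply, smul_eq_mul, RingHom.id_apply]; ring }, fun _ _ => rfl⟩
    have hRx : ∀ (z : Fin (m + 1) → ℝ) (x : Fin (m + 1) → ℤ), ∑ k, v k * x k = 0 →
        ∑ j, z j * x j = ∑ j, R z j * x (p.succAbove j) := by
      intro z x hvx
      rw [Fin.sum_univ_succAbove _ p] at hvx
      have h1 : (v p : ℝ) * x p = -∑ j, (v (p.succAbove j) : ℝ) * x (p.succAbove j) := by
        rw [eq_neg_iff_add_eq_zero]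
        exact_mod_cast hvx
      have h2 : (x p : ℝ) = -∑ j, (v (p.succAbove j) / v p : ℝ) * x (p.succAbove j) := by
        rw [← mul_right_inj' hpR, h1, mul_neg, Finset.mul_sum]
        congr 1
        refine Finset.sum_congr rfl fun j _ => ?_
        field_simp
      rw [Fin.sum_univ_succAbove _ p, h2, mul_neg, Finset.mul_sum, neg_add_eq_sub,
        ← Finset.sum_sub_distrib]
      refine Finset.sum_congr rfl fun j _ => ?_
      rw [hR]
      ring
    have hinj : ∀ x y : Fin (m + 1) → ℤ, ∑ k, v k * x k = 0 → ∑ k, v k * y k = 0 →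
        (∀ j, x (p.succAbove j) = y (p.succAbove j)) → x = y := by
      intro x y hx hy hxy
      rw [Fin.sum_univ_succAbove _ p] at hx hy
      simp only [hxy] at hx
      have h1 : x p = y p := mul_left_cancel₀ hp (by linarith)
      ext k
      rcases Fin.eq_self_or_eq_succAbove p k with rfl | ⟨j, rfl⟩
      · exact h1
      · exact hxy j
    have hRalg : ∀ z : Fin (m + 1) → ℝ, (∀ j, IsAlgebraic ℚ (z j)) →
        ∀ j, IsAlgebraic ℚ (R z j) := fun z hz j => by
      rw [hR]
      refine (hz _).sub ((hz _).mul ?_)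
      have : ((v (p.succAbove j) : ℝ) / v p) =
          algebraMap ℚ ℝ ((v (p.succAbove j) : ℚ) / v p) := by simp
      rw [this]
      exact isAlgebraic_algebraMap _
    have hRsurj : Function.Surjective R := fun y => by
      refine ⟨p.insertNth 0 y, ?_⟩
      ext j
      simp [hR]
    have ih := finite_setOf_prod_lt hε m (ℓ₀ := R ℓ₀) (ℓ := fun i => R (ℓ i)) (hRalg _ halg₀)
      (fun i => hRalg _ (halg i))
      (fun y hy hy0 => by
        obtain ⟨x, hx⟩ : ∃ x : Fin (m + 1) → ℤ,
          x = p.insertNth (-∑ j, v (p.succAbove j) * y j) fun j => v p * y j := ⟨_, rfl⟩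
        have hxp : x p = -∑ j, v (p.succAbove j) * y j := by simp [hx]
        have hxs : ∀ j, x (p.succAbove j) = v p * y j := fun j => by simp [hx]
        have h1 : ∑ k, v k * x k = 0 := by
          rw [Fin.sum_univ_succAbove _ p, hxp, mul_neg, Finset.mul_sum, neg_add_eq_zero]
          refine Finset.sum_congr rfl fun j _ => ?_
          rw [hxs]
          ring
        refine hne x ?_ ?_
        · rintro h
          obtain ⟨j, hj⟩ := Function.ne_iff.1 hy
          have h2 := hxs j
          rw [h] at h2
          exact mul_ne_zero hp hj h2.symm
        · rw [hRx _ _ h1]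
          simp only [hxs]
          push_cast
          simp only [mul_left_comm _ (v p : ℝ)]
          rw [← Finset.mul_sum, hy0, mul_zero])
      (by
        have h1 : insert (R ℓ₀) (Set.range fun i => R (ℓ i)) = R '' insert ℓ₀ (Set.range ℓ) := by
          rw [Set.image_insert_eq, ← Set.range_comp]
          rfl
        rw [h1, Submodule.span_image, top_le_iff.1 hspan, Submodule.map_top,
          LinearMap.range_eq_top.2 hRsurj])
    refine Set.Finite.of_finite_image (f := fun x j => x (p.succAbove j))
      (ih.subset ?_) ?_
    · rintro _ ⟨x, ⟨hx, hvx⟩, rfl⟩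
      rw [hRx _ _ hvx] at hx
      simp only [hRx _ _ hvx] at hx
      refine lt_of_lt_of_le hx ?_
      have hle : ‖realVec fun j => x (p.succAbove j)‖ ≤ ‖realVec x‖ := by
        rw [pi_norm_le_iff_of_nonneg (norm_nonneg _)]
        exact fun j => norm_le_pi_norm (realVec x) (p.succAbove j)
      refine Real.rpow_le_rpow_of_nonpos (norm_pos_iff.2 (realVec_ne_zero fun h => ?_)) hle
        (by linarith)
      have hx0 := hinj x 0 hvx (by simp) (congrFun h)
      have hx1 : realVec x = 0 := by ext; simp [realVec, hx0]
      rw [hx1, norm_zero, Real.zero_rpow (by linarith)] at hx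
      exact hx.not_ge (by positivity)
    · rintro x ⟨-, hx⟩ y ⟨-, hy⟩ hxy
      exact hinj x y hx hy (congrFun hxy)

end SchmidtSubspace

namespace SchmidtSubspace

lemma abs_le_znorm {m : ℕ} (n : Fin m → ℤ) (i : Fin m) : |(n i : ℝ)| ≤ znorm n := by
  rw [znorm, ← Real.sqrt_sq_eq_abs]
  exact Real.sqrt_le_sqrt (Finset.single_le_sum (f := fun i => ((n i : ℝ)) ^ 2)
    (fun i _ => sq_nonneg _) (Finset.mem_univ i))

/-- The vector obtained from `n` by prepending the nearest integer to a linear form, negated, is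
not much longer than `n`. -/
lemma exists_norm_cons_round_le {m : ℕ} (α : Fin m → ℝ) : ∃ K : ℝ, 1 ≤ K ∧
    ∀ n : Fin m → ℤ, n ≠ 0 → 0 < znorm n ∧
      ‖realVec (Fin.cons (-round (∑ i, α i * (n i : ℝ))) n : Fin (m + 1) → ℤ)‖ ≤ K * znorm n := by
  have hA : 0 ≤ ∑ i, |α i| := Finset.sum_nonneg fun i _ => abs_nonneg _
  refine ⟨∑ i, |α i| + 1, by linarith, fun n hn => ?_⟩
  obtain ⟨j, hj⟩ := Function.ne_iff.1 hn
  have h1 : 1 ≤ znorm n := by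
    refine le_trans ?_ (abs_le_znorm n j)
    exact_mod_cast Int.one_le_abs hj
  refine ⟨by linarith, ?_⟩
  rw [pi_norm_le_iff_of_nonneg (by nlinarith)]
  intro i
  rw [Real.norm_eq_abs, realVec]
  refine Fin.cases ?_ (fun i => ?_) i
  · rw [Fin.cons_zero, Int.cast_neg, abs_neg]
    have h2 : |∑ i, α i * (n i : ℝ)| ≤ (∑ i, |α i|) * znorm n := by
      rw [Finset.sum_mul]
      refine (Finset.abs_sum_le_sum_abs _ _).trans (Finset.sum_le_sum fun i _ => ?_)
      rw [abs_mul]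
      exact mul_le_mul_of_nonneg_left (abs_le_znorm n i) (abs_nonneg _)
    have h3 := abs_le.1 (abs_sub_round (∑ i, α i * (n i : ℝ)))
    have h4 := abs_le.1 h2
    rw [abs_le]
    constructor <;> linarith
  · rw [Fin.cons_succ]
    nlinarith [abs_le_znorm n i]

/-- Prepending a coordinate to a basis of forms gives, with any form having a nonzero new
coordinate, a spanning system. -/
lemma top_le_span_insert_cons {m : ℕ} (α : Fin m → ℝ) {L : Fin m → Fin m → ℝ}
    (hL : LinearIndependent ℝ L) :
    ⊤ ≤ Submodule.span ℝ (insert (Fin.cons 1 α : Fin (m + 1) → ℝ)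
      (Set.range fun k => (Fin.cons 0 (L k) : Fin (m + 1) → ℝ))) := by
  obtain ⟨f, hf⟩ : ∃ f : (Fin m → ℝ) →ₗ[ℝ] (Fin (m + 1) → ℝ), ∀ z, f z = Fin.cons 0 z :=
    ⟨{ toFun := fun z => Fin.cons 0 z
       map_add' := fun y z => by ext i; refine Fin.cases ?_ (fun i => ?_) i <;> simp
       map_smul' := fun a z => by ext i; refine Fin.cases ?_ (fun i => ?_) i <;> simp },
      fun _ => rfl⟩
  have hspan : Submodule.span ℝ (Set.range L) = ⊤ :=
    hL.span_eq_top_of_card_eq_finrank' (by simp)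
  have hcons : ∀ z : Fin m → ℝ, (Fin.cons 0 z : Fin (m + 1) → ℝ) ∈
      Submodule.span ℝ (Set.range fun k => (Fin.cons 0 (L k) : Fin (m + 1) → ℝ)) := fun z => by
    have h1 : (Set.range fun k => (Fin.cons 0 (L k) : Fin (m + 1) → ℝ)) = f '' Set.range L := by
      rw [← Set.range_comp]
      exact congrArg Set.range (funext fun k => (hf (L k)).symm)
    rw [h1, Submodule.span_image, hspan, ← hf]
    exact Submodule.mem_map_of_mem Submodule.mem_top
  intro w _
  have hw : w = w 0 • (Fin.cons 1 α : Fin (m + 1) → ℝ) +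
      Fin.cons 0 fun i => w i.succ - w 0 * α i := by
    ext i
    refine Fin.cases ?_ (fun i => ?_) i <;> simp
  rw [hw]
  exact Submodule.add_mem _ (Submodule.smul_mem _ _ (Submodule.subset_span (Set.mem_insert _ _)))
    (Submodule.span_mono (Set.subset_insert _ _) (hcons _))

end SchmidtSubspace

open SchmidtSubspace in
/-- A form of the subspace theorem of Schmidt: if the real algebraic numbers
`α₁, …, α_{d-1}, 1` are linearly independent over `ℚ` and `L₁, …, L_{d-1}` are linearly
independent linear forms with real algebraic coefficients, then for any `ε > 0` the
inequality `‖α₁n₁+⋯+α_{d-1}n_{d-1}‖ · ∏ (|L_k(n)|+1) < |n|^{-ε}` has only finitely many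
integer solutions `n ∈ ℤ^{d-1}`. -/
theorem schmidt_subspace_form
    {d : ℕ} (hd : 2 ≤ d) (α : Fin (d - 1) → ℝ)
    (halg : ∀ i, IsAlgebraic ℚ (α i))
    (hli : ∀ (q : Fin (d - 1) → ℚ) (q₀ : ℚ),
      (∑ i, (q i : ℝ) * α i) + (q₀ : ℝ) = 0 → q = 0 ∧ q₀ = 0)
    (L : Fin (d - 1) → Fin (d - 1) → ℝ)
    (halgL : ∀ k i, IsAlgebraic ℚ (L k i))
    (hLind : LinearIndependent ℝ L)
    (ε : ℝ) (hε : 0 < ε) :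
    {n : Fin (d - 1) → ℤ |
      nint (∑ i, α i * (n i : ℝ)) * ∏ k, (|∑ i, L k i * (n i : ℝ)| + 1)
        < znorm n ^ (-ε)}.Finite := by
  have hsum₀ : ∀ n : Fin (d - 1) → ℤ, ∀ p : ℤ,
      ∑ j, (Fin.cons 1 α : Fin (d - 1 + 1) → ℝ) j *
        ((Fin.cons p n : Fin (d - 1 + 1) → ℤ) j : ℝ) = p + ∑ i, α i * (n i : ℝ) := fun n p => by
    rw [Fin.sum_univ_succ]
    simp
  have hsum : ∀ n : Fin (d - 1) → ℤ, ∀ p : ℤ, ∀ k,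
      ∑ j, (Fin.cons 0 (L k) : Fin (d - 1 + 1) → ℝ) j *
        ((Fin.cons p n : Fin (d - 1 + 1) → ℤ) j : ℝ) = ∑ i, L k i * (n i : ℝ) := fun n p k => by
    rw [Fin.sum_univ_succ]
    simp
  have hfin := finite_setOf_prod_lt (half_pos hε) (d - 1 + 1)
    (ℓ₀ := Fin.cons 1 α) (ℓ := fun k => Fin.cons 0 (L k))
    (fun j => by
      refine Fin.cases ?_ (fun i => ?_) j
      · exact isAlgebraic_one
      · exact halg i)
    (fun k j => by
      refine Fin.cases ?_ (fun i => ?_) j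
      · exact isAlgebraic_zero
      · exact halgL k i)
    (fun x hx h0 => by
      rw [← Fin.cons_self_tail x, hsum₀] at h0
      obtain ⟨h1, h2⟩ := hli (fun i => Fin.tail x i) (x 0) (by
        rw [← h0, add_comm]
        simp [mul_comm])
      refine hx (funext fun i => ?_)
      refine Fin.cases ?_ (fun i => ?_) i
      · exact_mod_cast h2
      · exact Int.cast_eq_zero.1 (congrFun h1 i))
    (top_le_span_insert_cons α hLind)
  obtain ⟨K, hK, hKn⟩ := exists_norm_cons_round_le α
  refine Set.Finite.of_finite_image (f := fun n : Fin (d - 1) → ℤ =>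
    (Fin.cons (-round (∑ i, α i * (n i : ℝ))) n : Fin (d - 1 + 1) → ℤ))
    (((finite_setOf_norm_realVec_le (K ^ 2)).union hfin).subset ?_)
    fun n _ n' _ h => (Fin.cons_inj.1 h).2
  rintro _ ⟨n, hn, rfl⟩
  rcases eq_or_ne n 0 with rfl | hn0
  · refine Or.inl ((norm_le_zero_iff.2 (funext fun i => ?_)).trans (by positivity))
    refine Fin.cases ?_ (fun i => ?_) i <;> simp [realVec]
  obtain ⟨hz, hxz⟩ := hKn n hn0
  refine or_iff_not_imp_left.2 fun hbig => ?_
  obtain ⟨X, hX⟩ : ∃ X : ℝ, X =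
    ‖realVec (Fin.cons (-round (∑ i, α i * (n i : ℝ))) n : Fin (d - 1 + 1) → ℤ)‖ := ⟨_, rfl⟩
  rw [Set.mem_ofPred_eq, ← hX, not_le] at hbig
  rw [← hX] at hxz
  rw [Set.mem_ofPred_eq, hsum₀, ← hX]
  simp only [hsum]
  rw [Int.cast_neg, neg_add_eq_sub]
  refine lt_of_lt_of_le hn ?_
  have hK0 : 0 < K := by linarith
  have hX0 : 0 < X := lt_trans (by positivity) hbig
  have hsq : X ^ (1 / 2 : ℝ) ≤ znorm n := by
    have h1 : K ≤ X ^ (1 / 2 : ℝ) := by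
      rw [← Real.sqrt_eq_rpow]
      exact Real.le_sqrt_of_sq_le hbig.le
    have h2 : X ^ (1 / 2 : ℝ) * X ^ (1 / 2 : ℝ) = X := by
      rw [← Real.rpow_add hX0]
      norm_num
    nlinarith [Real.rpow_pos_of_pos hX0 (1 / 2)]
  calc znorm n ^ (-ε) ≤ (X ^ (1 / 2 : ℝ)) ^ (-ε) :=
        Real.rpow_le_rpow_of_nonpos (by positivity) hsq (by linarith)
    _ = X ^ (-(ε / 2)) := by
        rw [← Real.rpow_mul hX0.le]
        congr 1
        ring
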